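/- Asymptotic formula for symmetric cylindric partitions: let m ≥ 2 and δ=(δ_j)_{1≤j≤m−1} be a profile, with W_4(δ) = {2m−1} ∪ {2i−1 : δ_i=−1} ∪ {2m−2i : δ_i=1} and W_5(δ) = {2i+2j−2 : i<j, δ_i=δ_j=−1} ∪ {4m−2i−2j : i<j, δ_i=δ_j=1} ∪ {2(2m−1)+2i−2j : i<j, δ_i<δ_j} ∪ {2j−2i : i<j, δ_i>δ_j}. Then the number SCP_δ(n) of symmetric cylindric partitions with profile δ and size n satisfies, as n → ∞, SCP_δ(n) ~ v √(1/(8π)) · r^{b+1/4}/n^{b+3/4} · exp(√(nr)), where r = (m²+m+2)π²/(6(2m−1)), b = Σ_{t∈W_4(δ)}(t/(2(2m−1)) − 1/4) + Σ_{t∈W_5(δ)}(t/(4(2m−1)) − 1/4), and v = 2^{−(Σ_{t∈W_4(δ)} t)/(2m−1) − (m²−3m+2)/4} π^{−(m²−m+2)/4} (2m−1)^{2b} ∏_{t∈W_4(δ)} Γ(t/(2m−1)) ∏_{t∈W_5(δ)} Γ(t/(2(2m−1))). -/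

import Mathlib

open scoped BigOperators

/-- An integer partition: a weakly decreasing, finitely supported sequence of
nonnegative integers. -/
structure Ptn where
  toFun : ℕ →₀ ℕ
  antitone' : ∀ ⦃i j : ℕ⦄, i ≤ j → toFun j ≤ toFun i

namespace Ptn
/-- the `i`-th part (0-indexed) -/
def part (lam : Ptn) (i : ℕ) : ℕ := lam.toFun i
/-- the size `|λ|` -/
def size (lam : Ptn) : ℕ := lam.toFun.sum fun _ k => k
end Ptn

/-- `HStrip μ λ` means `μ ≺ λ`, i.e. `λ/μ` is a horizontal strip:
`λ_i ≥ μ_i ≥ λ_{i+1}` for all `i`. -/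
def HStrip (mu lam : Ptn) : Prop :=
  ∀ i : ℕ, mu.part i ≤ lam.part i ∧ lam.part (i + 1) ≤ mu.part i
/-- `δ` is a `±1`-profile on the indices `1, …, h` -/
def IsProfile (h : ℕ) (δ : ℕ → ℤ) : Prop := ∀ i, 1 ≤ i → i ≤ h → δ i = 1 ∨ δ i = -1

/-- A skew doubled shifted plane partition `ω = (λ^0, …, λ^{m-1})` with profile
`(δ_1, …, δ_{m-1})`: if `δ_{i+1} = 1` then `λ^i ≺ λ^{i+1}`, and if
`δ_{i+1} = -1` then `λ^i ≻ λ^{i+1}`. -/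
def IsDSPP (m : ℕ) (δ : ℕ → ℤ) (L : Fin m → Ptn) : Prop :=
  ∀ (i : ℕ) (hi : i + 1 < m),
    if δ (i + 1) = 1 then HStrip (L ⟨i, Nat.lt_of_succ_lt hi⟩) (L ⟨i + 1, hi⟩)
    else HStrip (L ⟨i + 1, hi⟩) (L ⟨i, Nat.lt_of_succ_lt hi⟩)

/-- the doubled profile `(-δ_h, …, -δ_1, δ_1, …, δ_h)` of the profile
`δ = (δ_1, …, δ_h)` -/
def dblProfile (h : ℕ) (δ : ℕ → ℤ) : ℕ → ℤ :=
  fun j => if j ≤ h then -δ (h + 1 - j) else δ (j - h)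

/-- A symmetric cylindric partition with profile `δ = (δ_1, …, δ_h)`: a skew
doubled shifted plane partition `ω = (λ^h, …, λ^1, λ^0, λ^1, …, λ^h)` (a
palindromic sequence of `2h+1` partitions) with the doubled profile
`(-δ_h, …, -δ_1, δ_1, …, δ_h)`. -/
def IsSCP (h : ℕ) (δ : ℕ → ℤ) (M : Fin (2 * h + 1) → Ptn) : Prop :=
  IsDSPP (2 * h + 1) (dblProfile h δ) M ∧
    ∀ k : Fin (2 * h + 1), M k = M ⟨2 * h - (k : ℕ), by omega⟩

/-- the size `|ω| = |λ^0| + 2 Σ_{i=1}^h |λ^i|` of a symmetric cylindric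
partition -/
noncomputable def scpSize (h : ℕ) (M : Fin (2 * h + 1) → Ptn) : ℕ :=
  (M ⟨h, by omega⟩).size +
    2 * ∑ i : Fin h, (M ⟨h + (i : ℕ) + 1, by have := i.isLt; omega⟩).size

/-- the multiset `W_4(δ) = {2m-1} ∪ {2i-1 : δ_i = -1} ∪ {2m-2i : δ_i = 1}` -/
def W4 (m : ℕ) (δ : ℕ → ℤ) : Multiset ℕ :=
  (2 * m - 1) ::ₘ
    (Finset.Icc 1 (m - 1)).val.map (fun i => if δ i = -1 then 2 * i - 1 else 2 * m - 2 * i)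

/-- the multiset
`W_5(δ) = {2i+2j-2 : i<j, δ_i=δ_j=-1} ∪ {4m-2i-2j : i<j, δ_i=δ_j=1}
          ∪ {2(2m-1)+2i-2j : i<j, δ_i<δ_j} ∪ {2j-2i : i<j, δ_i>δ_j}`,
where `1 ≤ i < j ≤ m-1` -/
def W5 (m : ℕ) (δ : ℕ → ℤ) : Multiset ℕ :=
  ((((Finset.Icc 1 (m - 1)) ×ˢ (Finset.Icc 1 (m - 1))).filter
      (fun q => q.1 < q.2)).val).map
    (fun q =>
      if δ q.1 = -1 ∧ δ q.2 = -1 then 2 * q.1 + 2 * q.2 - 2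
      else if δ q.1 = 1 ∧ δ q.2 = 1 then 4 * m - 2 * q.1 - 2 * q.2
      else if δ q.1 < δ q.2 then 2 * (2 * m - 1) + 2 * q.1 - 2 * q.2
      else 2 * q.2 - 2 * q.1)

/-- `SCPcount m δ n` is the number of symmetric cylindric partitions with
profile `δ = (δ_1, …, δ_{m-1})` and size `n` -/
noncomputable def SCPcount (m : ℕ) (δ : ℕ → ℤ) (n : ℕ) : ℕ :=
  Nat.card {M : Fin (2 * (m - 1) + 1) → Ptn //
    IsSCP (m - 1) δ M ∧ scpSize (m - 1) M = n}

/-- the constant `r = (m²+m+2)π²/(6(2m-1))` -/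
noncomputable def rSCP (m : ℕ) : ℝ :=
  (((m : ℝ) ^ 2 + m + 2) * Real.pi ^ 2) / (6 * (2 * (m : ℝ) - 1))

/-- the constant
`b = Σ_{t ∈ W_4(δ)} (t/(2(2m-1)) - 1/4) + Σ_{t ∈ W_5(δ)} (t/(4(2m-1)) - 1/4)` -/
noncomputable def bSCP (m : ℕ) (δ : ℕ → ℤ) : ℝ :=
  ((W4 m δ).map (fun t => (t : ℝ) / (2 * (2 * (m : ℝ) - 1)) - 1 / 4)).sum +
    ((W5 m δ).map (fun t => (t : ℝ) / (4 * (2 * (m : ℝ) - 1)) - 1 / 4)).sum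

/-- the constant
`v = 2^{-(Σ_{t ∈ W_4(δ)} t)/(2m-1) - (m²-3m+2)/4} π^{-(m²-m+2)/4} (2m-1)^{2b}
       ∏_{t ∈ W_4(δ)} Γ(t/(2m-1)) ∏_{t ∈ W_5(δ)} Γ(t/(2(2m-1)))` -/
noncomputable def vSCP (m : ℕ) (δ : ℕ → ℤ) : ℝ :=
  (2 : ℝ) ^ (-(((W4 m δ).map (fun t => (t : ℝ))).sum / (2 * (m : ℝ) - 1)) -
      ((m : ℝ) ^ 2 - 3 * m + 2) / 4) *
    Real.pi ^ (-(((m : ℝ) ^ 2 - m + 2)) / 4) *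
    (2 * (m : ℝ) - 1) ^ (2 * bSCP m δ) *
    ((W4 m δ).map (fun t => Real.Gamma ((t : ℝ) / (2 * (m : ℝ) - 1)))).prod *
    ((W5 m δ).map (fun t => Real.Gamma ((t : ℝ) / (2 * (2 * (m : ℝ) - 1))))).prod

section QGamma
open Filter Topology

/-- `-log (1 - e^{-u})`, the logarithm of the generating function of one part. -/
noncomputable def partLog (u : ℝ) : ℝ := -Real.log (1 - Real.exp (-u))

/-- The logarithm of `∏_{k ≥ 0} 1 / (1 - e^{-s (x + k)})`. -/
noncomputable def progLog (s x : ℝ) : ℝ := ∑' k : ℕ, partLog (s * (x + k))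

lemma HasSum.of_eq {ι M : Type*} [AddCommMonoid M] [TopologicalSpace M] {f g : ι → M} {a b : M}
    (h : HasSum f a) (hf : ∀ i, g i = f i) (hb : b = a) : HasSum g b := by
  rw [funext hf, hb]; exact h

lemma hasSum_partLog {u : ℝ} (hu : 0 < u) :
    HasSum (fun j : ℕ => Real.exp (-(((j : ℝ) + 1) * u)) / ((j : ℝ) + 1)) (partLog u) := by
  have h1 : |Real.exp (-u)| < 1 := by
    rw [abs_of_pos (Real.exp_pos _), Real.exp_lt_one_iff]; linarith
  refine (Real.hasSum_pow_div_log_of_abs_lt_one h1).of_eq (fun j => ?_) rfl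
  rw [← Real.exp_nat_mul]; push_cast; ring_nf

lemma partLog_nonneg {u : ℝ} (hu : 0 < u) : 0 ≤ partLog u :=
  (hasSum_partLog hu).nonneg fun j => by positivity

lemma partLog_le {u : ℝ} (hu : 0 < u) : partLog u ≤ Real.exp (-u) / (1 - Real.exp (-u)) := by
  have h1 : Real.exp (-u) < 1 := by rw [Real.exp_lt_one_iff]; linarith
  have h2 := Real.one_sub_inv_le_log_of_pos (sub_pos.2 h1)
  have h3 : 0 < 1 - Real.exp (-u) := sub_pos.2 h1
  unfold partLog
  have : Real.exp (-u) / (1 - Real.exp (-u)) = (1 - Real.exp (-u))⁻¹ - 1 := by field_simp; ring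
  linarith

lemma summable_partLog {s x : ℝ} (hs : 0 < s) (hx : 0 < x) :
    Summable fun k : ℕ => partLog (s * (x + k)) := by
  have hsx : 0 < s * x := mul_pos hs hx
  have h1 : Real.exp (-(s * x)) < 1 := by rw [Real.exp_lt_one_iff]; linarith
  have hr : Real.exp (-s) < 1 := by rw [Real.exp_lt_one_iff]; linarith
  refine Summable.of_nonneg_of_le (fun k => partLog_nonneg (by positivity)) (fun k => ?_)
    ((summable_geometric_of_lt_one (Real.exp_pos (-s)).le hr).mul_left
      (Real.exp (-(s * x)) / (1 - Real.exp (-(s * x)))))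
  refine (partLog_le (by positivity)).trans ?_
  have h2 : Real.exp (-(s * (x + k))) = Real.exp (-(s * x)) * Real.exp (-s) ^ k := by
    rw [← Real.exp_nat_mul, ← Real.exp_add]; ring_nf
  have h3 : Real.exp (-(s * (x + k))) ≤ Real.exp (-(s * x)) := by
    apply Real.exp_le_exp.2
    have : 0 ≤ s * (k : ℝ) := by positivity
    linarith
  rw [div_mul_eq_mul_div, ← h2]
  exact div_le_div_of_nonneg_left (Real.exp_pos _).le (sub_pos.2 h1) (by linarith)

lemma progLog_add_one {s x : ℝ} (hs : 0 < s) (hx : 0 < x) :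
    progLog s x = partLog (s * x) + progLog s (x + 1) := by
  unfold progLog
  rw [(summable_partLog hs hx).tsum_eq_zero_add]
  simp only [Nat.cast_zero, add_zero, Nat.cast_add, Nat.cast_one]
  congr 1
  refine tsum_congr fun k => ?_
  ring_nf

lemma convexOn_partLog : ConvexOn ℝ (Set.Ioi 0) partLog := by
  refine ⟨convex_Ioi 0, fun x hx y hy a b ha hb hab => ?_⟩
  simp only [Set.mem_Ioi, smul_eq_mul] at *
  have key : ∀ u : ℝ, 0 < u → 0 < 1 - Real.exp (-u) := fun u hu => by
    have : Real.exp (-u) < 1 := by rw [Real.exp_lt_one_iff]; linarith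
    linarith
  have h1 := convexOn_exp.2 (Set.mem_univ (-x)) (Set.mem_univ (-y)) ha hb hab
  have h2 := strictConcaveOn_log_Ioi.concaveOn.2 (key x hx) (key y hy) ha hb hab
  simp only [smul_eq_mul] at h1 h2
  have h3 : a * (1 - Real.exp (-x)) + b * (1 - Real.exp (-y)) ≤
      1 - Real.exp (-(a * x + b * y)) := by
    have : -(a * x + b * y) = a * -x + b * -y := by ring
    rw [this]; nlinarith
  have h4 : 0 < a * (1 - Real.exp (-x)) + b * (1 - Real.exp (-y)) := by
    have hx' := key x hx
    have hy' := key y hy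
    rcases ha.eq_or_lt with h | h
    · subst h; have : b = 1 := by linarith
      subst this; simpa using hy
    · have := mul_pos h hx'; have := mul_nonneg hb hy'.le; linarith
  have := Real.log_le_log h4 h3
  unfold partLog
  linarith

lemma convexOn_progLog {s : ℝ} (hs : 0 < s) : ConvexOn ℝ (Set.Ioi 0) (progLog s) := by
  refine ⟨convex_Ioi 0, fun x hx y hy a b ha hb hab => ?_⟩
  have hz : a • x + b • y ∈ Set.Ioi (0 : ℝ) := convex_Ioi 0 hx hy ha hb hab
  simp only [Set.mem_Ioi, smul_eq_mul] at *
  unfold progLog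
  rw [← tsum_mul_left, ← tsum_mul_left,
    ← ((summable_partLog hs hx).mul_left a).tsum_add ((summable_partLog hs hy).mul_left b)]
  refine (summable_partLog hs hz).tsum_le_tsum (fun k => ?_)
    (((summable_partLog hs hx).mul_left a).add ((summable_partLog hs hy).mul_left b))
  have := convexOn_partLog.2 (x := s * (x + k)) (y := s * (y + k)) (Set.mem_Ioi.2 (by positivity))
    (Set.mem_Ioi.2 (by positivity)) ha hb hab
  simp only [smul_eq_mul] at this
  convert this using 2
  linear_combination s * (k : ℝ) * (-hab)

/-- The logarithm of the `q`-Gamma function, `q = e^{-s}`, up to a power of `(1 - q) / s`. -/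
noncomputable def logQGamma (s x : ℝ) : ℝ := progLog s x - progLog s 1 - (x - 1) * Real.log s

lemma logQGamma_add_one {s x : ℝ} (hs : 0 < s) (hx : 0 < x) :
    logQGamma s (x + 1) = logQGamma s x + (Real.log (1 - Real.exp (-(s * x))) - Real.log s) := by
  unfold logQGamma
  rw [progLog_add_one hs hx, partLog]; ring

lemma convexOn_logQGamma {s : ℝ} (hs : 0 < s) : ConvexOn ℝ (Set.Ioi 0) (logQGamma s) := by
  have h := (convexOn_progLog hs).2
  refine ⟨convex_Ioi 0, fun x hx y hy a b ha hb hab => ?_⟩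
  have := h hx hy ha hb hab
  simp only [smul_eq_mul, logQGamma] at *
  have hb' : b = 1 - a := by linarith
  subst hb'
  linarith

lemma tendsto_logQGamma_step {x : ℝ} (hx : 0 < x) :
    Tendsto (fun s => Real.log (1 - Real.exp (-(s * x))) - Real.log s) (𝓝[>] 0)
      (𝓝 (Real.log x)) := by
  have h1 : HasDerivAt (fun s : ℝ => 1 - Real.exp (-(s * x))) x 0 := by
    have : HasDerivAt (fun s : ℝ => s * -x) (-x) 0 := by
      simpa using (hasDerivAt_id (0 : ℝ)).mul_const (-x)
    simpa using this.exp.const_sub 1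
  have h2 := (hasDerivAt_iff_tendsto_slope.1 h1).mono_left
    (nhdsWithin_mono 0 (fun s (hs : 0 < s) => (ne_of_gt hs : s ≠ 0)))
  refine ((Real.continuousAt_log hx.ne').tendsto.comp h2).congr' ?_
  filter_upwards [self_mem_nhdsWithin] with s hs
  have hs : 0 < s := hs
  have h3 : Real.exp (-(s * x)) < 1 := by
    rw [Real.exp_lt_one_iff]; have := mul_pos hs hx; linarith
  simp only [Function.comp, slope_def_field, zero_mul, neg_zero, Real.exp_zero, sub_self, sub_zero]
  rw [Real.log_div (by linarith) hs.ne']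

lemma logQGamma_one (s : ℝ) : logQGamma s 1 = 0 := by simp [logQGamma]

lemma tendsto_logQGamma_nat (n : ℕ) :
    ∃ l, Tendsto (fun s => logQGamma s (n + 1)) (𝓝[>] 0) (𝓝 l) := by
  induction n with
  | zero => exact ⟨0, by simp [logQGamma_one]⟩
  | succ n ih =>
    obtain ⟨l, hl⟩ := ih
    refine ⟨_, (hl.add (tendsto_logQGamma_step (x := (n : ℝ) + 1) (by positivity))).congr' ?_⟩
    filter_upwards [self_mem_nhdsWithin] with s hs
    push_cast
    rw [logQGamma_add_one (x := (n : ℝ) + 1) hs (by positivity)]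

lemma eventually_logQGamma_mem_Icc {x : ℝ} (hx : 0 < x) :
    ∃ B, ∀ᶠ s in 𝓝[>] (0 : ℝ), logQGamma s x ∈ Set.Icc (-B) B := by
  have large : ∀ x : ℝ, 2 < x → ∃ B, ∀ᶠ s in 𝓝[>] (0 : ℝ), |logQGamma s x| ≤ B := by
    intro x hx
    obtain ⟨n, hn⟩ := exists_nat_gt x
    obtain ⟨l, hl⟩ := tendsto_logQGamma_nat n
    obtain ⟨l2, hl2⟩ := tendsto_logQGamma_nat 1
    refine ⟨|l| + 1 + (x - 1) * (|l2| + 1), ?_⟩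
    have e1 : ∀ᶠ s in 𝓝[>] (0 : ℝ), |logQGamma s (n + 1)| < |l| + 1 :=
      hl.abs.eventually_lt_const (by linarith)
    have e2 : ∀ᶠ s in 𝓝[>] (0 : ℝ), |logQGamma s ((1 : ℕ) + 1)| < |l2| + 1 :=
      hl2.abs.eventually_lt_const (by linarith)
    filter_upwards [e1, e2, self_mem_nhdsWithin] with s h1 h2 hs
    have hc := convexOn_logQGamma hs
    have c2 : logQGamma s ((1 : ℕ) + 1) = logQGamma s 2 := by norm_num
    rw [c2] at h2
    have hlo := hc.slope_mono_adjacent (x := 1) (y := 2) (z := x) (Set.mem_Ioi.2 one_pos)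
      (Set.mem_Ioi.2 (by linarith)) (by norm_num) hx
    rw [logQGamma_one, div_le_div_iff₀ (by norm_num) (by linarith)] at hlo
    have hhi := hc.le_max_of_mem_Icc (x := 1) (y := (n : ℝ) + 1) (z := x) (Set.mem_Ioi.2 one_pos)
      (Set.mem_Ioi.2 (by positivity)) ⟨by linarith, by linarith⟩
    rw [logQGamma_one] at hhi
    have h1' := abs_lt.1 h1
    have h2' := abs_lt.1 h2
    have hp : 0 ≤ (x - 1) * (|l2| + 1) := by have := abs_nonneg l2; nlinarith
    rw [abs_le]
    constructor
    · have := abs_nonneg l; nlinarith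
    · refine hhi.trans (max_le ?_ ?_)
      · have := abs_nonneg l; linarith
      · linarith
  obtain ⟨B, hB⟩ := large (x + 1 + 1) (by linarith)
  have t1 := tendsto_logQGamma_step hx
  have t2 := tendsto_logQGamma_step (x := x + 1) (by linarith)
  refine ⟨B + (|Real.log x| + 1) + (|Real.log (x + 1)| + 1), ?_⟩
  filter_upwards [hB, t1.abs.eventually_lt_const (lt_add_one _),
    t2.abs.eventually_lt_const (lt_add_one _), self_mem_nhdsWithin] with s hs h1 h2 h0
  have h0 : 0 < s := h0
  rw [logQGamma_add_one h0 (by linarith), logQGamma_add_one h0 hx] at hs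
  have := abs_le.1 hs
  have := abs_lt.1 h1
  have := abs_lt.1 h2
  constructor <;> linarith

theorem tendsto_logQGamma {x : ℝ} (hx : 0 < x) :
    Tendsto (fun s => logQGamma s x) (𝓝[>] 0) (𝓝 (Real.log (Real.Gamma x))) := by
  rw [tendsto_iff_ultrafilter]
  intro g hg
  have hpos : ∀ᶠ s in (g : Filter ℝ), 0 < s := hg self_mem_nhdsWithin
  have hlim : ∀ y : ℝ, ∃ l, 0 < y → Tendsto (fun s => logQGamma s y) g (𝓝 l) := by
    intro y
    by_cases hy : 0 < y
    · obtain ⟨B, hB⟩ := eventually_logQGamma_mem_Icc hy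
      obtain ⟨l, -, hl⟩ := (isCompact_Icc (a := -B) (b := B)).ultrafilter_le_nhds
        (g.map fun s => logQGamma s y) (by
          rw [le_principal_iff]; exact hg hB)
      exact ⟨l, fun _ => hl⟩
    · exact ⟨0, fun h => absurd h hy⟩
  choose G hG using hlim
  have hE : Set.EqOn (fun y => Real.exp (G y)) Real.Gamma (Set.Ioi 0) := by
    apply Real.eq_Gamma_of_log_convex
    · refine ⟨convex_Ioi 0, fun y hy z hz a b ha hb hab => ?_⟩
      simp only [Function.comp, Real.log_exp, smul_eq_mul]
      have hw : a • y + b • z ∈ Set.Ioi (0 : ℝ) := convex_Ioi 0 hy hz ha hb hab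
      refine le_of_tendsto_of_tendsto (hG _ hw) (((hG y hy).const_mul a).add
        ((hG z hz).const_mul b)) ?_
      filter_upwards [hpos] with s hs
      exact (convexOn_logQGamma hs).2 hy hz ha hb hab
    · intro y hy
      have h1 := hG (y + 1) (by linarith)
      have h2 := (hG y hy).add ((tendsto_logQGamma_step hy).mono_left hg)
      have h3 : G (y + 1) = G y + Real.log y := by
        refine tendsto_nhds_unique (h1.congr' ?_) h2
        filter_upwards [hpos] with s hs
        exact logQGamma_add_one hs hy
      simp only [h3, Real.exp_add, Real.exp_log hy]; ring
    · intro y _; exact Real.exp_pos _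
    · have h1 := hG 1 one_pos
      have h3 : G 1 = 0 := by
        refine tendsto_nhds_unique h1 ?_
        simp [logQGamma_one]
      simp [h3]
  have := hE (Set.mem_Ioi.2 hx)
  simp only at this
  rw [← this, Real.log_exp]
  exact hG x hx

lemma progLog_half_add {s : ℝ} (hs : 0 < s) :
    progLog s (1 / 2) + progLog s 1 = progLog (s / 2) 1 := by
  unfold progLog
  have hsum := summable_partLog (s := s / 2) (x := 1) (by linarith) one_pos
  have e1 : (fun k : ℕ => partLog (s * (1 / 2 + k))) =
      fun k : ℕ => partLog (s / 2 * (1 + ((2 * k : ℕ) : ℝ))) := by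
    ext k; push_cast; ring_nf
  have e2 : (fun k : ℕ => partLog (s * (1 + k))) =
      fun k : ℕ => partLog (s / 2 * (1 + ((2 * k + 1 : ℕ) : ℝ))) := by
    ext k; push_cast; ring_nf
  rw [e1, e2]
  exact tsum_even_add_odd (f := fun k : ℕ => partLog (s / 2 * (1 + (k : ℝ))))
    (hsum.comp_injective (i := fun k => 2 * k) fun a b h => by simpa using h)
    (hsum.comp_injective (i := fun k => 2 * k + 1) fun a b h => by simpa using h)

lemma hasSum_exp_mul_succ {u : ℝ} (hu : 0 < u) :
    HasSum (fun k : ℕ => Real.exp (-(u * (1 + k)))) (1 / (Real.exp u - 1)) := by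
  have hr : Real.exp (-u) < 1 := by rw [Real.exp_lt_one_iff]; linarith
  have h := (hasSum_geometric_of_lt_one (Real.exp_pos (-u)).le hr).mul_left (Real.exp (-u))
  refine h.of_eq (fun k => ?_) ?_
  · rw [← Real.exp_nat_mul, ← Real.exp_add]; ring_nf
  · have h1 : 1 < Real.exp u := Real.one_lt_exp_iff.2 hu
    rw [Real.exp_neg]
    have : Real.exp u - 1 ≠ 0 := by linarith
    field_simp

lemma progLog_one_eq {s : ℝ} (hs : 0 < s) :
    progLog s 1 = ∑' j : ℕ, 1 / ((j : ℝ) + 1) * (1 / (Real.exp (s * (j + 1)) - 1)) := by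
  have hr : ∀ k : ℕ, HasSum (fun j : ℕ =>
      Real.exp (-(((j : ℝ) + 1) * (s * (1 + k)))) / ((j : ℝ) + 1))
      (partLog (s * (1 + k))) := fun k => hasSum_partLog (by positivity)
  have hc : ∀ j : ℕ, HasSum (fun k : ℕ =>
      Real.exp (-(((j : ℝ) + 1) * (s * (1 + k)))) / ((j : ℝ) + 1))
      (1 / ((j : ℝ) + 1) * (1 / (Real.exp (s * (j + 1)) - 1))) := fun j => by
    refine ((hasSum_exp_mul_succ (u := s * (j + 1)) (by positivity)).mul_left
      (1 / ((j : ℝ) + 1))).of_eq (fun k => ?_) rfl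
    rw [show ((j : ℝ) + 1) * (s * (1 + k)) = s * (j + 1) * (1 + k) by ring]
    ring
  have hS : Summable (Function.uncurry fun (k j : ℕ) =>
      Real.exp (-(((j : ℝ) + 1) * (s * (1 + k)))) / ((j : ℝ) + 1)) := by
    refine (summable_prod_of_nonneg fun p => by simp only [Function.uncurry]; positivity).2
      ⟨fun k => (hr k).summable, ?_⟩
    simp only [Function.uncurry, (hr _).tsum_eq]
    exact summable_partLog hs one_pos
  have := Summable.tsum_comm' hS (fun k => (hr k).summable) (fun j => (hc j).summable)
  simp only [(hr _).tsum_eq, (hc _).tsum_eq] at this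
  exact this.symm

lemma tendsto_mul_progLog_one :
    Tendsto (fun s => s * progLog s 1) (𝓝[>] 0) (𝓝 (Real.pi ^ 2 / 6)) := by
  have hz : HasSum (fun j : ℕ => 1 / ((j : ℝ) + 1) * (1 / ((j : ℝ) + 1))) (Real.pi ^ 2 / 6) := by
    have := (hasSum_nat_add_iff' 1).2 hasSum_zeta_two
    simp only [Finset.range_one, Finset.sum_singleton, Nat.cast_zero, ne_eq, OfNat.ofNat_ne_zero,
      not_false_eq_true, zero_pow, div_zero, sub_zero] at this
    refine this.of_eq (fun j => ?_) rfl
    push_cast; field_simp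
  rw [← hz.tsum_eq]
  have h := tendsto_tsum_of_dominated_convergence (𝓕 := 𝓝[>] (0 : ℝ))
    (f := fun s (j : ℕ) => 1 / ((j : ℝ) + 1) * (s / (Real.exp (s * (j + 1)) - 1)))
    (g := fun j : ℕ => 1 / ((j : ℝ) + 1) * (1 / ((j : ℝ) + 1))) hz.summable ?_ ?_
  · refine h.congr' ?_
    filter_upwards [self_mem_nhdsWithin] with s hs
    rw [progLog_one_eq hs, ← tsum_mul_left]
    exact tsum_congr fun j => by ring
  · intro j
    refine Tendsto.const_mul _ ?_
    have h1 : HasDerivAt (fun s : ℝ => Real.exp (s * (j + 1)) - 1) ((j : ℝ) + 1) 0 := by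
      have : HasDerivAt (fun s : ℝ => s * ((j : ℝ) + 1)) ((j : ℝ) + 1) 0 := by
        simpa using (hasDerivAt_id (0 : ℝ)).mul_const ((j : ℝ) + 1)
      simpa using this.exp.sub_const 1
    have h2 := (hasDerivAt_iff_tendsto_slope.1 h1).mono_left
      (nhdsWithin_mono 0 (fun s (hs : 0 < s) => (ne_of_gt hs : s ≠ 0)))
    have h3 := h2.inv₀ (by positivity)
    simp only [one_div]
    refine h3.congr fun s => ?_
    simp [slope_def_field]
  · filter_upwards [self_mem_nhdsWithin] with s hs j
    have hs : 0 < s := hs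
    have h1 : s * (j + 1) + 1 ≤ Real.exp (s * (j + 1)) := Real.add_one_le_exp _
    have h2 : 0 < s * ((j : ℝ) + 1) := by positivity
    have h3 : 0 < Real.exp (s * (j + 1)) - 1 := by linarith
    rw [Real.norm_of_nonneg (by positivity)]
    gcongr 1 / ((j : ℝ) + 1) * ?_
    rw [div_le_div_iff₀ h3 (by positivity)]
    linarith

lemma tendsto_zero_of_halving {D ε : ℝ → ℝ} (hD : ∀ s, 0 < s → D (s / 2) = 2 * D s + ε s)
    (hε : Tendsto ε (𝓝[>] 0) (𝓝 0)) (h0 : Tendsto (fun s => s * D s) (𝓝[>] 0) (𝓝 0)) :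
    Tendsto D (𝓝[>] 0) (𝓝 0) := by
  rw [Metric.tendsto_nhdsWithin_nhds] at hε ⊢
  intro η hη
  obtain ⟨d, hd, hε⟩ := hε (η / 2) (by linarith)
  refine ⟨d, hd, fun s hs hsd => ?_⟩
  simp only [Set.mem_Ioi, Real.dist_eq, sub_zero] at *
  have key : ∀ j : ℕ, |D s| ≤ |D (s / 2 ^ j)| / 2 ^ j + η / 2 := by
    intro j
    suffices ∀ j : ℕ, |D s| ≤ |D (s / 2 ^ j)| / 2 ^ j + η / 2 * (1 - 1 / 2 ^ j) from
      (this j).trans (by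
        have : 0 ≤ η / 2 * (1 / 2 ^ j) := by positivity
        linarith)
    intro j
    induction j with
    | zero => simp
    | succ j ih =>
      have hp : 0 < s / 2 ^ j := by positivity
      have hlt : |s / 2 ^ j| < d := by
        rw [abs_of_pos hp]; rw [abs_of_pos hs] at hsd
        exact (div_le_self hs.le (one_le_pow₀ (by norm_num))).trans_lt hsd
      have h1 := hD _ hp
      have h2 := hε hp hlt
      have h3 : |D (s / 2 ^ j)| ≤ |D (s / 2 ^ (j + 1))| / 2 + η / 4 := by
        have e : s / 2 ^ (j + 1) = s / 2 ^ j / 2 := by rw [pow_succ]; field_simp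
        rw [e]
        have : D (s / 2 ^ j) = (D (s / 2 ^ j / 2) - ε (s / 2 ^ j)) / 2 := by linarith
        rw [this, abs_div, abs_two]
        have := abs_sub (D (s / 2 ^ j / 2)) (ε (s / 2 ^ j))
        linarith
      refine ih.trans ?_
      have h4 : |D (s / 2 ^ j)| / 2 ^ j ≤ (|D (s / 2 ^ (j + 1))| / 2 + η / 4) / 2 ^ j := by gcongr
      have h5 : (|D (s / 2 ^ (j + 1))| / 2 + η / 4) / 2 ^ j + η / 2 * (1 - 1 / 2 ^ j) =
          |D (s / 2 ^ (j + 1))| / 2 ^ (j + 1) + η / 2 * (1 - 1 / 2 ^ (j + 1)) := by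
        rw [pow_succ]; field_simp; ring
      linarith
  have hseq : Tendsto (fun j : ℕ => s / 2 ^ j) atTop (𝓝[>] 0) := by
    refine tendsto_nhdsWithin_iff.2 ⟨?_, Eventually.of_forall fun j => by
      simp only [Set.mem_Ioi]; positivity⟩
    have := (tendsto_pow_atTop_nhds_zero_of_lt_one (r := (1 / 2 : ℝ)) (by norm_num)
      (by norm_num)).const_mul s
    simpa [div_eq_mul_inv] using this
  have h1 : Tendsto (fun j : ℕ => |D (s / 2 ^ j)| / 2 ^ j) atTop (𝓝 0) := by
    have h2 := ((h0.comp hseq).abs).div_const s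
    simp only [abs_zero, zero_div] at h2
    refine h2.congr fun j => ?_
    simp only [Function.comp]
    rw [abs_mul, abs_of_pos (show 0 < s / 2 ^ j by positivity)]
    field_simp
  have h2 := ge_of_tendsto' (h1.add_const (η / 2)) key
  linarith

lemma tendsto_mul_log_zero : Tendsto (fun s : ℝ => s * Real.log s) (𝓝[>] 0) (𝓝 0) := by
  have := (Real.continuous_mul_log.tendsto 0).mono_left (nhdsWithin_le_nhds (s := Set.Ioi 0))
  simpa using this

lemma tendsto_progLog_one :
    Tendsto (fun s => progLog s 1 - Real.pi ^ 2 / (6 * s) - 1 / 2 * Real.log s) (𝓝[>] 0)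
      (𝓝 (-(1 / 2 * Real.log (2 * Real.pi)))) := by
  set C := 1 / 2 * Real.log (2 * Real.pi) with hC
  set D : ℝ → ℝ := fun s => progLog s 1 - Real.pi ^ 2 / (6 * s) - 1 / 2 * Real.log s + C with hDdef
  set ε : ℝ → ℝ := fun s => logQGamma s (1 / 2) - 1 / 2 * Real.log Real.pi with hεdef
  have hD : Tendsto D (𝓝[>] 0) (𝓝 0) := by
    apply tendsto_zero_of_halving (ε := ε)
    · intro s hs
      have h := progLog_half_add hs
      have hl : Real.log (s / 2) = Real.log s - Real.log 2 := Real.log_div hs.ne' two_ne_zero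
      have hpi : Real.log (2 * Real.pi) = Real.log 2 + Real.log Real.pi :=
        Real.log_mul two_ne_zero Real.pi_ne_zero
      simp only [hDdef, hεdef, logQGamma, hC, ← h, hl, hpi]
      field_simp
      ring
    · have := (tendsto_logQGamma (x := 1 / 2) (by norm_num)).sub_const (1 / 2 * Real.log Real.pi)
      rw [Real.Gamma_one_half_eq, Real.log_sqrt Real.pi_pos.le] at this
      convert this using 2
      ring
    · have hid : Tendsto (fun s : ℝ => s) (𝓝[>] 0) (𝓝 0) := nhdsWithin_le_nhds
      have := ((tendsto_mul_progLog_one.sub_const (Real.pi ^ 2 / 6)).sub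
        (tendsto_mul_log_zero.const_mul (1 / 2))).add (hid.mul_const C)
      simp only [sub_self, mul_zero, zero_mul, add_zero] at this
      refine this.congr' ?_
      filter_upwards [self_mem_nhdsWithin] with s hs
      have hs : s ≠ 0 := ne_of_gt hs
      simp only [hDdef]
      field_simp
  have := hD.sub_const C
  simp only [zero_sub] at this
  refine this.congr fun s => ?_
  simp only [hDdef]; ring

theorem tendsto_progLog {x : ℝ} (hx : 0 < x) :
    Tendsto (fun s => progLog s x - Real.pi ^ 2 / (6 * s) - (x - 1 / 2) * Real.log s) (𝓝[>] 0)
      (𝓝 (Real.log (Real.Gamma x) - 1 / 2 * Real.log (2 * Real.pi))) := by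
  refine ((tendsto_logQGamma hx).add tendsto_progLog_one).congr fun s => ?_
  unfold logQGamma; ring

end QGamma

section CircleIntegral
open Filter Topology MeasureTheory

/-- The power series with coefficients `A` at `e^{-τ + iθ}`. -/
noncomputable def circSum (A : ℕ → ℝ) (τ θ : ℝ) : ℂ :=
  ∑' N : ℕ, ((A N * Real.exp (-(N * τ)) : ℝ) : ℂ) * Complex.exp (((N * θ : ℝ) : ℂ) * Complex.I)

lemma norm_circSum_term (A : ℕ → ℝ) (τ θ : ℝ) (N : ℕ) :
    ‖((A N * Real.exp (-(N * τ)) : ℝ) : ℂ) * Complex.exp (((N * θ : ℝ) : ℂ) * Complex.I)‖ =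
      |A N * Real.exp (-(N * τ))| := by
  rw [norm_mul, Complex.norm_exp_ofReal_mul_I, mul_one, Complex.norm_real, Real.norm_eq_abs]

lemma hasSum_circSum {A : ℕ → ℝ} {τ : ℝ} (h : Summable fun N : ℕ => A N * Real.exp (-(N * τ)))
    (θ : ℝ) : HasSum (fun N : ℕ => ((A N * Real.exp (-(N * τ)) : ℝ) : ℂ) *
      Complex.exp (((N * θ : ℝ) : ℂ) * Complex.I)) (circSum A τ θ) := by
  refine Summable.hasSum (Summable.of_norm ?_)
  simp only [norm_circSum_term]
  exact h.abs

lemma continuous_circSum {A : ℕ → ℝ} {τ : ℝ}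
    (h : Summable fun N : ℕ => A N * Real.exp (-(N * τ))) : Continuous (circSum A τ) := by
  refine continuous_tsum (u := fun N : ℕ => |A N * Real.exp (-(N * τ))|) (fun N => by fun_prop)
    h.abs fun N θ => (norm_circSum_term A τ θ N).le

lemma circSum_eq_tsum_pow (A : ℕ → ℝ) (τ θ : ℝ) :
    circSum A τ θ = ∑' N : ℕ, (A N : ℂ) * Complex.exp (-τ + θ * Complex.I) ^ N := by
  refine tsum_congr fun N => ?_
  rw [← Complex.exp_nat_mul, Complex.ofReal_mul, Complex.ofReal_exp, mul_assoc, ← Complex.exp_add]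
  push_cast; ring_nf

lemma differentiableOn_tsum_pow {A : ℕ → ℝ} {σ : ℝ}
    (h : Summable fun N : ℕ => A N * Real.exp (-(N * σ))) :
    DifferentiableOn ℂ (fun z : ℂ => ∑' N : ℕ, (A N : ℂ) * z ^ N)
      (Metric.ball 0 (Real.exp (-σ))) := by
  refine Complex.differentiableOn_tsum_of_summable_norm h.abs (fun N => by fun_prop)
    Metric.isOpen_ball fun N w hw => ?_
  rw [mem_ball_zero_iff] at hw
  rw [norm_mul, norm_pow, Complex.norm_real, Real.norm_eq_abs, abs_mul, Real.abs_exp]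
  gcongr
  calc ‖w‖ ^ N ≤ Real.exp (-σ) ^ N := by gcongr
    _ = _ := by rw [← Real.exp_nat_mul]; ring_nf

lemma circSum_eq_exp {a A : ℕ → ℝ} {Ψ : ℝ → ℝ}
    (hΨ : ∀ τ, 0 < τ → HasSum (fun N : ℕ => A N * Real.exp (-(N * τ))) (Ψ τ))
    (ha : ∀ τ, 0 < τ → HasSum (fun N : ℕ => a N * Real.exp (-(N * τ))) (Real.exp (Ψ τ)))
    {τ : ℝ} (hτ : 0 < τ) (θ : ℝ) : circSum a τ θ = Complex.exp (circSum A τ θ) := by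
  have hσ : 0 < τ / 2 := by linarith
  set R := Real.exp (-(τ / 2)) with hR
  have d1 := (differentiableOn_tsum_pow (ha _ hσ).summable).analyticOnNhd Metric.isOpen_ball
  have d2 := (differentiableOn_tsum_pow (hΨ _ hσ).summable).cexp.analyticOnNhd Metric.isOpen_ball
  have hreal : ∀ x : ℝ, x ∈ Set.Ioo 0 1 →
      ∑' N : ℕ, (a N : ℂ) * (x : ℂ) ^ N = Complex.exp (∑' N : ℕ, (A N : ℂ) * (x : ℂ) ^ N) := by
    intro x hx
    have hl : 0 < -Real.log x := by have := Real.log_neg hx.1 hx.2; linarith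
    have e : ∀ N : ℕ, Real.exp (-(N * -Real.log x)) = x ^ N := fun N => by
      rw [mul_neg, neg_neg, Real.exp_nat_mul, Real.exp_log hx.1]
    have h1 := Complex.hasSum_ofReal.2 (ha _ hl)
    have h2 := Complex.hasSum_ofReal.2 (hΨ _ hl)
    simp only [e, Complex.ofReal_mul, Complex.ofReal_pow, Complex.ofReal_exp] at h1 h2
    rw [h1.tsum_eq, h2.tsum_eq]
  have hR0 : 0 < R := Real.exp_pos _
  have hR1 : R < 1 := by rw [hR, Real.exp_lt_one_iff]; linarith
  have hz0 : ((R / 2 : ℝ) : ℂ) ∈ Metric.ball (0 : ℂ) R := by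
    rw [mem_ball_zero_iff, Complex.norm_real, Real.norm_of_nonneg (by positivity)]; linarith
  have hfreq : ∃ᶠ z in 𝓝[≠] ((R / 2 : ℝ) : ℂ),
      (∑' N : ℕ, (a N : ℂ) * z ^ N) = Complex.exp (∑' N : ℕ, (A N : ℂ) * z ^ N) := by
    have ht : Tendsto (fun x : ℝ => (x : ℂ)) (𝓝[≠] (R / 2)) (𝓝[≠] ((R / 2 : ℝ) : ℂ)) :=
      Complex.continuous_ofReal.continuousAt.tendsto.inf
        (tendsto_principal_principal.2 fun x hx => fun h => hx (Complex.ofReal_injective h))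
    refine ht.frequently (Eventually.frequently ?_)
    have : Set.Ioo (0 : ℝ) 1 ∈ 𝓝 (R / 2) := Ioo_mem_nhds (by linarith) (by linarith)
    filter_upwards [mem_nhdsWithin_of_mem_nhds this] with x hx using hreal x hx
  have := d1.eqOn_of_preconnected_of_frequently_eq d2 (convex_ball 0 R).isPreconnected hz0 hfreq
  have hz : Complex.exp (-τ + θ * Complex.I) ∈ Metric.ball (0 : ℂ) R := by
    rw [mem_ball_zero_iff, Complex.norm_exp]
    simp only [Complex.add_re, Complex.neg_re, Complex.ofReal_re, Complex.mul_re, Complex.I_re,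
      mul_zero, Complex.ofReal_im, Complex.I_im, sub_self, add_zero, hR, zero_mul]
    exact Real.exp_lt_exp.2 (by linarith)
  simpa only [circSum_eq_tsum_pow] using this hz

lemma integral_exp_int_mul (m : ℤ) :
    ∫ θ in (-Real.pi)..Real.pi, Complex.exp (((m * θ : ℝ) : ℂ) * Complex.I) =
      if m = 0 then 2 * Real.pi else 0 := by
  split_ifs with h
  · subst h; simp [two_mul]
  · have hc : (m : ℂ) * Complex.I ≠ 0 := mul_ne_zero (by exact_mod_cast h) Complex.I_ne_zero
    have e : ∀ θ : ℝ, Complex.exp (((m * θ : ℝ) : ℂ) * Complex.I) =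
        Complex.exp ((m : ℂ) * Complex.I * θ) := fun θ => by push_cast; ring_nf
    simp only [e]
    rw [integral_exp_mul_complex hc]
    have : Complex.exp ((m : ℂ) * Complex.I * (Real.pi : ℝ)) =
        Complex.exp ((m : ℂ) * Complex.I * ((-Real.pi : ℝ) : ℂ)) := by
      rw [Complex.exp_eq_exp_iff_exists_int]
      exact ⟨m, by push_cast; ring⟩
    rw [this, sub_self, zero_div, Complex.ofReal_zero]

lemma integral_circSum_mul_exp {a : ℕ → ℝ} {τ : ℝ}
    (h : Summable fun N : ℕ => a N * Real.exp (-(N * τ))) (n : ℕ) :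
    ∫ θ in (-Real.pi)..Real.pi, circSum a τ θ * Complex.exp (((-(n * θ) : ℝ) : ℂ) * Complex.I) =
      2 * Real.pi * ((a n * Real.exp (-(n * τ)) : ℝ) : ℂ) := by
  let f : ℕ → C(ℝ, ℂ) := fun N => ⟨fun θ => ((a N * Real.exp (-(N * τ)) : ℝ) : ℂ) *
    Complex.exp ((((N - n : ℤ) * θ : ℝ) : ℂ) * Complex.I), by fun_prop⟩
  have hf : ∀ θ, HasSum (fun N => f N θ)
      (circSum a τ θ * Complex.exp (((-(n * θ) : ℝ) : ℂ) * Complex.I)) := fun θ => by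
    refine ((hasSum_circSum h θ).mul_right _).of_eq (fun N => ?_) rfl
    simp only [f, ContinuousMap.coe_mk]
    rw [mul_assoc, ← Complex.exp_add]
    push_cast; ring_nf
  have hs : Summable fun N => ‖(f N).restrict
      (⟨Set.uIcc (-Real.pi) Real.pi, isCompact_uIcc⟩ : TopologicalSpace.Compacts ℝ)‖ := by
    refine Summable.of_nonneg_of_le (fun _ => norm_nonneg _) (fun N => ?_) h.abs
    refine (ContinuousMap.norm_le _ (abs_nonneg _)).2 fun θ => ?_
    simp only [f, ContinuousMap.restrict_apply, ContinuousMap.coe_mk]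
    rw [norm_mul, Complex.norm_exp_ofReal_mul_I, mul_one, Complex.norm_real, Real.norm_eq_abs]
  have key := intervalIntegral.hasSum_intervalIntegral_of_summable_norm hs
  simp only [(hf _).tsum_eq] at key
  refine key.unique ?_
  refine (hasSum_ite_eq n (2 * Real.pi * ((a n * Real.exp (-(n * τ)) : ℝ) : ℂ))).of_eq
    (fun N => ?_) rfl
  simp only [f, ContinuousMap.coe_mk, intervalIntegral.integral_const_mul, integral_exp_int_mul,
    sub_eq_zero, Nat.cast_inj]
  split_ifs with h
  · subst h; push_cast; ring
  · simp

end CircleIntegral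

section Moments
open Filter Topology MeasureTheory

/-- The moments `∑ A_N N^k e^{-Nτ}`. -/
noncomputable def expMoment (A : ℕ → ℝ) (k : ℕ) (τ : ℝ) : ℝ :=
  ∑' N : ℕ, A N * (N : ℝ) ^ k * Real.exp (-(N * τ))

lemma pow_mul_exp_neg_le (k N : ℕ) {τ : ℝ} (hτ : 0 < τ) :
    (N : ℝ) ^ k * Real.exp (-(N * τ)) ≤ k.factorial * (2 / τ) ^ k * Real.exp (-(N * (τ / 2))) := by
  have h := Real.pow_div_factorial_le_exp (N * (τ / 2)) (by positivity) k
  have hk : (0 : ℝ) < k.factorial := by exact_mod_cast k.factorial_pos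
  rw [div_le_iff₀ hk] at h
  have e1 : (N : ℝ) ^ k = (2 / τ) ^ k * (N * (τ / 2)) ^ k := by
    rw [← mul_pow]; congr 1; field_simp
  have e2 : Real.exp (-(N * (τ / 2))) = Real.exp (N * (τ / 2)) * Real.exp (-(N * τ)) := by
    rw [← Real.exp_add]; ring_nf
  rw [e1, e2]
  calc (2 / τ) ^ k * (N * (τ / 2)) ^ k * Real.exp (-(N * τ))
      ≤ (2 / τ) ^ k * (Real.exp (N * (τ / 2)) * k.factorial) * Real.exp (-(N * τ)) := by gcongr
    _ = _ := by ring

section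
variable {A : ℕ → ℝ} {Ψ : ℝ → ℝ}

lemma hasSum_expMoment (hA : ∀ N, 0 ≤ A N)
    (hΨ : ∀ τ, 0 < τ → HasSum (fun N : ℕ => A N * Real.exp (-(N * τ))) (Ψ τ)) (k : ℕ)
    {τ : ℝ} (hτ : 0 < τ) :
    HasSum (fun N : ℕ => A N * (N : ℝ) ^ k * Real.exp (-(N * τ))) (expMoment A k τ) := by
  refine Summable.hasSum (Summable.of_nonneg_of_le (fun N => ?_) (fun N => ?_)
    ((hΨ (τ / 2) (by linarith)).summable.mul_left (k.factorial * (2 / τ) ^ k)))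
  · have := hA N; positivity
  · have := mul_le_mul_of_nonneg_left (pow_mul_exp_neg_le k N hτ) (hA N)
    linarith

lemma expMoment_nonneg (hA : ∀ N, 0 ≤ A N) (k : ℕ) (τ : ℝ) : 0 ≤ expMoment A k τ :=
  tsum_nonneg fun N => by have := hA N; positivity

lemma expMoment_le (hA : ∀ N, 0 ≤ A N)
    (hΨ : ∀ τ, 0 < τ → HasSum (fun N : ℕ => A N * Real.exp (-(N * τ))) (Ψ τ)) (k : ℕ)
    {τ : ℝ} (hτ : 0 < τ) : expMoment A k τ ≤ k.factorial * (2 / τ) ^ k * Ψ (τ / 2) := by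
  refine hasSum_le (fun N => ?_) (hasSum_expMoment hA hΨ k hτ)
    ((hΨ (τ / 2) (by linarith)).mul_left (k.factorial * (2 / τ) ^ k))
  have := mul_le_mul_of_nonneg_left (pow_mul_exp_neg_le k N hτ) (hA N)
  linarith

lemma abs_exp_sub_taylor_le (x : ℝ) :
    |Real.exp x - 1 - x - x ^ 2 / 2| ≤ |x| ^ 3 * Real.exp |x| := by
  have h := Complex.norm_exp_sub_sum_le_norm_mul_exp (x : ℂ) 3
  have e : Complex.exp (x : ℂ) - ∑ m ∈ Finset.range 3, (x : ℂ) ^ m / m.factorial =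
      ((Real.exp x - 1 - x - x ^ 2 / 2 : ℝ) : ℂ) := by
    simp [Finset.sum_range_succ, Nat.factorial]; ring
  rwa [e, Complex.norm_real, Complex.norm_real, Real.norm_eq_abs, Real.norm_eq_abs] at h

lemma norm_exp_mul_I_sub_taylor_le (x : ℝ) :
    ‖Complex.exp ((x : ℂ) * Complex.I) - 1 - x * Complex.I + x ^ 2 / 2‖ ≤ 4 * |x| ^ 3 := by
  by_cases hx : |x| ≤ 1
  · have h := Complex.norm_exp_sub_sum_le_norm_mul_exp ((x : ℂ) * Complex.I) 3
    have e : Complex.exp ((x : ℂ) * Complex.I) -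
        ∑ m ∈ Finset.range 3, ((x : ℂ) * Complex.I) ^ m / m.factorial =
        Complex.exp ((x : ℂ) * Complex.I) - 1 - x * Complex.I + x ^ 2 / 2 := by
      simp [Finset.sum_range_succ, Nat.factorial, mul_pow]; ring
    rw [e, norm_mul, Complex.norm_I, mul_one, Complex.norm_real, Real.norm_eq_abs] at h
    have h1 : Real.exp |x| ≤ 4 := by
      have := Real.exp_le_exp.2 hx
      have := Real.exp_one_lt_d9
      linarith
    have h2 : 0 ≤ |x| ^ 3 := by positivity
    nlinarith
  · push Not at hx
    have h1 : ‖Complex.exp ((x : ℂ) * Complex.I) - 1 - x * Complex.I + x ^ 2 / 2‖ ≤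
        1 + 1 + |x| + |x| ^ 2 / 2 := by
      refine (norm_add_le _ _).trans (add_le_add ((norm_sub_le _ _).trans (add_le_add
        ((norm_sub_le _ _).trans (add_le_add ?_ ?_)) ?_)) ?_)
      · rw [Complex.norm_exp_ofReal_mul_I]
      · simp
      · simp
      · simp
    have h2 : |x| ≤ |x| ^ 3 := by nlinarith [sq_nonneg (|x|)]
    have h3 : |x| ^ 2 ≤ |x| ^ 3 := by nlinarith [sq_nonneg (|x|)]
    linarith

lemma abs_shift_sub_taylor_le (hA : ∀ N, 0 ≤ A N)
    (hΨ : ∀ τ, 0 < τ → HasSum (fun N : ℕ => A N * Real.exp (-(N * τ))) (Ψ τ))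
    {τ d : ℝ} (hτ : 0 < τ) (hd : |d| ≤ τ / 2) :
    |Ψ (τ - d) - Ψ τ - d * expMoment A 1 τ - d ^ 2 / 2 * expMoment A 2 τ| ≤
      |d| ^ 3 * expMoment A 3 (τ / 2) := by
  have hd' := abs_le.1 hd
  have hs := (((hΨ (τ - d) (by linarith)).sub (hΨ τ hτ)).sub
    ((hasSum_expMoment hA hΨ 1 hτ).mul_left d)).sub
    ((hasSum_expMoment hA hΨ 2 hτ).mul_left (d ^ 2 / 2))
  refine hs.norm_le_of_bounded ((hasSum_expMoment hA hΨ 3 (half_pos hτ)).mul_left (|d| ^ 3))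
    fun N => ?_
  have e1 : Real.exp (-(N * (τ - d))) = Real.exp (-(N * τ)) * Real.exp (N * d) := by
    rw [← Real.exp_add]; ring_nf
  have e : A N * Real.exp (-(N * (τ - d))) - A N * Real.exp (-(N * τ)) -
      d * (A N * (N : ℝ) ^ 1 * Real.exp (-(N * τ))) -
      d ^ 2 / 2 * (A N * (N : ℝ) ^ 2 * Real.exp (-(N * τ))) =
      A N * Real.exp (-(N * τ)) * (Real.exp (N * d) - 1 - N * d - (N * d) ^ 2 / 2) := by
    rw [e1]; ring
  rw [e, Real.norm_eq_abs, abs_mul, abs_of_nonneg (mul_nonneg (hA N) (Real.exp_pos _).le)]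
  have hN : |(N : ℝ) * d| = N * |d| := by rw [abs_mul, Nat.abs_cast]
  calc A N * Real.exp (-(N * τ)) * |Real.exp (N * d) - 1 - N * d - (N * d) ^ 2 / 2|
      ≤ A N * Real.exp (-(N * τ)) * ((N * |d|) ^ 3 * Real.exp (N * |d|)) := by
        have := abs_exp_sub_taylor_le (N * d)
        rw [hN] at this
        exact mul_le_mul_of_nonneg_left this (mul_nonneg (hA N) (Real.exp_pos _).le)
    _ = |d| ^ 3 * (A N * (N : ℝ) ^ 3 * (Real.exp (-(N * τ)) * Real.exp (N * |d|))) := by ring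
    _ ≤ |d| ^ 3 * (A N * (N : ℝ) ^ 3 * Real.exp (-(N * (τ / 2)))) := by
        have h0 := hA N
        rw [← Real.exp_add]
        gcongr
        have : (N : ℝ) * |d| ≤ N * (τ / 2) := by gcongr
        linarith

lemma norm_circSum_sub_taylor_le (hA : ∀ N, 0 ≤ A N)
    (hΨ : ∀ τ, 0 < τ → HasSum (fun N : ℕ => A N * Real.exp (-(N * τ))) (Ψ τ))
    {τ : ℝ} (hτ : 0 < τ) (θ : ℝ) :
    ‖circSum A τ θ - Ψ τ - Complex.I * θ * expMoment A 1 τ + θ ^ 2 / 2 * expMoment A 2 τ‖ ≤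
      4 * |θ| ^ 3 * expMoment A 3 τ := by
  have hs := (((hasSum_circSum (hΨ τ hτ).summable θ).sub (Complex.hasSum_ofReal.2 (hΨ τ hτ))).sub
    ((Complex.hasSum_ofReal.2 (hasSum_expMoment hA hΨ 1 hτ)).mul_left (Complex.I * θ))).add
    ((Complex.hasSum_ofReal.2 (hasSum_expMoment hA hΨ 2 hτ)).mul_left ((θ : ℂ) ^ 2 / 2))
  refine hs.norm_le_of_bounded ((hasSum_expMoment hA hΨ 3 hτ).mul_left (4 * |θ| ^ 3))
    fun N => ?_
  have h := norm_exp_mul_I_sub_taylor_le (N * θ)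
  have e : ((A N * Real.exp (-(N * τ)) : ℝ) : ℂ) * Complex.exp (((N * θ : ℝ) : ℂ) * Complex.I) -
      ((A N * Real.exp (-(N * τ)) : ℝ) : ℂ) -
      Complex.I * θ * ((A N * (N : ℝ) ^ 1 * Real.exp (-(N * τ)) : ℝ) : ℂ) +
      (θ : ℂ) ^ 2 / 2 * ((A N * (N : ℝ) ^ 2 * Real.exp (-(N * τ)) : ℝ) : ℂ) =
      ((A N * Real.exp (-(N * τ)) : ℝ) : ℂ) * (Complex.exp (((N * θ : ℝ) : ℂ) * Complex.I) - 1 -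
        ((N * θ : ℝ) : ℂ) * Complex.I + ((N * θ : ℝ) : ℂ) ^ 2 / 2) := by
    push_cast; ring
  rw [e, norm_mul, Complex.norm_real,
    Real.norm_of_nonneg (mul_nonneg (hA N) (Real.exp_pos _).le)]
  refine (mul_le_mul_of_nonneg_left h (mul_nonneg (hA N) (Real.exp_pos _).le)).trans (le_of_eq ?_)
  rw [abs_mul, Nat.abs_cast]; ring

variable {c B C : ℝ}

lemma tendsto_mul_of_expansion
    (hasy : Tendsto (fun τ => Ψ τ - c / τ - B * Real.log τ) (𝓝[>] 0) (𝓝 C)) :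
    Tendsto (fun τ => τ * Ψ τ) (𝓝[>] 0) (𝓝 c) := by
  have hid : Tendsto (fun s : ℝ => s) (𝓝[>] 0) (𝓝 0) := nhdsWithin_le_nhds
  have h := ((hid.mul hasy).add (tendsto_mul_log_zero.const_mul B)).add_const c
  simp only [zero_mul, mul_zero, zero_add] at h
  refine h.congr' ?_
  filter_upwards [self_mem_nhdsWithin] with τ hτ
  have : τ ≠ 0 := ne_of_gt hτ
  field_simp
  ring

lemma tendsto_sq_nhdsGT_zero : Tendsto (fun w : ℝ => w ^ 2) (𝓝[>] 0) (𝓝[>] 0) := by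
  refine tendsto_nhdsWithin_iff.2 ⟨?_, ?_⟩
  · have : Tendsto (fun w : ℝ => w ^ 2) (𝓝 0) (𝓝 (0 ^ 2)) := (continuous_pow 2).tendsto 0
    simpa using this.mono_left nhdsWithin_le_nhds
  · filter_upwards [self_mem_nhdsWithin] with w hw
    exact pow_pos (Set.mem_Ioi.1 hw) 2

lemma tendsto_mul_const_nhdsGT_zero {k : ℝ} (hk : 0 < k) :
    Tendsto (fun w : ℝ => w * k) (𝓝[>] 0) (𝓝[>] 0) := by
  refine tendsto_nhdsWithin_iff.2 ⟨?_, ?_⟩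
  · have : Tendsto (fun w : ℝ => w * k) (𝓝 0) (𝓝 (0 * k)) := (continuous_mul_const k).tendsto 0
    simpa using this.mono_left nhdsWithin_le_nhds
  · filter_upwards [self_mem_nhdsWithin] with w hw
    exact mul_pos (Set.mem_Ioi.1 hw) hk

lemma tendsto_third_moment (hA : ∀ N, 0 ≤ A N)
    (hΨ : ∀ τ, 0 < τ → HasSum (fun N : ℕ => A N * Real.exp (-(N * τ))) (Ψ τ))
    (hasy : Tendsto (fun τ => Ψ τ - c / τ - B * Real.log τ) (𝓝[>] 0) (𝓝 C)) {k : ℝ} (hk : 0 < k) :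
    Tendsto (fun w => w ^ 9 * expMoment A 3 (w ^ 2 * k)) (𝓝[>] 0) (𝓝 0) := by
  have h1 := (tendsto_mul_of_expansion hasy).comp
    ((tendsto_mul_const_nhdsGT_zero (show 0 < k / 2 by linarith)).comp tendsto_sq_nhdsGT_zero)
  have hid : Tendsto (fun s : ℝ => s) (𝓝[>] 0) (𝓝 0) := nhdsWithin_le_nhds
  have h2 := (hid.mul h1).mul_const (6 * (2 / k) ^ 3 * (2 / k))
  simp only [zero_mul] at h2
  refine tendsto_of_tendsto_of_tendsto_of_le_of_le' tendsto_const_nhds h2 ?_ ?_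
  · filter_upwards [self_mem_nhdsWithin] with w hw
    have hw : 0 < w := hw
    have := expMoment_nonneg hA 3 (w ^ 2 * k)
    positivity
  · filter_upwards [self_mem_nhdsWithin] with w hw
    have hw : 0 < w := hw
    have := mul_le_mul_of_nonneg_left (expMoment_le hA hΨ 3 (τ := w ^ 2 * k) (by positivity))
      (pow_pos hw 9).le
    refine this.trans (le_of_eq ?_)
    simp only [Function.comp, Nat.factorial]
    rw [show w ^ 2 * k / 2 = w ^ 2 * (k / 2) by ring]
    field_simp
    push_cast
    ring

lemma tendsto_shift (hA : ∀ N, 0 ≤ A N)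
    (hΨ : ∀ τ, 0 < τ → HasSum (fun N : ℕ => A N * Real.exp (-(N * τ))) (Ψ τ))
    (hasy : Tendsto (fun τ => Ψ τ - c / τ - B * Real.log τ) (𝓝[>] 0) (𝓝 C))
    {σ : ℝ} (hσ : σ ^ 2 = 1) :
    Tendsto (fun w => σ * (w ^ 3 * expMoment A 1 (w ^ 2) - c / w) +
      w ^ 6 * expMoment A 2 (w ^ 2) / 2) (𝓝[>] 0) (𝓝 c) := by
  have hid : Tendsto (fun s : ℝ => s) (𝓝[>] 0) (𝓝 0) := nhdsWithin_le_nhds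
  have habs : |σ| = 1 := by rw [← sq_eq_sq₀ (abs_nonneg _) zero_le_one, sq_abs, hσ, one_pow]
  have hu : Tendsto (fun w : ℝ => 1 - σ * w) (𝓝[>] 0) (𝓝 1) := by
    simpa using (hid.const_mul σ).const_sub 1
  have hsmall : ∀ᶠ w in 𝓝[>] (0 : ℝ), w < 1 / 2 := hid.eventually_lt_const (by norm_num)
  have hpos : ∀ᶠ w in 𝓝[>] (0 : ℝ), 0 < w := self_mem_nhdsWithin
  have hupos : ∀ᶠ w in 𝓝[>] (0 : ℝ), 0 < 1 - σ * w := hu.eventually_const_lt (by norm_num)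
  have hw2 := tendsto_sq_nhdsGT_zero
  have hτ' : Tendsto (fun w : ℝ => w ^ 2 - σ * w ^ 3) (𝓝[>] 0) (𝓝[>] 0) := by
    refine tendsto_nhdsWithin_iff.2 ⟨?_, ?_⟩
    · have := (tendsto_nhdsWithin_iff.1 hw2).1.mul hu
      simp only [zero_mul] at this
      exact this.congr fun w => by ring
    · filter_upwards [hpos, hupos] with w h1 h2
      have := mul_pos (pow_pos h1 2) h2
      simp only [Set.mem_Ioi]; linarith
  have hrem : Tendsto (fun w => Ψ (w ^ 2 - σ * w ^ 3) - Ψ (w ^ 2) -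
      σ * w ^ 3 * expMoment A 1 (w ^ 2) - (σ * w ^ 3) ^ 2 / 2 * expMoment A 2 (w ^ 2))
      (𝓝[>] 0) (𝓝 0) := by
    refine squeeze_zero_norm' ?_ (tendsto_third_moment hA hΨ hasy (k := 1 / 2) (by norm_num))
    filter_upwards [hpos, hsmall] with w h1 h2
    have ha : |σ * w ^ 3| = w ^ 3 := by rw [abs_mul, habs, one_mul, abs_of_pos (pow_pos h1 3)]
    have := abs_shift_sub_taylor_le hA hΨ (τ := w ^ 2) (d := σ * w ^ 3) (pow_pos h1 2) (by
      rw [ha]; nlinarith [pow_pos h1 2])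
    rw [ha] at this
    refine this.trans (le_of_eq ?_)
    rw [show w ^ 2 / 2 = w ^ 2 * (1 / 2) by ring]; ring
  have hlog : Tendsto (fun w : ℝ => B * Real.log (1 - σ * w)) (𝓝[>] 0) (𝓝 0) := by
    have := ((Real.continuousAt_log one_ne_zero).tendsto.comp hu).const_mul B
    simpa using this
  have hc : Tendsto (fun w : ℝ => c / (1 - σ * w)) (𝓝[>] 0) (𝓝 c) := by
    simpa [div_eq_mul_inv] using (hu.inv₀ one_ne_zero).const_mul c
  have key := ((((hasy.comp hτ').sub (hasy.comp hw2)).sub hrem).add hlog).add hc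
  simp only [sub_self, zero_add] at key
  refine key.congr' ?_
  filter_upwards [hpos, hupos] with w h1 h2
  simp only [Function.comp]
  have e : w ^ 2 - σ * w ^ 3 = w ^ 2 * (1 - σ * w) := by ring
  rw [e, Real.log_mul (pow_pos h1 2).ne' h2.ne']
  have hw0 : w ≠ 0 := h1.ne'
  have e2 : c / (w ^ 2 * (1 - σ * w)) = c / w ^ 2 + σ * c / w + c / (1 - σ * w) := by
    obtain ⟨u, hu'⟩ : ∃ u, u = 1 - σ * w := ⟨_, rfl⟩
    rw [← hu'] at h2 ⊢
    have := h2.ne'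
    field_simp
    rw [hu']
    linear_combination (c * w ^ 2) * hσ
  rw [e2, mul_pow, hσ]
  ring

lemma tendsto_first_moment (hA : ∀ N, 0 ≤ A N)
    (hΨ : ∀ τ, 0 < τ → HasSum (fun N : ℕ => A N * Real.exp (-(N * τ))) (Ψ τ))
    (hasy : Tendsto (fun τ => Ψ τ - c / τ - B * Real.log τ) (𝓝[>] 0) (𝓝 C)) :
    Tendsto (fun w => w ^ 3 * expMoment A 1 (w ^ 2) - c / w) (𝓝[>] 0) (𝓝 0) := by
  have := ((tendsto_shift hA hΨ hasy (σ := 1) (by norm_num)).sub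
    (tendsto_shift hA hΨ hasy (σ := -1) (by norm_num))).div_const 2
  simp only [sub_self, zero_div] at this
  exact this.congr fun w => by ring

lemma tendsto_second_moment (hA : ∀ N, 0 ≤ A N)
    (hΨ : ∀ τ, 0 < τ → HasSum (fun N : ℕ => A N * Real.exp (-(N * τ))) (Ψ τ))
    (hasy : Tendsto (fun τ => Ψ τ - c / τ - B * Real.log τ) (𝓝[>] 0) (𝓝 C)) :
    Tendsto (fun w => w ^ 6 * expMoment A 2 (w ^ 2) / 2) (𝓝[>] 0) (𝓝 c) := by
  have := ((tendsto_shift hA hΨ hasy (σ := 1) (by norm_num)).add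
    (tendsto_shift hA hΨ hasy (σ := -1) (by norm_num))).div_const 2
  simp only [add_self_div_two] at this
  exact this.congr fun w => by ring

lemma tendsto_circSum_scaled (hA : ∀ N, 0 ≤ A N)
    (hΨ : ∀ τ, 0 < τ → HasSum (fun N : ℕ => A N * Real.exp (-(N * τ))) (Ψ τ))
    (hasy : Tendsto (fun τ => Ψ τ - c / τ - B * Real.log τ) (𝓝[>] 0) (𝓝 C)) (y : ℝ) :
    Tendsto (fun w : ℝ => circSum A (w ^ 2) (w ^ 3 * y) - Ψ (w ^ 2) -
      ((c * y / w : ℝ) : ℂ) * Complex.I) (𝓝[>] 0) (𝓝 (-(c * y ^ 2 : ℝ) : ℂ)) := by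
  have h3 := tendsto_third_moment hA hΨ hasy one_pos
  have hrem : Tendsto (fun w : ℝ => circSum A (w ^ 2) (w ^ 3 * y) - Ψ (w ^ 2) -
      Complex.I * ((w ^ 3 * y : ℝ) : ℂ) * expMoment A 1 (w ^ 2) +
      ((w ^ 3 * y : ℝ) : ℂ) ^ 2 / 2 * expMoment A 2 (w ^ 2)) (𝓝[>] 0) (𝓝 0) := by
    have h3' := h3.mul_const (4 * |y| ^ 3)
    rw [zero_mul] at h3'
    refine squeeze_zero_norm' ?_ h3'
    filter_upwards [self_mem_nhdsWithin] with w hw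
    have hw : 0 < w := hw
    refine (norm_circSum_sub_taylor_le hA hΨ (pow_pos hw 2) (w ^ 3 * y)).trans (le_of_eq ?_)
    rw [abs_mul, abs_of_pos (pow_pos hw 3), mul_one]; ring
  have h1 := (Complex.continuous_ofReal.tendsto _).comp
    ((tendsto_first_moment hA hΨ hasy).mul_const y)
  have h2 := (Complex.continuous_ofReal.tendsto _).comp
    ((tendsto_second_moment hA hΨ hasy).mul_const (y ^ 2))
  have key := (hrem.add (h1.mul_const Complex.I)).sub h2
  simp only [zero_mul, Complex.ofReal_zero, zero_add, zero_sub] at key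
  refine key.congr fun w => ?_
  simp only [Function.comp]
  push_cast
  ring
end

end Moments

section SaddlePoint
open Filter Topology MeasureTheory

section
variable {A a : ℕ → ℝ} {Ψ : ℝ → ℝ} {c B C κ τ₀ : ℝ}

/-- The integrand of the circle method after rescaling the angle by `w ^ 3`, at radius
`e^{-w ^ 2}`. -/
noncomputable def scaledIntegrand (A : ℕ → ℝ) (Ψ : ℝ → ℝ) (c w y : ℝ) : ℂ :=
  Complex.exp (circSum A (w ^ 2) (w ^ 3 * y) - Ψ (w ^ 2) - ((c * y / w : ℝ) : ℂ) * Complex.I)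

lemma continuous_scaledIntegrand
    (hΨ : ∀ τ, 0 < τ → HasSum (fun N : ℕ => A N * Real.exp (-(N * τ))) (Ψ τ)) {w : ℝ}
    (hw : 0 < w) : Continuous (scaledIntegrand A Ψ c w) := by
  have := continuous_circSum (hΨ (w ^ 2) (pow_pos hw 2)).summable
  unfold scaledIntegrand
  fun_prop

lemma re_circSum_sub
    (hΨ : ∀ τ, 0 < τ → HasSum (fun N : ℕ => A N * Real.exp (-(N * τ))) (Ψ τ)) {τ : ℝ}
    (hτ : 0 < τ) (θ : ℝ) : (circSum A τ θ - Ψ τ).re =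
      -∑' N : ℕ, A N * Real.exp (-(N * τ)) * (1 - Real.cos (N * θ)) := by
  have h := Complex.hasSum_re ((Complex.hasSum_ofReal.2 (hΨ τ hτ)).sub
    (hasSum_circSum (hΨ τ hτ).summable θ))
  rw [← neg_sub, Complex.neg_re, ← h.tsum_eq]
  congr 1
  refine tsum_congr fun N => ?_
  rw [Complex.sub_re, Complex.re_ofReal_mul, Complex.exp_ofReal_mul_I_re, Complex.ofReal_re]
  ring

lemma exp_neg_div_le {w y : ℝ} (hκ : 0 < κ) (hw : 0 < w) (hy : |w ^ 3 * y| ≤ Real.pi) :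
    Real.exp (-(κ * (y ^ 2 / (1 + w ^ 2 * y ^ 2)))) ≤
      (2 + 48 * (1 + Real.pi ^ 2) / κ ^ 3) * (1 + y ^ 2)⁻¹ := by
  set x := κ * (y ^ 2 / (1 + w ^ 2 * y ^ 2)) with hx
  have hx0 : 0 ≤ x := by positivity
  have hK : 0 ≤ 48 * (1 + Real.pi ^ 2) / κ ^ 3 := by positivity
  have hy2 : 0 < 1 + y ^ 2 := by positivity
  rw [← div_eq_mul_inv, le_div_iff₀ hy2]
  rcases le_total (y ^ 2) 1 with h1 | h1
  · have : Real.exp (-x) ≤ 1 := Real.exp_le_one_iff.2 (by linarith)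
    nlinarith [Real.exp_pos (-x)]
  · have h6 : w ^ 6 * y ^ 2 ≤ Real.pi ^ 2 := by
      have := sq_le_sq' (by linarith [abs_nonneg (w ^ 3 * y), Real.pi_pos]) hy
      rw [sq_abs] at this
      linarith [this, show (w ^ 3 * y) ^ 2 = w ^ 6 * y ^ 2 by ring]
    have hD : (1 + w ^ 2 * y ^ 2) ^ 3 ≤ 4 * (1 + Real.pi ^ 2) * y ^ 4 := by
      have e : (1 + w ^ 2 * y ^ 2) ^ 3 ≤ 4 * (1 + (w ^ 2 * y ^ 2) ^ 3) := by
        have hz : 0 ≤ w ^ 2 * y ^ 2 := by positivity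
        nlinarith [mul_nonneg (add_nonneg zero_le_one hz) (sq_nonneg (1 - w ^ 2 * y ^ 2))]
      have e' : (w ^ 2 * y ^ 2) ^ 3 ≤ Real.pi ^ 2 * y ^ 4 := by
        have := mul_le_mul_of_nonneg_right h6 (show 0 ≤ y ^ 4 by positivity)
        linarith [this, show (w ^ 2 * y ^ 2) ^ 3 = w ^ 6 * y ^ 2 * y ^ 4 by ring]
      have e'' : (1 : ℝ) ≤ y ^ 4 := by nlinarith
      linarith
    have hx3 : κ ^ 3 * y ^ 2 / (4 * (1 + Real.pi ^ 2)) ≤ x ^ 3 := by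
      rw [hx, mul_pow, div_pow, mul_div_assoc]
      refine mul_le_mul_of_nonneg_left ?_ (by positivity)
      rw [div_le_div_iff₀ (by positivity) (by positivity)]
      nlinarith [mul_le_mul_of_nonneg_left hD (sq_nonneg y)]
    have he := Real.pow_div_factorial_le_exp x hx0 3
    simp only [Nat.factorial] at he
    push_cast at he
    have hinv : Real.exp (-x) * Real.exp x = 1 := by rw [← Real.exp_add]; simp
    have hge : κ ^ 3 * y ^ 2 / (24 * (1 + Real.pi ^ 2)) ≤ Real.exp x := by
      refine le_trans (le_of_eq ?_) ((div_le_div_of_nonneg_right hx3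
        (by norm_num : (0 : ℝ) ≤ 6)).trans he)
      field_simp
      ring
    have h2 : Real.exp (-x) * (κ ^ 3 * y ^ 2 / (24 * (1 + Real.pi ^ 2))) ≤ 1 := by
      have := mul_le_mul_of_nonneg_left hge (Real.exp_pos (-x)).le
      rwa [hinv] at this
    have h3 : Real.exp (-x) * y ^ 2 ≤ 24 * (1 + Real.pi ^ 2) / κ ^ 3 := by
      rw [le_div_iff₀ (by positivity)]
      rw [← mul_div_assoc, div_le_one (by positivity)] at h2
      linarith
    have h4 : Real.exp (-x) * (1 + y ^ 2) ≤ 2 * (Real.exp (-x) * y ^ 2) := by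
      nlinarith [Real.exp_pos (-x)]
    refine h4.trans ?_
    rw [show 48 * (1 + Real.pi ^ 2) / κ ^ 3 = 2 * (24 * (1 + Real.pi ^ 2) / κ ^ 3) by ring]
    linarith

lemma norm_scaledIntegrand_le
    (hΨ : ∀ τ, 0 < τ → HasSum (fun N : ℕ => A N * Real.exp (-(N * τ))) (Ψ τ)) (hκ : 0 < κ)
    (hdom : ∀ τ, 0 < τ → τ < τ₀ → ∀ θ, |θ| ≤ Real.pi → κ * (θ ^ 2 / (τ * (τ ^ 2 + θ ^ 2))) ≤
      ∑' N : ℕ, A N * Real.exp (-(N * τ)) * (1 - Real.cos (N * θ)))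
    {w y : ℝ} (hw : 0 < w) (hwτ : w ^ 2 < τ₀) (hy : |w ^ 3 * y| ≤ Real.pi) :
    ‖scaledIntegrand A Ψ c w y‖ ≤
      (2 + 48 * (1 + Real.pi ^ 2) / κ ^ 3) * (1 + y ^ 2)⁻¹ := by
  refine le_trans ?_ (exp_neg_div_le hκ hw hy)
  rw [scaledIntegrand, Complex.norm_exp, Complex.sub_re, re_circSum_sub hΨ (pow_pos hw 2),
    Complex.re_ofReal_mul, Complex.I_re, mul_zero, sub_zero, Real.exp_le_exp, neg_le_neg_iff]
  refine le_trans (le_of_eq ?_) (hdom (w ^ 2) (pow_pos hw 2) hwτ _ hy)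
  have : (1 + w ^ 2 * y ^ 2) ≠ 0 := by positivity
  rw [show w ^ 2 * ((w ^ 2) ^ 2 + (w ^ 3 * y) ^ 2) = w ^ 6 * (1 + w ^ 2 * y ^ 2) by ring,
    show (w ^ 3 * y) ^ 2 = w ^ 6 * y ^ 2 by ring, mul_div_mul_left _ _ (pow_pos hw 6).ne']

lemma tendsto_integral_scaled (hA : ∀ N, 0 ≤ A N)
    (hΨ : ∀ τ, 0 < τ → HasSum (fun N : ℕ => A N * Real.exp (-(N * τ))) (Ψ τ))
    (hasy : Tendsto (fun τ => Ψ τ - c / τ - B * Real.log τ) (𝓝[>] 0) (𝓝 C))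
    (hκ : 0 < κ) (hτ₀ : 0 < τ₀)
    (hdom : ∀ τ, 0 < τ → τ < τ₀ → ∀ θ, |θ| ≤ Real.pi → κ * (θ ^ 2 / (τ * (τ ^ 2 + θ ^ 2))) ≤
      ∑' N : ℕ, A N * Real.exp (-(N * τ)) * (1 - Real.cos (N * θ))) :
    Tendsto (fun w : ℝ => ∫ y in (-(Real.pi / w ^ 3))..(Real.pi / w ^ 3),
      scaledIntegrand A Ψ c w y) (𝓝[>] 0) (𝓝 (Real.sqrt (Real.pi / c) : ℝ)) := by
  have hpos : ∀ᶠ w in 𝓝[>] (0 : ℝ), 0 < w := self_mem_nhdsWithin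
  have hsmall : ∀ᶠ w in 𝓝[>] (0 : ℝ), w ^ 2 < τ₀ :=
    (tendsto_nhdsWithin_iff.1 tendsto_sq_nhdsGT_zero).1.eventually_lt_const hτ₀
  have hlim : Tendsto (fun w : ℝ => Real.pi / w ^ 3) (𝓝[>] 0) atTop := by
    have h3 : Tendsto (fun w : ℝ => w ^ 3) (𝓝[>] 0) (𝓝[>] 0) := by
      refine tendsto_nhdsWithin_iff.2 ⟨?_, ?_⟩
      · have : Tendsto (fun w : ℝ => w ^ 3) (𝓝 0) (𝓝 (0 ^ 3)) := (continuous_pow 3).tendsto 0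
        simpa using this.mono_left nhdsWithin_le_nhds
      · filter_upwards [hpos] with w hw using pow_pos hw 3
    simpa only [div_eq_mul_inv, Function.comp] using
      (tendsto_inv_nhdsGT_zero.comp h3).const_mul_atTop Real.pi_pos
  have key := tendsto_integral_filter_of_dominated_convergence (μ := volume)
    (F := fun w : ℝ => (Set.Ioc (-(Real.pi / w ^ 3)) (Real.pi / w ^ 3)).indicator
      (scaledIntegrand A Ψ c w)) (f := fun y : ℝ => Complex.exp (-(c * y ^ 2 : ℝ) : ℂ))
    (l := 𝓝[>] (0 : ℝ)) (fun y => (2 + 48 * (1 + Real.pi ^ 2) / κ ^ 3) * (1 + y ^ 2)⁻¹)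
    ?_ ?_ (integrable_inv_one_add_sq.const_mul _) ?_
  · have e : ∫ y : ℝ, Complex.exp (-(c * y ^ 2 : ℝ) : ℂ) = (Real.sqrt (Real.pi / c) : ℝ) := by
      rw [← integral_gaussian, ← integral_complex_ofReal]
      congr 1; ext y; push_cast; ring_nf
    rw [e] at key
    refine key.congr' ?_
    filter_upwards [hpos] with w hw
    have : 0 < Real.pi / w ^ 3 := by positivity
    rw [integral_indicator measurableSet_Ioc, intervalIntegral.integral_of_le (by linarith)]
  · filter_upwards [hpos] with w hw
    exact ((continuous_scaledIntegrand hΨ hw).aestronglyMeasurable).indicator measurableSet_Ioc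
  · filter_upwards [hpos, hsmall] with w hw hw'
    refine Eventually.of_forall fun y => ?_
    rw [Set.indicator_apply]
    split_ifs with h
    · refine norm_scaledIntegrand_le hΨ hκ hdom hw hw' ?_
      have hy : |y| ≤ Real.pi / w ^ 3 := abs_le.2 ⟨h.1.le, h.2⟩
      rw [abs_mul, abs_of_pos (pow_pos hw 3)]
      rw [le_div_iff₀ (pow_pos hw 3)] at hy
      linarith
    · rw [norm_zero]; positivity
  · refine Eventually.of_forall fun y => ?_
    have h := (Complex.continuous_exp.tendsto _).comp (tendsto_circSum_scaled hA hΨ hasy y)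
    refine h.congr' ?_
    filter_upwards [hlim.eventually_gt_atTop |y|] with w hw
    rw [Set.indicator_of_mem (Set.mem_Ioc.2 ⟨(abs_lt.1 hw).1, (abs_lt.1 hw).2.le⟩)]
    rfl

lemma coeff_eq_integral
    (hΨ : ∀ τ, 0 < τ → HasSum (fun N : ℕ => A N * Real.exp (-(N * τ))) (Ψ τ))
    (ha : ∀ τ, 0 < τ → HasSum (fun N : ℕ => a N * Real.exp (-(N * τ))) (Real.exp (Ψ τ)))
    {w : ℝ} (hw : 0 < w) {n : ℕ} (hn : (n : ℝ) = c / w ^ 4) :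
    ((2 * Real.pi * a n / (Real.exp (c / w ^ 2 + Ψ (w ^ 2)) * w ^ 3) : ℝ) : ℂ) =
      ∫ y in (-(Real.pi / w ^ 3))..(Real.pi / w ^ 3), scaledIntegrand A Ψ c w y := by
  have hw2 := pow_pos hw 2
  have hw3 := pow_pos hw 3
  have h := integral_circSum_mul_exp (ha (w ^ 2) hw2).summable n
  have hs := intervalIntegral.integral_comp_mul_left (a := -(Real.pi / w ^ 3))
    (b := Real.pi / w ^ 3) (fun θ => circSum a (w ^ 2) θ *
      Complex.exp (((-(n * θ) : ℝ) : ℂ) * Complex.I)) hw3.ne'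
  rw [mul_neg, mul_div_cancel₀ _ hw3.ne', h] at hs
  have hi : ∀ y : ℝ, circSum a (w ^ 2) (w ^ 3 * y) *
      Complex.exp (((-(n * (w ^ 3 * y)) : ℝ) : ℂ) * Complex.I) =
      ((Real.exp (Ψ (w ^ 2)) : ℝ) : ℂ) * scaledIntegrand A Ψ c w y := by
    intro y
    have e : -(n * (w ^ 3 * y)) = -(c * y / w) := by rw [hn]; field_simp
    rw [circSum_eq_exp hΨ ha hw2, scaledIntegrand, e, Complex.ofReal_exp, ← Complex.exp_add,
      ← Complex.exp_add]
    congr 1; push_cast; ring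
  simp only [hi] at hs
  rw [intervalIntegral.integral_const_mul] at hs
  have hne : ((Real.exp (Ψ (w ^ 2)) : ℝ) : ℂ) ≠ 0 := by
    exact_mod_cast (Real.exp_pos _).ne'
  rw [← mul_right_inj' hne, hs, Complex.real_smul]
  have e : (n : ℝ) * w ^ 2 = c / w ^ 2 := by rw [hn]; field_simp
  rw [e, Real.exp_add, Real.exp_neg]
  have : (w : ℂ) ≠ 0 := by exact_mod_cast hw.ne'
  have h1 := Complex.exp_ne_zero (c / w ^ 2 : ℝ)
  push_cast at hne h1 ⊢
  field_simp

/-- Saddle point asymptotics of the coefficients of `exp (Ψ τ)` as a power series in `e^{-τ}`. -/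
theorem tendsto_coeff_div (hA : ∀ N, 0 ≤ A N)
    (hΨ : ∀ τ, 0 < τ → HasSum (fun N : ℕ => A N * Real.exp (-(N * τ))) (Ψ τ))
    (ha : ∀ τ, 0 < τ → HasSum (fun N : ℕ => a N * Real.exp (-(N * τ))) (Real.exp (Ψ τ)))
    (hasy : Tendsto (fun τ => Ψ τ - c / τ - B * Real.log τ) (𝓝[>] 0) (𝓝 C))
    (hc : 0 < c) (hκ : 0 < κ) (hτ₀ : 0 < τ₀)
    (hdom : ∀ τ, 0 < τ → τ < τ₀ → ∀ θ, |θ| ≤ Real.pi → κ * (θ ^ 2 / (τ * (τ ^ 2 + θ ^ 2))) ≤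
      ∑' N : ℕ, A N * Real.exp (-(N * τ)) * (1 - Real.cos (N * θ))) :
    Tendsto (fun n : ℕ => a n / (Real.exp C * Real.sqrt (Real.pi / c) / (2 * Real.pi) *
      (c / n) ^ (B / 2 + 3 / 4) * Real.exp (2 * Real.sqrt (c * n)))) atTop (𝓝 1) := by
  set w : ℕ → ℝ := fun n => (c / n) ^ (1 / 4 : ℝ) with hw
  have hcn : ∀ n : ℕ, 0 < n → 0 < c / n := fun n hn => div_pos hc (by exact_mod_cast hn)
  have hwpos : ∀ n : ℕ, 0 < n → 0 < w n := fun n hn => Real.rpow_pos_of_pos (hcn n hn) _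
  have hlim : Tendsto w atTop (𝓝[>] 0) := by
    refine tendsto_nhdsWithin_iff.2 ⟨?_, ?_⟩
    · have := (tendsto_const_div_atTop_nhds_zero_nat c).rpow_const (p := 1 / 4)
        (Or.inr (by norm_num))
      rwa [Real.zero_rpow (by norm_num)] at this
    · filter_upwards [eventually_gt_atTop 0] with n hn using hwpos n hn
  have h1 := (tendsto_integral_scaled hA hΨ hasy hκ hτ₀ hdom).comp hlim
  have h2 := (Real.continuous_exp.tendsto _).comp ((hasy.comp tendsto_sq_nhdsGT_zero).comp hlim)
  have h1' := (Complex.continuous_re.tendsto _).comp h1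
  have hsq : 0 < Real.sqrt (Real.pi / c) := Real.sqrt_pos.2 (div_pos Real.pi_pos hc)
  have key := (h1'.mul h2).div_const (Real.sqrt (Real.pi / c) * Real.exp C)
  rw [Complex.ofReal_re, div_self (mul_pos hsq (Real.exp_pos C)).ne'] at key
  refine key.congr' ?_
  filter_upwards [eventually_gt_atTop 0] with n hn
  have hn' : (0 : ℝ) < n := by exact_mod_cast hn
  have hwn := hwpos n hn
  have hx := hcn n hn
  have hpow : ∀ k : ℕ, w n ^ k = (c / n) ^ ((k : ℝ) / 4) := fun k => by
    rw [hw, ← Real.rpow_natCast, ← Real.rpow_mul hx.le]; congr 1; ring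
  have hw4 : w n ^ 4 = c / n := by rw [hpow]; norm_num
  have hw2 : w n ^ 2 = Real.sqrt (c / n) := by rw [hpow, Real.sqrt_eq_rpow]; norm_num
  have hn4 : (n : ℝ) = c / w n ^ 4 := by rw [hw4]; field_simp
  have hsqrt : c / w n ^ 2 = Real.sqrt (c * n) := by
    rw [hw2, div_eq_iff (Real.sqrt_pos.2 hx).ne', ← Real.sqrt_mul (by positivity)]
    rw [show c * n * (c / n) = c ^ 2 by field_simp, Real.sqrt_sq hc.le]
  simp only [Function.comp]
  rw [← coeff_eq_integral hΨ ha hwn hn4, Complex.ofReal_re]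
  have hlogw : Real.log (w n ^ 2) = Real.log (c / n) / 2 := by
    rw [hw2, Real.log_sqrt hx.le]
  have hw3 : w n ^ 3 = Real.exp (3 / 4 * Real.log (c / n)) := by
    rw [hpow, Real.rpow_def_of_pos hx]; congr 1; push_cast; ring
  rw [hlogw, hw3, hsqrt, Real.rpow_def_of_pos hx, Real.exp_add, Real.exp_sub, Real.exp_sub,
    show Real.log (c / n) * (B / 2 + 3 / 4) = B * (Real.log (c / n) / 2) +
      3 / 4 * Real.log (c / n) by ring, Real.exp_add, two_mul (Real.sqrt _), Real.exp_add]
  have p1 := Real.exp_pos (Real.sqrt (c * n))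
  have p2 := Real.exp_pos (Ψ (w n ^ 2))
  have p3 := Real.exp_pos (B * (Real.log (c / n) / 2))
  have p4 := Real.exp_pos (3 / 4 * Real.log (c / n))
  have p5 := Real.exp_pos C
  have p6 := Real.pi_pos
  generalize Real.exp (Real.sqrt (c * n)) = x1 at *
  generalize Real.exp (Ψ (w n ^ 2)) = x2 at *
  generalize Real.exp (B * (Real.log (c / n) / 2)) = x3 at *
  generalize Real.exp (3 / 4 * Real.log (c / n)) = x4 at *
  generalize Real.exp C = x5 at *
  generalize Real.sqrt (Real.pi / c) = x6 at *
  field_simp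
end

end SaddlePoint

section AngleBound
open Filter Topology

section
lemma sq_div_five_le_one_sub_cos {x : ℝ} (hx : |x| ≤ Real.pi) : x ^ 2 / 5 ≤ 1 - Real.cos x := by
  have h := Real.cos_le_one_sub_mul_cos_sq hx
  have hpi : Real.pi ^ 2 ≤ 10 := by nlinarith [Real.pi_lt_d2, Real.pi_pos]
  have : x ^ 2 / 5 ≤ 2 / Real.pi ^ 2 * x ^ 2 := by
    rw [div_mul_eq_mul_div, div_le_div_iff₀ (by norm_num) (by positivity)]
    nlinarith [sq_nonneg x]
  linarith

lemma hasSum_pow_mul_one_sub_cos {q : ℝ} (hq0 : 0 < q) (hq1 : q < 1) (x : ℝ) :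
    HasSum (fun k : ℕ => q ^ (k + 1) * (1 - Real.cos ((k + 1 : ℕ) * x)))
      (q * (1 + q) * (1 - Real.cos x) /
        ((1 - q) * ((1 - q) ^ 2 + 2 * q * (1 - Real.cos x)))) := by
  set z : ℂ := q * Complex.exp (x * Complex.I) with hz
  have hn : ‖z‖ < 1 := by
    rw [hz, norm_mul, Complex.norm_exp_ofReal_mul_I, mul_one, Complex.norm_real,
      Real.norm_of_nonneg hq0.le]
    exact hq1
  have h1 := Complex.hasSum_re (hasSum_geometric_of_norm_lt_one hn)
  have h2 := (hasSum_geometric_of_lt_one hq0.le hq1).sub h1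
  have hX : Real.cos x ≤ 1 := Real.cos_le_one x
  have hD : 0 < (1 - q) ^ 2 + 2 * q * (1 - Real.cos x) := by
    have := mul_nonneg hq0.le (sub_nonneg.2 hX)
    have := pow_pos (sub_pos.2 hq1) 2
    linarith
  have hre : ((1 - z)⁻¹).re = (1 - q + q * (1 - Real.cos x)) /
      ((1 - q) ^ 2 + 2 * q * (1 - Real.cos x)) := by
    have hzre : z.re = q * Real.cos x := by
      rw [hz, Complex.re_ofReal_mul, Complex.exp_ofReal_mul_I_re]
    have hzim : z.im = q * Real.sin x := by
      rw [hz, Complex.im_ofReal_mul, Complex.exp_ofReal_mul_I_im]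
    have hns : Complex.normSq (1 - z) = (1 - q) ^ 2 + 2 * q * (1 - Real.cos x) := by
      rw [Complex.normSq_apply, Complex.sub_re, Complex.sub_im, hzre, hzim, Complex.one_re,
        Complex.one_im]
      linear_combination q ^ 2 * Real.sin_sq_add_cos_sq x
    rw [Complex.inv_re, hns, Complex.sub_re, hzre, Complex.one_re]
    congr 1; ring
  have hterm : ∀ k : ℕ, q ^ k - (z ^ k).re = q ^ k * (1 - Real.cos (k * x)) := by
    intro k
    have : z ^ k = ((q ^ k : ℝ) : ℂ) * Complex.exp ((k * x : ℝ) * Complex.I) := by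
      rw [hz, mul_pow, ← Complex.exp_nat_mul]; push_cast; ring_nf
    rw [this, Complex.re_ofReal_mul, Complex.exp_ofReal_mul_I_re]; ring
  simp only [hterm] at h2
  rw [hre] at h2
  have h3 := (hasSum_nat_add_iff' 1).2 h2
  simp only [Finset.range_one, Finset.sum_singleton, Nat.cast_zero, zero_mul, Real.cos_zero,
    sub_self, mul_zero, sub_zero] at h3
  refine h3.of_eq (fun _ => rfl) ?_
  have h1q := (sub_pos.2 hq1).ne'
  rw [inv_eq_one_div, div_sub_div _ _ h1q hD.ne', div_left_inj' (mul_ne_zero h1q hD.ne')]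
  ring

lemma one_sub_cos_sub_le (x y : ℝ) :
    1 - Real.cos (x - y) ≤ 2 * (1 - Real.cos x) + 2 * (1 - Real.cos y) := by
  rw [Real.cos_sub]
  nlinarith [sq_nonneg (Real.cos x + Real.cos y - 2), sq_nonneg (Real.sin x + Real.sin y),
    Real.sin_sq_add_cos_sq x, Real.sin_sq_add_cos_sq y]

variable {A : ℕ → ℝ}

lemma hasSum_mul_one_sub_cos (hA : ∀ N, 0 ≤ A N) {τ : ℝ}
    (hs : Summable fun N : ℕ => A N * Real.exp (-(N * τ))) (θ : ℝ) :
    HasSum (fun N : ℕ => A N * Real.exp (-(N * τ)) * (1 - Real.cos (N * θ)))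
      (∑' N : ℕ, A N * Real.exp (-(N * τ)) * (1 - Real.cos (N * θ))) := by
  refine Summable.hasSum (Summable.of_nonneg_of_le (fun N => ?_) (fun N => ?_) (hs.mul_right 2))
  · exact mul_nonneg (mul_nonneg (hA N) (Real.exp_pos _).le) (by linarith [Real.cos_le_one (N * θ)])
  · exact mul_le_mul_of_nonneg_left (by linarith [Real.neg_one_le_cos (N * θ)])
      (mul_nonneg (hA N) (Real.exp_pos _).le)

lemma one_third_le_exp_neg {x : ℝ} (hx : x ≤ 1) : 1 / 3 ≤ Real.exp (-x) := by
  have h : Real.exp (-1) ≤ Real.exp (-x) := Real.exp_le_exp.2 (by linarith)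
  have := Real.exp_one_lt_d9
  rw [Real.exp_neg] at h
  refine le_trans ?_ h
  rw [one_div, inv_le_inv₀ (by norm_num) (Real.exp_pos 1)]
  linarith

lemma le_tsum_of_small_angle (hA : ∀ N, 0 ≤ A N) {T : ℕ} (hT : 0 < T)
    (h0 : ∀ k, 1 ≤ A (T * (k + 1))) {τ : ℝ} (hτ : 0 < τ) (hτ1 : T * τ ≤ 1)
    (hs : Summable fun N : ℕ => A N * Real.exp (-(N * τ))) {θ : ℝ} (hθ : |T * θ| ≤ Real.pi) :
    1 / (15 * T) * (θ ^ 2 / (τ * (τ ^ 2 + θ ^ 2))) ≤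
      ∑' N : ℕ, A N * Real.exp (-(N * τ)) * (1 - Real.cos (N * θ)) := by
  have hT' : (0 : ℝ) < T := by exact_mod_cast hT
  set q := Real.exp (-(T * τ)) with hq
  have hq0 : 0 < q := Real.exp_pos _
  have hTτ : 0 < T * τ := mul_pos hT' hτ
  have hq1 : q < 1 := by
    rw [hq, ← Real.exp_zero]; exact Real.exp_lt_exp.2 (by linarith)
  have hq3 : 1 / 3 ≤ q := one_third_le_exp_neg hτ1
  have hq1' : 1 - q ≤ T * τ := by linarith [Real.add_one_le_exp (-(T * τ))]
  have hle := hasSum_le_inj (fun k : ℕ => T * (k + 1))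
    (fun i j h => by
      have := Nat.eq_of_mul_eq_mul_left hT h
      omega)
    (fun N _ => mul_nonneg (mul_nonneg (hA N) (Real.exp_pos _).le)
      (by linarith [Real.cos_le_one (N * θ)]))
    (fun k => ?_) (hasSum_pow_mul_one_sub_cos hq0 hq1 (T * θ)) (hasSum_mul_one_sub_cos hA hs θ)
  · refine le_trans ?_ hle
    have hX := sq_div_five_le_one_sub_cos hθ
    set X := 1 - Real.cos (T * θ) with hXdef
    rcases eq_or_ne θ 0 with rfl | hθ0
    · simp [hXdef]
    have hθ2 : 0 < θ ^ 2 := by positivity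
    have hX0 : 0 < X := lt_of_lt_of_le (by positivity) hX
    have h1q : 0 < 1 - q := by linarith
    have hden : (1 - q) * ((1 - q) ^ 2 + 2 * q * X) ≤ (T * τ) * ((T * τ) ^ 2 + 2 * X) := by
      have e1 : (1 - q) ^ 2 ≤ (T * τ) ^ 2 := pow_le_pow_left₀ h1q.le hq1' 2
      have e2 : 2 * q * X ≤ 2 * X := by nlinarith
      exact mul_le_mul hq1' (by linarith) (by positivity) hTτ.le
    have hnum : 1 / 3 * X ≤ q * (1 + q) * X :=
      mul_le_mul_of_nonneg_right (by nlinarith) hX0.le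
    refine le_trans ?_ (div_le_div₀ (by positivity) hnum (by positivity) hden)
    rw [one_div_mul_eq_div, div_div, div_le_div_iff₀ (by positivity) (by positivity)]
    have hX2 : T ^ 2 * θ ^ 2 ≤ 5 * X := by linarith [show (T * θ) ^ 2 = T ^ 2 * θ ^ 2 by ring]
    have e : 0 ≤ (T : ℝ) * τ * (τ ^ 2 * (5 * X - T ^ 2 * θ ^ 2) + 3 * θ ^ 2 * X) := by
      have := sub_nonneg.2 hX2
      positivity
    linarith
  · have e : q ^ (k + 1) = Real.exp (-((T * (k + 1) : ℕ) * τ)) := by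
      rw [hq, ← Real.exp_nat_mul]; congr 1; push_cast; ring
    rw [e, show ((T * (k + 1) : ℕ) : ℝ) * θ = (k + 1 : ℕ) * (T * θ) by push_cast; ring]
    refine mul_le_mul_of_nonneg_right ?_ (by linarith [Real.cos_le_one ((k + 1 : ℕ) * (T * θ))])
    have := mul_le_mul_of_nonneg_right (h0 k) (Real.exp_pos (-((T * (k + 1) : ℕ) * τ))).le
    linarith

lemma le_tsum_of_large_angle (hA : ∀ N, 0 ≤ A N) {T : ℕ} (hT : 0 < T) {φ : ℕ → ℕ}
    (hφ : Function.Injective φ)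
    (hφT : ∀ k, φ k = T * (k + 1) + 1 ∨ φ k + 1 = T * (k + 1))
    (h0 : ∀ k, 1 ≤ A (T * (k + 1))) (h1 : ∀ k, 1 ≤ A (φ k)) {τ : ℝ} (hτ : 0 < τ)
    (hτ1 : (T + 1) * τ ≤ 1) (hs : Summable fun N : ℕ => A N * Real.exp (-(N * τ))) (θ : ℝ) :
    1 / (12 * T) * ((1 - Real.cos θ) / τ) ≤
      ∑' N : ℕ, A N * Real.exp (-(N * τ)) * (1 - Real.cos (N * θ)) := by
  have hT' : (0 : ℝ) < T := by exact_mod_cast hT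
  have hD := hasSum_mul_one_sub_cos hA hs θ
  set D := ∑' N : ℕ, A N * Real.exp (-(N * τ)) * (1 - Real.cos (N * θ))
  have hf0 : ∀ N : ℕ, 0 ≤ A N * Real.exp (-(N * τ)) * (1 - Real.cos (N * θ)) := fun N =>
    mul_nonneg (mul_nonneg (hA N) (Real.exp_pos _).le) (by linarith [Real.cos_le_one (N * θ)])
  have hinj : Function.Injective fun k : ℕ => T * (k + 1) := fun i j h => by
    have := Nat.eq_of_mul_eq_mul_left hT h
    omega
  have hsub : ∀ ψ : ℕ → ℕ, Function.Injective ψ →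
      ∃ S, HasSum (fun k => A (ψ k) * Real.exp (-(ψ k * τ)) * (1 - Real.cos (ψ k * θ))) S ∧
        S ≤ D := fun ψ hψ =>
    ⟨_, (hD.summable.comp_injective hψ).hasSum,
      hasSum_le_inj ψ hψ (fun N _ => hf0 N) (fun _ => le_rfl)
        (hD.summable.comp_injective hψ).hasSum hD⟩
  obtain ⟨S₁, hS₁, hS₁D⟩ := hsub _ hinj
  obtain ⟨S₂, hS₂, hS₂D⟩ := hsub _ hφ
  set q := Real.exp (-(T * τ)) with hq
  have hq0 : 0 < q := Real.exp_pos _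
  have hTτ : 0 < T * τ := mul_pos hT' hτ
  have hq1 : q < 1 := by
    rw [hq, ← Real.exp_zero]; exact Real.exp_lt_exp.2 (by linarith)
  have hq1' : 1 - q ≤ T * τ := by linarith [Real.add_one_le_exp (-(T * τ))]
  have hc : 0 ≤ 1 - Real.cos θ := by linarith [Real.cos_le_one θ]
  have hgeo := (hasSum_geometric_of_lt_one hq0.le hq1).mul_left
    (Real.exp (-((T + 1) * τ)) * (1 - Real.cos θ))
  have hmono : ∀ N k : ℕ, N ≤ T * (k + 1) + 1 → 1 ≤ A N →
      Real.exp (-((T + 1) * τ)) * q ^ k * (1 - Real.cos (N * θ)) ≤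
        A N * Real.exp (-(N * τ)) * (1 - Real.cos (N * θ)) := by
    intro N k hN hAN
    refine mul_le_mul_of_nonneg_right ?_ (by linarith [Real.cos_le_one (N * θ)])
    have e : Real.exp (-((T + 1) * τ)) * q ^ k ≤ Real.exp (-(N * τ)) := by
      rw [hq, ← Real.exp_nat_mul, ← Real.exp_add, Real.exp_le_exp]
      have : (N : ℝ) ≤ T * (k + 1) + 1 := by exact_mod_cast hN
      nlinarith
    exact e.trans (by nlinarith [Real.exp_pos (-(N * τ))])
  have hle := hasSum_le (fun k => ?_) hgeo ((hS₁.add hS₂).mul_left 2)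
  · have h4 : Real.exp (-((T + 1) * τ)) * (1 - Real.cos θ) * (1 - q)⁻¹ ≤ 4 * D := by linarith
    have h5 : 1 / 3 * (1 - Real.cos θ) * (T * τ)⁻¹ ≤ 4 * D := by
      refine le_trans ?_ h4
      have := one_third_le_exp_neg hτ1
      have h1q : 0 < 1 - q := by linarith
      gcongr
    have e : 1 / (12 * T) * ((1 - Real.cos θ) / τ) =
        1 / 4 * (1 / 3 * (1 - Real.cos θ) * (T * τ)⁻¹) := by
      field_simp; ring
    rw [e]; linarith
  · have hk0 := hmono (T * (k + 1)) k (by omega) (h0 k)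
    have hk1 := hmono (φ k) k (by rcases hφT k with h | h <;> omega) (h1 k)
    have hcos : 1 - Real.cos θ ≤ 2 * (1 - Real.cos ((T * (k + 1) : ℕ) * θ)) +
        2 * (1 - Real.cos (φ k * θ)) := by
      rcases hφT k with h | h
      · have := one_sub_cos_sub_le (φ k * θ) ((T * (k + 1) : ℕ) * θ)
        rw [h] at this ⊢
        rw [show ((T * (k + 1) + 1 : ℕ) : ℝ) * θ - (T * (k + 1) : ℕ) * θ = θ by
          push_cast; ring] at this
        linarith
      · have := one_sub_cos_sub_le ((T * (k + 1) : ℕ) * θ) (φ k * θ)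
        rw [← h] at this ⊢
        rw [show ((φ k + 1 : ℕ) : ℝ) * θ - φ k * θ = θ by push_cast; ring] at this
        linarith
    have hE : 0 ≤ Real.exp (-((T + 1) * τ)) * q ^ k := by positivity
    have := mul_le_mul_of_nonneg_left hcos hE
    linarith

/-- Away from the positive axis the exponent is smaller by a definite amount. -/
theorem exists_dom (hA : ∀ N, 0 ≤ A N)
    (hs : ∀ τ, 0 < τ → Summable fun N : ℕ => A N * Real.exp (-(N * τ))) {T : ℕ} (hT : 0 < T)
    {φ : ℕ → ℕ} (hφ : Function.Injective φ)
    (hφT : ∀ k, φ k = T * (k + 1) + 1 ∨ φ k + 1 = T * (k + 1))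
    (h0 : ∀ k, 1 ≤ A (T * (k + 1))) (h1 : ∀ k, 1 ≤ A (φ k)) :
    ∃ κ > 0, ∃ τ₀ > 0, ∀ τ, 0 < τ → τ < τ₀ → ∀ θ, |θ| ≤ Real.pi →
      κ * (θ ^ 2 / (τ * (τ ^ 2 + θ ^ 2))) ≤
        ∑' N : ℕ, A N * Real.exp (-(N * τ)) * (1 - Real.cos (N * θ)) := by
  have hT' : (1 : ℝ) ≤ T := by exact_mod_cast hT
  have hT0 : (0 : ℝ) < T := by linarith
  refine ⟨1 / (15 * T ^ 3), by positivity, 1 / (T + 1), by positivity, fun τ hτ hτ' θ hθ => ?_⟩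
  rw [lt_div_iff₀ (by positivity)] at hτ'
  rcases le_total |T * θ| Real.pi with h | h
  · refine le_trans (mul_le_mul_of_nonneg_right ?_ (by positivity))
      (le_tsum_of_small_angle hA hT h0 hτ (by nlinarith) (hs τ hτ) h)
    refine one_div_le_one_div_of_le (by positivity) ?_
    nlinarith [pow_le_pow_right₀ hT' (show 1 ≤ 3 by norm_num)]
  · refine le_trans ?_ (le_tsum_of_large_angle hA hT hφ hφT h0 h1 hτ (by linarith) (hs τ hτ) θ)
    have hX := sq_div_five_le_one_sub_cos hθ
    have hsq : 9 ≤ T ^ 2 * θ ^ 2 := by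
      have : 3 ≤ |T * θ| := by linarith [Real.pi_gt_three]
      nlinarith [sq_abs (T * θ), show (T * θ) ^ 2 = T ^ 2 * θ ^ 2 by ring]
    have hθ2 : 0 < θ ^ 2 := by
      by_contra hn
      have : θ ^ 2 = 0 := le_antisymm (not_lt.1 hn) (sq_nonneg θ)
      rw [this] at hsq; norm_num at hsq
    have e1 : θ ^ 2 / (τ * (τ ^ 2 + θ ^ 2)) ≤ 1 / τ := by
      rw [div_le_div_iff₀ (by positivity) hτ]
      nlinarith [mul_pos hτ (pow_pos hτ 2)]
    refine (mul_le_mul_of_nonneg_left e1 (by positivity)).trans ?_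
    rw [← mul_div_assoc, ← mul_div_assoc, mul_one]
    refine div_le_div_of_nonneg_right ?_ hτ.le
    rw [one_div_mul_eq_div, div_le_div_iff₀ (by positivity) (by positivity)]
    nlinarith [mul_le_mul_of_nonneg_left hX (show 0 ≤ (T : ℝ) ^ 3 by positivity),
      mul_le_mul_of_nonneg_left hsq hT0.le]
end

end AngleBound

section ProductCoefficients
open Filter Topology

section
lemma hasSum_prod_progLog {s x : ℝ} (hs : 0 < s) (hx : 0 < x) :
    HasSum (fun y : ℕ × ℕ => Real.exp (-((y.2 + 1) * (s * (x + y.1)))) / (y.2 + 1))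
      (progLog s x) := by
  have hpos : ∀ k : ℕ, 0 < s * (x + k) := fun k =>
    mul_pos hs (add_pos_of_pos_of_nonneg hx k.cast_nonneg)
  obtain ⟨f, hf⟩ : ∃ f : ℕ × ℕ → ℝ, ∀ y, f y =
    Real.exp (-((y.2 + 1) * (s * (x + y.1)))) / (y.2 + 1) := ⟨_, fun _ => rfl⟩
  have hf0 : 0 ≤ f := fun y => by
    rw [hf]; exact div_nonneg (Real.exp_pos _).le (by positivity)
  have hk : ∀ k : ℕ, HasSum (fun j => f (k, j)) (partLog (s * (x + k))) := fun k =>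
    (hasSum_partLog (hpos k)).of_eq (fun j => hf (k, j)) rfl
  have hsum : Summable f := (summable_prod_of_nonneg hf0).2
    ⟨fun k => (hk k).summable, (summable_partLog hs hx).congr fun k => (hk k).tsum_eq.symm⟩
  have h2 : HasSum (fun k : ℕ => partLog (s * (x + k))) (∑' y, f y) :=
    hsum.hasSum.prod_fiberwise hk
  have h3 : progLog s x = ∑' y, f y := h2.tsum_eq
  rw [h3]
  exact hsum.hasSum.of_eq (fun y => (hf y).symm) rfl

lemma exists_coeff_progLog {p t : ℕ} (hp : 0 < p) (ht : 0 < t) :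
    ∃ A : ℕ → ℝ, (∀ N, 0 ≤ A N) ∧ (∀ k, 1 ≤ A (t + p * k)) ∧
      ∀ τ, 0 < τ → HasSum (fun N : ℕ => A N * Real.exp (-(N * τ))) (progLog (p * τ) (t / p)) := by
  have hp' : (0 : ℝ) < p := by exact_mod_cast hp
  have ht' : (0 : ℝ) < t := by exact_mod_cast ht
  let g : ℕ × ℕ → ℕ := fun y => (y.2 + 1) * (t + p * y.1)
  have hsum : ∀ τ, 0 < τ → HasSum (fun y : ℕ × ℕ => 1 / ((y.2 : ℝ) + 1) * Real.exp (-(g y * τ)))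
      (progLog (p * τ) (t / p)) := fun τ hτ => by
    refine (hasSum_prod_progLog (mul_pos hp' hτ) (div_pos ht' hp')).of_eq (fun y => ?_) rfl
    rw [one_div_mul_eq_div]
    congr 2
    simp only [g]; push_cast; field_simp
  have hfib : ∀ (τ : ℝ) (N : ℕ) (y : g ⁻¹' {N}), 1 / ((y.1.2 : ℝ) + 1) * Real.exp (-(g y * τ)) =
      1 / ((y.1.2 : ℝ) + 1) * Real.exp (-(N * τ)) := fun τ N y => by
    have : g y.1 = N := y.2
    rw [this]
  refine ⟨fun N => ∑' y : g ⁻¹' {N}, 1 / ((y.1.2 : ℝ) + 1), fun N => tsum_nonneg fun y => by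
    positivity, fun k => ?_, fun τ hτ => ?_⟩
  · have hs := ((hsum 1 one_pos).summable.subtype (g ⁻¹' {t + p * k}))
    have hs' : Summable fun y : g ⁻¹' {t + p * k} => 1 / ((y.1.2 : ℝ) + 1) := by
      have := hs.mul_right (Real.exp ((t + p * k : ℕ) * 1))
      refine this.congr fun y => ?_
      simp only [Function.comp]
      rw [hfib, mul_assoc, ← Real.exp_add]; simp
    have := hs'.le_tsum ⟨(k, 0), by simp [g]⟩ fun y _ => by positivity
    simpa using this
  · refine ((hsum τ hτ).tsum_fiberwise g).of_eq (fun N => ?_) rfl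
    rw [← tsum_mul_right]
    exact tsum_congr fun y => (hfib τ N y).symm

lemma exists_coeff_multiset_progLog (P : Multiset (ℕ × ℕ)) (hP : ∀ x ∈ P, 0 < x.1 ∧ 0 < x.2) :
    ∃ A : ℕ → ℝ, (∀ N, 0 ≤ A N) ∧ (∀ x ∈ P, ∀ k, 1 ≤ A (x.2 + x.1 * k)) ∧
      ∀ τ, 0 < τ → HasSum (fun N : ℕ => A N * Real.exp (-(N * τ)))
        (P.map fun x : ℕ × ℕ => progLog (x.1 * τ) (x.2 / x.1)).sum := by
  induction P using Multiset.induction_on with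
  | empty => exact ⟨fun _ => 0, fun _ => le_rfl, by simp, fun τ _ => by simp⟩
  | cons x P ih =>
    obtain ⟨A, hA, hA1, hAs⟩ := ih fun y hy => hP y (Multiset.mem_cons_of_mem hy)
    obtain ⟨hx1, hx2⟩ := hP x (Multiset.mem_cons_self x P)
    obtain ⟨A', hA', hA1', hAs'⟩ := exists_coeff_progLog hx1 hx2
    refine ⟨fun N => A' N + A N, fun N => add_nonneg (hA' N) (hA N), fun y hy k => ?_,
      fun τ hτ => ?_⟩
    · rcases Multiset.mem_cons.1 hy with rfl | hy
      · linarith [hA1' k, hA (y.2 + y.1 * k)]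
      · linarith [hA1 y hy k, hA' (y.2 + y.1 * k)]
    · rw [Multiset.map_cons, Multiset.sum_cons]
      exact ((hAs' τ hτ).add (hAs τ hτ)).of_eq (fun N => add_mul _ _ _) rfl

lemma tendsto_multiset_progLog (P : Multiset (ℕ × ℕ)) (hP : ∀ x ∈ P, 0 < x.1 ∧ 0 < x.2) :
    Tendsto (fun τ : ℝ => (P.map fun x : ℕ × ℕ => progLog (x.1 * τ) (x.2 / x.1)).sum -
      (P.map fun x : ℕ × ℕ => Real.pi ^ 2 / (6 * x.1)).sum / τ -
      (P.map fun x : ℕ × ℕ => ((x.2 : ℝ) / x.1 - 1 / 2)).sum * Real.log τ) (𝓝[>] 0)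
      (𝓝 (P.map fun x : ℕ × ℕ => Real.log (Real.Gamma (x.2 / x.1)) -
        1 / 2 * Real.log (2 * Real.pi) + ((x.2 : ℝ) / x.1 - 1 / 2) * Real.log x.1).sum) := by
  induction P using Multiset.induction_on with
  | empty => simp
  | cons x P ih =>
    have h1 := ih fun y hy => hP y (Multiset.mem_cons_of_mem hy)
    obtain ⟨hx1, hx2⟩ := hP x (Multiset.mem_cons_self x P)
    have hp' : (0 : ℝ) < x.1 := by exact_mod_cast hx1
    have ht' : (0 : ℝ) < x.2 := by exact_mod_cast hx2
    have hmul : Tendsto (fun τ : ℝ => x.1 * τ) (𝓝[>] 0) (𝓝[>] 0) := by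
      refine tendsto_nhdsWithin_iff.2 ⟨?_, ?_⟩
      · have : Tendsto (fun w : ℝ => x.1 * w) (𝓝 0) (𝓝 (x.1 * 0)) :=
          (continuous_const_mul (x.1 : ℝ)).tendsto 0
        rw [mul_zero] at this
        exact this.mono_left nhdsWithin_le_nhds
      · filter_upwards [self_mem_nhdsWithin] with w hw using mul_pos hp' (Set.mem_Ioi.1 hw)
    have h2 := ((tendsto_progLog (div_pos ht' hp')).comp hmul).add_const
      (((x.2 : ℝ) / x.1 - 1 / 2) * Real.log x.1)
    simp only [Multiset.map_cons, Multiset.sum_cons]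
    refine (h2.add h1).congr' ?_
    filter_upwards [self_mem_nhdsWithin] with τ hτ
    have hτ : 0 < τ := hτ
    simp only [Function.comp]
    rw [Real.log_mul hp'.ne' hτ.ne']
    field_simp
    ring
end

end ProductCoefficients

namespace Ptn

lemma ext_part {lam mu : Ptn} (h : ∀ i, lam.part i = mu.part i) : lam = mu := by
  cases lam; cases mu
  congr 1
  exact Finsupp.ext h

lemma part_antitone (lam : Ptn) {i j : ℕ} (h : i ≤ j) : lam.part j ≤ lam.part i :=
  lam.antitone' h

lemma part_succ_le (lam : Ptn) (i : ℕ) : lam.part (i + 1) ≤ lam.part i :=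
  lam.part_antitone i.le_succ

lemma exists_part_eq_zero (lam : Ptn) : ∃ n, ∀ i, n ≤ i → lam.part i = 0 := by
  obtain ⟨n, hn⟩ := lam.toFun.support.bddAbove
  refine ⟨n + 1, fun i hi => ?_⟩
  by_contra h
  have := hn (Finset.mem_coe.2 (Finsupp.mem_support_iff.2 h))
  omega

lemma size_eq_sum_range (lam : Ptn) {n : ℕ} (h : ∀ i, n ≤ i → lam.part i = 0) :
    lam.size = ∑ i ∈ Finset.range n, lam.part i := by
  refine Finset.sum_subset (fun i hi => ?_) (fun i _ hi => Finsupp.notMem_support_iff.1 hi)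
  rw [Finset.mem_range]
  by_contra hn
  exact (Finsupp.mem_support_iff.1 hi) (h i (not_lt.1 hn))

/-- The partition with given parts. -/
noncomputable def ofParts (f : ℕ → ℕ) (hf : ∀ i, f (i + 1) ≤ f i) (h0 : ∃ n, ∀ i, n ≤ i → f i = 0) :
    Ptn where
  toFun := Finsupp.ofSupportFinite f (by
    obtain ⟨n, hn⟩ := h0
    refine (Set.finite_lt_nat n).subset fun i hi => ?_
    by_contra h
    exact hi (hn i (not_lt.1 h)))
  antitone' := antitone_nat_of_succ_le hf

@[simp] lemma part_ofParts (f : ℕ → ℕ) (hf : ∀ i, f (i + 1) ≤ f i)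
    (h0 : ∃ n, ∀ i, n ≤ i → f i = 0) (i : ℕ) : (ofParts f hf h0).part i = f i := rfl

end Ptn

section Toggle
variable {lam mu : Ptn}

/-- The lower partition obtained by reflecting the parts of `nu` in the intervals allowed by
interlacing with `lam` and `mu`. -/
noncomputable def toggleDown (nu : Ptn) (h1 : HStrip lam nu) (h2 : HStrip mu nu) : Ptn :=
  Ptn.ofParts (fun i => min (lam.part i) (mu.part i) + max (lam.part (i + 1)) (mu.part (i + 1)) -
      nu.part (i + 1))
    (fun i => by
      have := h1 i; have := h2 i; have := h1 (i + 1); have := h2 (i + 1)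
      have := h1 (i + 1 + 1); have := h2 (i + 1 + 1)
      omega)
    (by
      obtain ⟨n, hn⟩ := lam.exists_part_eq_zero
      refine ⟨n, fun i hi => ?_⟩
      have := hn i hi; have := h1 (i + 1); have := h2 (i + 1)
      omega)

/-- The parts of `toggleUp`. -/
def toggleUpPart (lam mu : Ptn) (j : ℕ) (kap : Ptn) : ℕ → ℕ
  | 0 => max (lam.part 0) (mu.part 0) + j
  | i + 1 => min (lam.part i) (mu.part i) + max (lam.part (i + 1)) (mu.part (i + 1)) - kap.part i

/-- The upper partition obtained by reflecting the parts of `kap` in the intervals allowed by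
interlacing with `lam` and `mu`, with `j` extra boxes in the first row. -/
noncomputable def toggleUp (j : ℕ) (kap : Ptn) (h1 : HStrip kap lam) (h2 : HStrip kap mu) : Ptn :=
  Ptn.ofParts (toggleUpPart lam mu j kap)
    (fun i => by
      cases i with
      | zero =>
        have := h1 0; have := h2 0
        simp only [toggleUpPart]; omega
      | succ i =>
        have := h1 i; have := h2 i; have := h1 (i + 1); have := h2 (i + 1)
        simp only [toggleUpPart]; omega)
    (by
      obtain ⟨n, hn⟩ := lam.exists_part_eq_zero
      refine ⟨n + 1, fun i hi => ?_⟩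
      obtain ⟨i, rfl⟩ : ∃ k, i = k + 1 := ⟨i - 1, by omega⟩
      have := hn i (by omega); have := h1 i; have := h2 i
      simp only [toggleUpPart]; omega)

/-- Partitions above both `lam` and `mu` correspond to a number of extra boxes in the first row
and a partition below both. -/
noncomputable def toggleEquiv (lam mu : Ptn) :
    {nu : Ptn // HStrip lam nu ∧ HStrip mu nu} ≃ ℕ × {kap : Ptn // HStrip kap lam ∧ HStrip kap mu}
    where
  toFun nu := (nu.1.part 0 - max (lam.part 0) (mu.part 0), ⟨toggleDown nu.1 nu.2.1 nu.2.2, by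
    constructor <;> intro i <;> have := nu.2.1 i <;> have := nu.2.2 i <;>
      have := nu.2.1 (i + 1) <;> have := nu.2.2 (i + 1) <;>
      simp only [toggleDown, Ptn.part_ofParts] <;> omega⟩)
  invFun x := ⟨toggleUp x.1 x.2.1 x.2.2.1 x.2.2.2, by
    constructor <;> intro i <;> rcases i with _ | i <;>
      simp only [toggleUp, toggleUpPart, Ptn.part_ofParts]
    · have := x.2.2.1 0; have := x.2.2.2 0; omega
    · have := x.2.2.1 i; have := x.2.2.2 i; have := x.2.2.1 (i + 1); have := x.2.2.2 (i + 1); omega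
    · have := x.2.2.1 0; have := x.2.2.2 0; omega
    · have := x.2.2.1 i; have := x.2.2.2 i; have := x.2.2.1 (i + 1)
      have := x.2.2.2 (i + 1); omega⟩
  left_inv nu := by
    refine Subtype.ext (Ptn.ext_part fun i => ?_)
    rcases i with _ | i <;> simp only [toggleUp, toggleUpPart, toggleDown, Ptn.part_ofParts]
    · have := nu.2.1 0; have := nu.2.2 0; omega
    · have := nu.2.1 i; have := nu.2.2 i; have := nu.2.1 (i + 1); have := nu.2.2 (i + 1); omega
  right_inv x := by
    refine Prod.ext ?_ (Subtype.ext (Ptn.ext_part fun i => ?_)) <;>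
      simp only [toggleUp, toggleUpPart, toggleDown, Ptn.part_ofParts]
    · omega
    · have := x.2.2.1 i; have := x.2.2.2 i; omega

lemma size_toggleEquiv (nu : {nu : Ptn // HStrip lam nu ∧ HStrip mu nu}) :
    nu.1.size + (toggleEquiv lam mu nu).2.1.size =
      (toggleEquiv lam mu nu).1 + lam.size + mu.size := by
  obtain ⟨n₁, h₁⟩ := lam.exists_part_eq_zero
  obtain ⟨n₂, h₂⟩ := mu.exists_part_eq_zero
  obtain ⟨nu, hl, hm⟩ := nu
  set n := max n₁ n₂
  have e1 := lam.size_eq_sum_range (n := n + 1) fun i hi => h₁ i (by omega)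
  have e2 := mu.size_eq_sum_range (n := n + 1) fun i hi => h₂ i (by omega)
  have e3 := nu.size_eq_sum_range (n := n + 1) fun i hi => by
    have h := h₁ (i - 1) (by omega)
    have h' := (hl (i - 1)).2
    rw [show i - 1 + 1 = i by omega] at h'
    omega
  have e4 := (toggleDown nu hl hm).size_eq_sum_range (n := n) fun i hi => by
    have := h₁ i (by omega); have := hl (i + 1); have := hm (i + 1)
    simp only [toggleDown, Ptn.part_ofParts]
    omega
  have e5 : ∑ i ∈ Finset.range n, (min (lam.part i) (mu.part i)) =
      ∑ i ∈ Finset.range (n + 1), (min (lam.part i) (mu.part i)) := by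
    rw [Finset.sum_range_succ, h₁ n (le_max_left _ _), Nat.zero_min, add_zero]
  have e6 : ∑ i ∈ Finset.range n, (nu.part (i + 1) + (toggleDown nu hl hm).part i) =
      ∑ i ∈ Finset.range n, (min (lam.part i) (mu.part i) +
        max (lam.part (i + 1)) (mu.part (i + 1))) := by
    refine Finset.sum_congr rfl fun i _ => ?_
    have := hl i; have := hm i; have := hl (i + 1); have := hm (i + 1)
    simp only [toggleDown, Ptn.part_ofParts]
    omega
  have e7 : ∑ i ∈ Finset.range (n + 1), (max (lam.part i) (mu.part i)) =
      ∑ i ∈ Finset.range n, (max (lam.part (i + 1)) (mu.part (i + 1))) +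
        max (lam.part 0) (mu.part 0) := Finset.sum_range_succ' _ _
  have e8 : ∑ i ∈ Finset.range (n + 1), (min (lam.part i) (mu.part i)) +
      ∑ i ∈ Finset.range (n + 1), (max (lam.part i) (mu.part i)) =
      ∑ i ∈ Finset.range (n + 1), lam.part i + ∑ i ∈ Finset.range (n + 1), mu.part i := by
    rw [← Finset.sum_add_distrib, ← Finset.sum_add_distrib]
    exact Finset.sum_congr rfl fun i _ => min_add_max _ _
  rw [Finset.sum_add_distrib, Finset.sum_add_distrib, e5] at e6
  rw [Finset.sum_range_succ'] at e3
  have := hl 0; have := hm 0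
  change nu.size + (toggleDown nu hl hm).size =
    (nu.part 0 - max (lam.part 0) (mu.part 0)) + lam.size + mu.size
  omega

end Toggle

section Weights

/-- The weight `exp (-x)` as an extended nonnegative real. -/
noncomputable def expW (x : ℝ) : ENNReal := ENNReal.ofReal (Real.exp (-x))

lemma expW_add (x y : ℝ) : expW (x + y) = expW x * expW y := by
  rw [expW, expW, expW, ← ENNReal.ofReal_mul (Real.exp_pos _).le, ← Real.exp_add, neg_add]

@[simp] lemma expW_zero : expW 0 = 1 := by simp [expW]

lemma expW_ne_zero (x : ℝ) : expW x ≠ 0 := by simp [expW, Real.exp_pos]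

lemma expW_le_expW {x y : ℝ} (h : x ≤ y) : expW y ≤ expW x :=
  ENNReal.ofReal_le_ofReal (Real.exp_le_exp.2 (neg_le_neg h))

/-- The geometric series with ratio `exp (-x)`. -/
noncomputable def geomW (x : ℝ) : ENNReal := ∑' j : ℕ, expW (j * x)

open Classical in
/-- The indicator of `HStrip`. -/
noncomputable def strip (lam nu : Ptn) : ENNReal := if HStrip lam nu then 1 else 0

lemma strip_mul_self (lam nu : Ptn) : strip lam nu * strip lam nu = strip lam nu := by
  unfold strip; split_ifs <;> simp

lemma strip_self (lam : Ptn) : strip lam lam = 1 :=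
  if_pos fun i => ⟨le_rfl, lam.part_succ_le i⟩

lemma strip_eq_zero {lam nu : Ptn} (h : ¬ HStrip lam nu) : strip lam nu = 0 := if_neg h

lemma tsum_strip_toggle (lam mu : Ptn) (F : ℝ → ENNReal) :
    ∑' nu, strip lam nu * strip mu nu * F nu.size =
      ∑' j : ℕ, ∑' kap, strip kap lam * strip kap mu * F (j + lam.size + mu.size - kap.size) := by
  classical
  have e1 : ∀ G : Ptn → ENNReal, ∑' nu, strip lam nu * strip mu nu * G nu =
      ∑' nu : {nu // HStrip lam nu ∧ HStrip mu nu}, G nu := fun G => by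
    rw [show ∑' nu : {nu // HStrip lam nu ∧ HStrip mu nu}, G nu = _ from
      tsum_subtype {nu | HStrip lam nu ∧ HStrip mu nu} G]
    refine tsum_congr fun nu => ?_
    by_cases h1 : HStrip lam nu <;> by_cases h2 : HStrip mu nu <;>
      simp [strip, Set.indicator, h1, h2]
  have e2 : ∀ G : Ptn → ENNReal, ∑' kap, strip kap lam * strip kap mu * G kap =
      ∑' kap : {kap // HStrip kap lam ∧ HStrip kap mu}, G kap := fun G => by
    rw [show ∑' kap : {kap // HStrip kap lam ∧ HStrip kap mu}, G kap = _ from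
      tsum_subtype {kap | HStrip kap lam ∧ HStrip kap mu} G]
    refine tsum_congr fun nu => ?_
    by_cases h1 : HStrip nu lam <;> by_cases h2 : HStrip nu mu <;>
      simp [strip, Set.indicator, h1, h2]
  rw [e1 fun nu => F nu.size]
  simp_rw [fun j : ℕ => e2 fun kap => F (j + lam.size + mu.size - kap.size)]
  rw [← ENNReal.tsum_prod (f := fun (j : ℕ) (kap : {kap // HStrip kap lam ∧ HStrip kap mu}) =>
      F (j + lam.size + mu.size - kap.1.size)),
    ← (toggleEquiv lam mu).tsum_eq]
  refine tsum_congr fun nu => ?_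
  have := size_toggleEquiv nu
  rw [← @Nat.cast_inj ℝ] at this
  push_cast at this
  congr 1
  linarith

end Weights

section Operators

/-- The operator summing over partitions above the given one. -/
noncomputable def up (a : ℝ) (f : Ptn → ENNReal) (lam : Ptn) : ENNReal :=
  ∑' nu, strip lam nu * expW (a * (nu.size - lam.size)) * f nu

/-- The operator summing over partitions below the given one. -/
noncomputable def down (b : ℝ) (f : Ptn → ENNReal) (lam : Ptn) : ENNReal :=
  ∑' kap, strip kap lam * expW (b * (kap.size - lam.size)) * f kap

/-- The weighted sum of a function over all partitions. -/
noncomputable def total (T : ℝ) (f : Ptn → ENNReal) : ENNReal :=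
  ∑' lam : Ptn, expW (T * lam.size) * f lam

lemma up_smul (a : ℝ) (c : ENNReal) (f : Ptn → ENNReal) : up a (c • f) = c • up a f := by
  ext lam
  simp only [up, Pi.smul_apply, smul_eq_mul, ← ENNReal.tsum_mul_left]
  exact tsum_congr fun nu => by ring

lemma total_smul (T : ℝ) (c : ENNReal) (f : Ptn → ENNReal) :
    total T (c • f) = c * total T f := by
  simp only [total, Pi.smul_apply, smul_eq_mul, ← ENNReal.tsum_mul_left]
  exact tsum_congr fun nu => by ring

lemma up_down (a b : ℝ) (f : Ptn → ENNReal) :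
    up a (down b f) = geomW (a - b) • down b (up a f) := by
  ext lam
  simp only [up, down, geomW, Pi.smul_apply, smul_eq_mul, ← ENNReal.tsum_mul_left,
    ← ENNReal.tsum_mul_right]
  rw [ENNReal.tsum_comm]
  have key : ∀ mu : Ptn, ∑' nu, strip lam nu * expW (a * (nu.size - lam.size)) *
      (strip mu nu * expW (b * (mu.size - nu.size)) * f mu) =
      ∑' j : ℕ, ∑' kap, expW (j * (a - b)) * (strip kap lam * expW (b * (kap.size - lam.size)) *
        (strip kap mu * expW (a * (mu.size - kap.size)) * f mu)) := fun mu => by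
    have := tsum_strip_toggle lam mu fun x =>
      expW (a * (x - lam.size)) * expW (b * (mu.size - x)) * f mu
    refine (tsum_congr fun nu => ?_).trans (this.trans (tsum_congr fun j =>
      tsum_congr fun kap => ?_))
    · ring
    · have e : expW (a * (j + lam.size + mu.size - kap.size - lam.size)) *
          expW (b * (mu.size - (j + lam.size + mu.size - kap.size))) =
          expW (j * (a - b)) * expW (b * (kap.size - lam.size)) *
            expW (a * (mu.size - kap.size)) := by
        rw [← expW_add, ← expW_add, ← expW_add]
        congr 1; ring
      rw [e]; ring
  simp_rw [key]
  rw [ENNReal.tsum_comm]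
  simp_rw [ENNReal.tsum_comm (α := ℕ) (β := Ptn)]
  exact ENNReal.tsum_comm

lemma up_one (a : ℝ) : up a 1 = geomW a • down (-a) 1 := by
  ext lam
  simp only [up, down, geomW, Pi.smul_apply, smul_eq_mul, ← ENNReal.tsum_mul_left,
    ← ENNReal.tsum_mul_right, Pi.one_apply, mul_one]
  have := tsum_strip_toggle lam lam fun x => expW (a * (x - lam.size))
  simp only [strip_mul_self] at this
  rw [this, ENNReal.tsum_comm]
  refine tsum_congr fun kap => tsum_congr fun j => ?_
  rw [mul_left_comm, ← expW_add]
  congr 2; ring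

lemma total_down (T b : ℝ) (f : Ptn → ENNReal) :
    total T (down b f) = geomW (T - b) * total T (up (2 * T - b) f) := by
  simp only [total, up, down, geomW, ← ENNReal.tsum_mul_left, ← ENNReal.tsum_mul_right]
  rw [ENNReal.tsum_comm]
  have key : ∀ kap : Ptn, ∑' lam : Ptn, expW (T * lam.size) *
      (strip kap lam * expW (b * (kap.size - lam.size)) * f kap) =
      ∑' j : ℕ, ∑' mu : Ptn, expW (j * (T - b)) * (expW (T * mu.size) *
        (strip mu kap * expW ((2 * T - b) * (kap.size - mu.size)) * f kap)) := fun kap => by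
    have := tsum_strip_toggle kap kap fun x => expW (T * x) * expW (b * (kap.size - x)) * f kap
    simp only [strip_mul_self] at this
    refine (tsum_congr fun nu => ?_).trans (this.trans (tsum_congr fun j =>
      tsum_congr fun mu => ?_))
    · ring
    · have e : expW (T * (j + kap.size + kap.size - mu.size)) *
          expW (b * (kap.size - (j + kap.size + kap.size - mu.size))) =
          expW (j * (T - b)) * expW (T * mu.size) *
            expW ((2 * T - b) * (kap.size - mu.size)) := by
        rw [← expW_add, ← expW_add, ← expW_add]
        congr 1; ring
      rw [e]; ring
  simp_rw [key]
  rw [ENNReal.tsum_comm]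
  simp_rw [ENNReal.tsum_comm (α := ℕ) (β := Ptn)]
  exact ENNReal.tsum_comm

/-- The composition of the operators `up a` for `a` in the list. -/
noncomputable def applyUp (l : List ℝ) (f : Ptn → ENNReal) : Ptn → ENNReal := l.foldr up f

@[simp] lemma applyUp_nil (f : Ptn → ENNReal) : applyUp [] f = f := rfl

@[simp] lemma applyUp_cons (a : ℝ) (l : List ℝ) (f : Ptn → ENNReal) :
    applyUp (a :: l) f = up a (applyUp l f) := rfl

lemma applyUp_append (l₁ l₂ : List ℝ) (f : Ptn → ENNReal) :
    applyUp (l₁ ++ l₂) f = applyUp l₁ (applyUp l₂ f) := List.foldr_append ..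

lemma applyUp_smul (l : List ℝ) (c : ENNReal) (f : Ptn → ENNReal) :
    applyUp l (c • f) = c • applyUp l f := by
  induction l with
  | nil => rfl
  | cons a l ih => rw [applyUp_cons, ih, up_smul, applyUp_cons]

lemma applyUp_down (l : List ℝ) (b : ℝ) (f : Ptn → ENNReal) :
    applyUp l (down b f) = (l.map fun a => geomW (a - b)).prod • down b (applyUp l f) := by
  induction l with
  | nil => simp
  | cons a l ih =>
    rw [applyUp_cons, ih, up_smul, up_down, smul_smul, applyUp_cons, List.map_cons, List.prod_cons,
      mul_comm]

lemma total_applyUp_down (T b : ℝ) (l : List ℝ) (f : Ptn → ENNReal) :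
    total T (applyUp l (down b f)) = (l.map fun a => geomW (a - b)).prod * geomW (T - b) *
      total T (applyUp ((2 * T - b) :: l) f) := by
  rw [applyUp_down, total_smul, total_down, mul_assoc, applyUp_cons]

lemma total_applyUp_rotate (T a : ℝ) (l : List ℝ) :
    total T (applyUp (l ++ [a]) 1) = geomW a * geomW (T + a) *
      (l.map fun x => geomW (x + a)).prod * total T (applyUp ((a + 2 * T) :: l) 1) := by
  rw [applyUp_append, applyUp_cons, applyUp_nil, up_one, applyUp_smul, total_smul,
    total_applyUp_down]
  simp only [sub_neg_eq_add, add_comm (2 * T) a]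
  ring

end Operators

section PartitionGF
open Filter Topology

lemma geomW_eq {x : ℝ} (hx : 0 < x) : geomW x = ENNReal.ofReal (Real.exp (partLog x)) := by
  have h1 : Real.exp (-x) < 1 := by simpa using hx
  have : HasSum (fun j : ℕ => Real.exp (-(j * x))) (Real.exp (partLog x)) := by
    rw [partLog, Real.exp_neg, Real.exp_log (sub_pos.2 h1)]
    refine (hasSum_geometric_of_lt_one (Real.exp_pos _).le h1).of_eq (fun j => ?_) rfl
    rw [← Real.exp_nat_mul, mul_neg]
  rw [geomW, ← this.tsum_eq, ENNReal.ofReal_tsum_of_nonneg (fun j => (Real.exp_pos _).le)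
    this.summable]
  rfl

/-- The infinite product of `1 / (1 - exp (-(x + k * p)))` over the natural numbers `k`. -/
noncomputable def progW (x p : ℝ) : ENNReal := ENNReal.ofReal (Real.exp (progLog p (x / p)))

lemma progLog_nonneg {s x : ℝ} (hs : 0 < s) (hx : 0 < x) : 0 ≤ progLog s x :=
  tsum_nonneg fun k => partLog_nonneg (by positivity)

lemma progW_eq_mul {x p : ℝ} (hx : 0 < x) (hp : 0 < p) :
    progW x p = geomW x * progW (x + p) p := by
  rw [progW, progW, geomW_eq hx, ← ENNReal.ofReal_mul (Real.exp_pos _).le, ← Real.exp_add,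
    add_div, div_self hp.ne', progLog_add_one hp (div_pos hx hp), mul_div_cancel₀ _ hp.ne']

lemma one_le_progW {x p : ℝ} (hx : 0 < x) (hp : 0 < p) : 1 ≤ progW x p := by
  rw [progW, ENNReal.one_le_ofReal]
  exact Real.one_le_exp (progLog_nonneg hp (div_pos hx hp))

lemma progW_ne_top (x p : ℝ) : progW x p ≠ ⊤ := ENNReal.ofReal_ne_top

lemma tendsto_progW (x : ℝ) {p : ℝ} (hp : 0 < p) :
    Tendsto (fun N : ℕ => progW (x + N * p) p) atTop (𝓝 1) := by
  have h : Tendsto (fun N : ℕ => progLog p (x / p + N)) atTop (𝓝 0) := by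
    refine (tendsto_sum_nat_add fun k : ℕ => partLog (p * (x / p + k))).congr fun N => ?_
    exact tsum_congr fun k => by push_cast; ring_nf
  have := ENNReal.tendsto_ofReal ((Real.continuous_exp.tendsto 0).comp h)
  rw [Real.exp_zero, ENNReal.ofReal_one] at this
  refine this.congr fun N => ?_
  rw [progW, add_div, mul_div_cancel_right₀ _ hp.ne', Function.comp]

/-- Partitions with at most `k + 1` parts correspond to the multiplicity of the column of length
`k + 1` and a partition with at most `k` parts. -/
noncomputable def columnEquiv (k : ℕ) :
    {lam : Ptn // lam.part (k + 1) = 0} ≃ ℕ × {lam : Ptn // lam.part k = 0} where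
  toFun lam := (lam.1.part k, ⟨Ptn.ofParts (fun i => lam.1.part i - lam.1.part k)
    (fun i => Nat.sub_le_sub_right (lam.1.part_succ_le i) _)
    ⟨k, fun i hi => Nat.sub_eq_zero_of_le (lam.1.part_antitone hi)⟩, Nat.sub_self _⟩)
  invFun x := ⟨Ptn.ofParts (fun i => x.2.1.part i + if i ≤ k then x.1 else 0)
    (fun i => by
      have := x.2.1.part_succ_le i
      split_ifs <;> omega)
    ⟨k + 1, fun i hi => by
      have := x.2.1.part_antitone (show k ≤ i by omega)
      rw [x.2.2] at this
      rw [if_neg (by omega)]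
      omega⟩, by
      have := x.2.1.part_succ_le k
      rw [x.2.2] at this
      rw [Ptn.part_ofParts, if_neg (by omega)]
      omega⟩
  left_inv lam := by
    refine Subtype.ext (Ptn.ext_part fun i => ?_)
    simp only [Ptn.part_ofParts]
    split_ifs with h
    · have := lam.1.part_antitone h
      omega
    · have := lam.1.part_antitone (show k + 1 ≤ i by omega)
      rw [lam.2] at this
      omega
  right_inv x := by
    have h0 := x.2.2
    refine Prod.ext ?_ (Subtype.ext (Ptn.ext_part fun i => ?_)) <;>
      simp only [Ptn.part_ofParts, le_refl, if_true, h0]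
    · omega
    · split_ifs with h
      · omega
      · have := x.2.1.part_antitone (show k ≤ i by omega)
        omega

lemma size_columnEquiv (k : ℕ) (lam : {lam : Ptn // lam.part (k + 1) = 0}) :
    lam.1.size = (k + 1) * (columnEquiv k lam).1 + (columnEquiv k lam).2.1.size := by
  have h1 := lam.1.size_eq_sum_range (n := k + 1) fun i hi => by
    have := lam.1.part_antitone hi
    rw [lam.2] at this
    omega
  have h2 := (columnEquiv k lam).2.1.size_eq_sum_range (n := k + 1) fun i hi => by
    have := (columnEquiv k lam).2.1.part_antitone (show k ≤ i by omega)
    rw [(columnEquiv k lam).2.2] at this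
    omega
  rw [h1, h2, show (k + 1) * (columnEquiv k lam).1 =
    ∑ i ∈ Finset.range (k + 1), (columnEquiv k lam).1 by simp, ← Finset.sum_add_distrib]
  refine Finset.sum_congr rfl fun i hi => ?_
  have := lam.1.part_antitone (show i ≤ k from Nat.lt_succ_iff.1 (Finset.mem_range.1 hi))
  change lam.1.part i = lam.1.part k + (lam.1.part i - lam.1.part k)
  omega

lemma tsum_expW_part_eq_zero (w : ℝ) (k : ℕ) :
    ∑' lam : {lam : Ptn // lam.part k = 0}, expW (w * lam.1.size) =
      ∏ i ∈ Finset.range k, geomW (w * (i + 1)) := by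
  induction k with
  | zero =>
    have h : ∀ lam : Ptn, lam.part 0 = 0 → lam.size = 0 := fun lam h => by
      rw [lam.size_eq_sum_range (n := 0) fun i _ => ?_, Finset.sum_range_zero]
      have := lam.part_antitone i.zero_le
      omega
    let e : Ptn := Ptn.ofParts (fun _ => 0) (fun _ => le_rfl) ⟨0, fun _ _ => rfl⟩
    have : Unique {lam : Ptn // lam.part 0 = 0} :=
      { default := ⟨e, rfl⟩
        uniq := fun lam => Subtype.ext (Ptn.ext_part fun i => by
          have := lam.1.part_antitone i.zero_le
          rw [lam.2] at this
          change _ = 0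
          omega) }
    rw [tsum_fintype, Fintype.sum_unique, h _ this.default.2]
    simp
  | succ k ih =>
    rw [Finset.prod_range_succ, ← ih, mul_comm, geomW, ← ENNReal.tsum_mul_right]
    simp_rw [← ENNReal.tsum_mul_left]
    rw [← ENNReal.tsum_prod (f := fun (j : ℕ) (lam : {lam : Ptn // lam.part k = 0}) =>
      expW (j * (w * (k + 1))) * expW (w * lam.1.size)), ← (columnEquiv k).tsum_eq]
    refine tsum_congr fun lam => ?_
    rw [size_columnEquiv, ← expW_add]
    congr 1
    push_cast
    ring

/-- Euler's product for the generating function of partitions. -/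
theorem total_one {w : ℝ} (hw : 0 < w) : total w 1 = progW w w := by
  have hprod : ∀ k, ∏ i ∈ Finset.range k, geomW (w * (i + 1)) =
      ENNReal.ofReal (Real.exp (∑ i ∈ Finset.range k, partLog (w * (1 + i)))) := fun k => by
    rw [Real.exp_sum, ENNReal.ofReal_prod_of_nonneg fun i _ => (Real.exp_pos _).le]
    exact Finset.prod_congr rfl fun i _ => by rw [geomW_eq (by positivity), add_comm]
  have hs := summable_partLog hw one_pos
  have hsub : ∀ k, ∏ i ∈ Finset.range k, geomW (w * (i + 1)) =
      ∑' lam, Set.indicator {lam : Ptn | lam.part k = 0} (fun lam => expW (w * lam.size)) lam :=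
    fun k => by
      rw [← tsum_expW_part_eq_zero]
      exact tsum_subtype {lam : Ptn | lam.part k = 0} fun lam => expW (w * lam.size)
  rw [progW, div_self hw.ne']
  simp only [total, Pi.one_apply, mul_one]
  refine le_antisymm ?_ ?_
  · rw [ENNReal.tsum_eq_iSup_sum]
    refine iSup_le fun s => ?_
    obtain ⟨k, hk⟩ : ∃ k, ∀ lam ∈ s, lam.part k = 0 := by
      choose n hn using Ptn.exists_part_eq_zero
      exact ⟨s.sup n, fun lam hl => hn lam _ (Finset.le_sup hl)⟩
    calc ∑ lam ∈ s, expW (w * lam.size)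
        = ∑ lam ∈ s, Set.indicator {lam : Ptn | lam.part k = 0}
            (fun lam => expW (w * lam.size)) lam :=
          Finset.sum_congr rfl fun lam hl =>
            (Set.indicator_of_mem (show lam ∈ {lam : Ptn | lam.part k = 0} from hk lam hl)
              fun lam => expW (w * lam.size)).symm
      _ ≤ _ := ENNReal.sum_le_tsum s
      _ = _ := (hsub k).symm
      _ = _ := hprod k
      _ ≤ _ := ENNReal.ofReal_le_ofReal (Real.exp_le_exp.2 (hs.sum_le_tsum _ fun i _ =>
          partLog_nonneg (by positivity)))
  · refine le_of_tendsto' (ENNReal.tendsto_ofReal ((Real.continuous_exp.tendsto _).comp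
      hs.hasSum.tendsto_sum_nat)) fun k => ?_
    change ENNReal.ofReal (Real.exp (∑ i ∈ Finset.range k, partLog (w * (1 + i)))) ≤ _
    rw [← hprod, hsub]
    exact ENNReal.tsum_le_tsum fun lam => Set.indicator_le_self _ _ _

end PartitionGF

section PairProd
variable {ι M : Type*} [CommMonoid M]

/-- The product of `g a b` over the pairs of entries `a` before `b` of a list. -/
def pairProd (g : ι → ι → M) : List ι → M
  | [] => 1
  | a :: l => (l.map (g a)).prod * pairProd g l

lemma pairProd_append (g : ι → ι → M) (l₁ l₂ : List ι) :
    pairProd g (l₁ ++ l₂) =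
      pairProd g l₁ * (l₁.map fun a => (l₂.map (g a)).prod).prod * pairProd g l₂ := by
  induction l₁ with
  | nil => simp [pairProd]
  | cons a l ih =>
    simp only [List.cons_append, pairProd, ih, List.map_append, List.prod_append, List.map_cons,
      List.prod_cons]
    simp only [mul_assoc, mul_comm, mul_left_comm]

end PairProd

section UpProduct
open Filter Topology

lemma HStrip.size_le {lam nu : Ptn} (h : HStrip lam nu) : lam.size ≤ nu.size := by
  obtain ⟨n, hn⟩ := nu.exists_part_eq_zero
  rw [nu.size_eq_sum_range hn, lam.size_eq_sum_range fun i hi => Nat.eq_zero_of_le_zero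
    ((h i).1.trans (hn i hi).le)]
  exact Finset.sum_le_sum fun i _ => (h i).1

lemma HStrip.eq_of_size_le {lam nu : Ptn} (h : HStrip lam nu) (hs : nu.size ≤ lam.size) :
    lam = nu := by
  refine Ptn.ext_part fun i => ?_
  obtain ⟨n, hn⟩ := nu.exists_part_eq_zero
  rw [nu.size_eq_sum_range hn, lam.size_eq_sum_range fun i hi => Nat.eq_zero_of_le_zero
    ((h i).1.trans (hn i hi).le)] at hs
  by_cases hi : i < n
  · by_contra hne
    exact absurd hs (not_le.2 (Finset.sum_lt_sum (fun j _ => (h j).1)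
      ⟨i, Finset.mem_range.2 hi, lt_of_le_of_ne (h i).1 hne⟩))
  · have := hn i (not_lt.1 hi)
    have := (h i).1
    omega

lemma up_mono (a : ℝ) {f g : Ptn → ENNReal} (h : f ≤ g) : up a f ≤ up a g := fun _ =>
  ENNReal.tsum_le_tsum fun nu => mul_le_mul_right (h nu) _

lemma const_smul_mono (c : ENNReal) {f g : Ptn → ENNReal} (h : f ≤ g) : c • f ≤ c • g :=
  fun lam => mul_le_mul_right (h lam) c

lemma total_mono (T : ℝ) {f g : Ptn → ENNReal} (h : f ≤ g) : total T f ≤ total T g :=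
  ENNReal.tsum_le_tsum fun nu => mul_le_mul_right (h nu) _

lemma total_add (T : ℝ) (f g : Ptn → ENNReal) : total T (f + g) = total T f + total T g := by
  rw [total, total, total, ← ENNReal.tsum_add]
  exact tsum_congr fun _ => mul_add ..

lemma up_add (a : ℝ) (f g : Ptn → ENNReal) : up a (f + g) = up a f + up a g := by
  ext lam
  rw [Pi.add_apply, up, up, up, ← ENNReal.tsum_add]
  exact tsum_congr fun _ => mul_add ..

lemma le_up (a : ℝ) (f : Ptn → ENNReal) : f ≤ up a f := fun lam => by
  have := ENNReal.le_tsum (f := fun nu : Ptn =>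
    strip lam nu * expW (a * (nu.size - lam.size)) * f nu) lam
  exact (by simp [strip_self] : f lam = _).le.trans this

lemma one_le_applyUp (l : List ℝ) : 1 ≤ applyUp l 1 := by
  induction l with
  | nil => exact le_rfl
  | cons a l ih => exact ih.trans (le_up a _)

lemma up_add_le (a M : ℝ) (hM : 0 ≤ M) (f : Ptn → ENNReal) :
    up (a + M) f ≤ f + expW M • up a f := by
  classical
  intro lam
  have : f lam = ∑' nu, if nu = lam then f lam else 0 := by simp
  rw [Pi.add_apply, Pi.smul_apply, smul_eq_mul, up, up, this, ← ENNReal.tsum_mul_left,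
    ← ENNReal.tsum_add]
  refine ENNReal.tsum_le_tsum fun nu => ?_
  by_cases h : HStrip lam nu
  · split_ifs with he
    · subst he
      simp [strip_self]
    · have h1 : lam.size + 1 ≤ nu.size := by
        by_contra hs
        exact he (h.eq_of_size_le (by omega)).symm
      have h2 : (lam.size : ℝ) + 1 ≤ nu.size := by exact_mod_cast h1
      rw [zero_add, mul_left_comm, mul_assoc, mul_assoc]
      calc _ ≤ strip lam nu * (expW M * expW (a * (nu.size - lam.size)) * f nu) := by
            gcongr
            rw [← expW_add]
            exact expW_le_expW (by nlinarith)
        _ = _ := by ring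
  · simp [strip_eq_zero h]

lemma applyUp_add_le (l : List ℝ) {M : ℝ} (hM : 0 ≤ M) :
    applyUp (l.map (· + M)) 1 ≤ 1 + (l.length * expW M) • applyUp l 1 := by
  induction l with
  | nil => simp
  | cons a l ih =>
    have h1 : up (a + M) 1 ≤ 1 + expW M • up a (applyUp l 1) :=
      (up_add_le a M hM 1).trans (add_le_add le_rfl (const_smul_mono _
        (up_mono a (one_le_applyUp l))))
    have h2 : up (a + M) (applyUp l 1) ≤ up a (applyUp l 1) := fun lam =>
      ENNReal.tsum_le_tsum fun nu => by
        by_cases h : HStrip lam nu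
        · have : (lam.size : ℝ) ≤ nu.size := by exact_mod_cast h.size_le
          gcongr
          exact expW_le_expW (mul_le_mul_of_nonneg_right (by linarith) (by linarith))
        · simp [strip_eq_zero h]
    rw [List.map_cons, applyUp_cons, applyUp_cons]
    refine (up_mono _ ih).trans ?_
    rw [up_add, up_smul]
    refine (add_le_add h1 (const_smul_mono _ h2)).trans (le_of_eq ?_)
    rw [add_assoc, ← add_smul, List.length_cons, Nat.cast_succ, add_mul, one_mul, add_comm (expW M)]

lemma exists_applyUp_le (l : List ℝ) (hl : ∀ a ∈ l, 0 < a) {ε : ℝ} (hε : 0 < ε) :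
    ∃ C : ENNReal, C ≠ ⊤ ∧ ∀ lam, applyUp l 1 lam ≤ C * expW (-(ε * lam.size)) := by
  induction l generalizing ε with
  | nil =>
    refine ⟨1, ENNReal.one_ne_top, fun lam => ?_⟩
    have : expW 0 ≤ expW (-(ε * lam.size)) := expW_le_expW (by
      have : 0 ≤ ε * (lam.size : ℝ) := by positivity
      linarith)
    simpa using this
  | cons a l ih =>
    have ha := hl a (by simp)
    set b := min a ε / 2 with hb
    have hb0 : 0 < b := by positivity
    have hba : 2 * b ≤ a := by rw [hb]; linarith [min_le_left a ε]
    have hbε : 2 * b ≤ ε := by rw [hb]; linarith [min_le_right a ε]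
    obtain ⟨C, hC, h⟩ := ih (fun x hx => hl x (by simp [hx])) hb0
    refine ⟨C * progW b b, ENNReal.mul_ne_top hC (progW_ne_top _ _), fun lam => ?_⟩
    rw [← total_one hb0, applyUp_cons, up, total, mul_assoc, ← ENNReal.tsum_mul_right,
      ← ENNReal.tsum_mul_left]
    refine ENNReal.tsum_le_tsum fun nu => ?_
    by_cases hs : HStrip lam nu
    · have h1 : (lam.size : ℝ) ≤ nu.size := by exact_mod_cast hs.size_le
      rw [strip, if_pos hs, one_mul, Pi.one_apply, mul_one]
      calc expW (a * (nu.size - lam.size)) * applyUp l 1 nu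
          ≤ expW (a * (nu.size - lam.size)) * (C * expW (-(b * nu.size))) := by gcongr; exact h nu
        _ = C * expW (a * (nu.size - lam.size) + -(b * nu.size)) := by rw [expW_add]; ring
        _ ≤ C * expW (b * nu.size + -(ε * lam.size)) := by
            gcongr
            refine expW_le_expW ?_
            have h2 : (0 : ℝ) ≤ lam.size := Nat.cast_nonneg _
            nlinarith
        _ = _ := by rw [expW_add]
    · simp [strip_eq_zero hs]

lemma total_applyUp_ne_top {T : ℝ} (hT : 0 < T) (l : List ℝ) (hl : ∀ a ∈ l, 0 < a) :
    total T (applyUp l 1) ≠ ⊤ := by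
  obtain ⟨C, hC, h⟩ := exists_applyUp_le l hl (half_pos hT)
  refine ne_top_of_le_ne_top (ENNReal.mul_ne_top hC (progW_ne_top (T / 2) (T / 2))) ?_
  rw [← total_one (half_pos hT), total, total, ← ENNReal.tsum_mul_left]
  refine ENNReal.tsum_le_tsum fun lam => ?_
  refine (mul_le_mul_right (h lam) _).trans (le_of_eq ?_)
  rw [mul_left_comm, ← expW_add, Pi.one_apply, mul_one]
  congr 2
  ring

end UpProduct

section UpFormula
open Filter Topology

/-- The product formula for `total T (applyUp l 1)`. -/
noncomputable def upProd (T : ℝ) (l : List ℝ) : ENNReal :=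
  progW T T * (l.map (progW · T)).prod * pairProd (fun a b => progW (a + b) (2 * T)) l

lemma upProd_rotate {T a : ℝ} (hT : 0 < T) (ha : 0 < a) (l : List ℝ) (hl : ∀ x ∈ l, 0 < x) :
    upProd T (l ++ [a]) = geomW a * geomW (T + a) * (l.map fun x => geomW (x + a)).prod *
      upProd T ((a + 2 * T) :: l) := by
  have h1 : progW a T = geomW a * (geomW (T + a) * progW (a + 2 * T) T) := by
    rw [progW_eq_mul ha hT, progW_eq_mul (by positivity) hT, add_comm T a, add_assoc, ← two_mul]
  have h2 : (l.map fun x => progW (x + a) (2 * T)).prod = (l.map fun x => geomW (x + a)).prod *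
      (l.map fun x => progW (a + 2 * T + x) (2 * T)).prod := by
    rw [← List.prod_map_mul]
    congr 1
    refine List.map_congr_left fun x hx => ?_
    have := hl x hx
    rw [progW_eq_mul (by positivity) (by positivity)]
    congr 2
    ring
  simp only [upProd, pairProd_append, pairProd, List.map_append, List.prod_append, List.map_cons,
    List.prod_cons, List.map_nil, List.prod_nil, mul_one, h1, h2]
  ring

lemma exists_total_eq_mul_rotate {T : ℝ} (hT : 0 < T) (l₂ : List ℝ) : ∀ l₁ : List ℝ,
    (∀ x ∈ l₁, 0 < x) → (∀ x ∈ l₂, 0 < x) → ∃ c : ENNReal,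
      total T (applyUp (l₁ ++ l₂) 1) = c * total T (applyUp (l₂.map (· + 2 * T) ++ l₁) 1) ∧
      upProd T (l₁ ++ l₂) = c * upProd T (l₂.map (· + 2 * T) ++ l₁) := by
  induction l₂ using List.reverseRecOn with
  | nil => exact fun l₁ _ _ => ⟨1, by simp, by simp⟩
  | append_singleton l a ih =>
    intro l₁ h₁ h₂
    have ha : 0 < a := h₂ a (by simp)
    have hl : ∀ x ∈ l, 0 < x := fun x hx => h₂ x (by simp [hx])
    obtain ⟨c, hc, hc'⟩ := ih ((a + 2 * T) :: l₁)
      (by simpa using ⟨by positivity, h₁⟩) hl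
    refine ⟨geomW a * geomW (T + a) * ((l₁ ++ l).map fun x => geomW (x + a)).prod * c, ?_, ?_⟩
    · rw [← List.append_assoc, total_applyUp_rotate, ← List.cons_append, hc]
      simp [mul_assoc]
    · rw [← List.append_assoc, upProd_rotate hT ha, ← List.cons_append, hc']
      · simp [mul_assoc]
      · intro x hx
        rcases List.mem_append.1 hx with h | h
        exacts [h₁ x h, hl x h]

lemma exists_total_eq_mul_shift {T : ℝ} (hT : 0 < T) (l : List ℝ) (hl : ∀ x ∈ l, 0 < x) (N : ℕ) :
    ∃ c : ENNReal, total T (applyUp l 1) = c * total T (applyUp (l.map (· + N * (2 * T))) 1) ∧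
      upProd T l = c * upProd T (l.map (· + N * (2 * T))) := by
  induction N with
  | zero => exact ⟨1, by simp, by simp⟩
  | succ N ih =>
    obtain ⟨c, hc, hc'⟩ := ih
    obtain ⟨d, hd, hd'⟩ := exists_total_eq_mul_rotate hT (l.map (· + N * (2 * T))) []
      (by simp) (by
        simp only [List.mem_map, forall_exists_index, and_imp]
        rintro _ x hx rfl
        have := hl x hx
        positivity)
    have e : (l.map (· + N * (2 * T))).map (· + 2 * T) ++ [] =
        l.map (· + (N + 1 : ℕ) * (2 * T)) := by
      rw [List.append_nil, List.map_map]
      refine List.map_congr_left fun x _ => ?_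
      simp only [Function.comp, Nat.cast_succ]
      ring
    rw [e, List.nil_append] at hd hd'
    exact ⟨c * d, by rw [hc, hd, mul_assoc], by rw [hc', hd', mul_assoc]⟩

lemma tendsto_list_prod_one {ι : Type*} (l : List ι) (f : ℕ → ι → ENNReal)
    (h : ∀ x ∈ l, Tendsto (f · x) atTop (𝓝 1)) :
    Tendsto (fun N => (l.map (f N)).prod) atTop (𝓝 1) := by
  induction l with
  | nil => simp
  | cons a l ih =>
    simpa using ENNReal.Tendsto.mul (h a (by simp)) (by simp)
      (ih fun x hx => h x (by simp [hx])) (by simp)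

lemma tendsto_upProd {T : ℝ} (hT : 0 < T) (l : List ℝ) :
    Tendsto (fun N : ℕ => upProd T (l.map (· + N * (2 * T)))) atTop (𝓝 (progW T T)) := by
  have h2 : Tendsto (fun N : ℕ => N * 2) atTop atTop := tendsto_id.atTop_mul_const' two_pos
  have h1 : Tendsto (fun N : ℕ => ((l.map (· + N * (2 * T))).map (progW · T)).prod) atTop
      (𝓝 1) := by
    simp_rw [List.map_map]
    refine tendsto_list_prod_one l (fun N x => progW (x + N * (2 * T)) T) fun x _ => ?_
    refine ((tendsto_progW x hT).comp h2).congr fun N => ?_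
    simp only [Function.comp, Nat.cast_mul, Nat.cast_ofNat]
    ring_nf
  have h3 : Tendsto (fun N : ℕ => pairProd (fun a b => progW (a + b) (2 * T))
      (l.map (· + N * (2 * T)))) atTop (𝓝 1) := by
    clear h1
    induction l with
    | nil => simp [pairProd]
    | cons a l ih =>
      simp only [List.map_cons, pairProd]
      rw [← one_mul (1 : ENNReal)]
      refine ENNReal.Tendsto.mul ?_ (by simp) ih (by simp)
      simp_rw [List.map_map]
      refine tendsto_list_prod_one l
        (fun N x => progW (a + N * (2 * T) + (x + N * (2 * T))) (2 * T)) fun x _ => ?_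
      refine ((tendsto_progW (a + x) (p := 2 * T) (by positivity)).comp h2).congr fun N => ?_
      simp only [Function.comp, Nat.cast_mul, Nat.cast_ofNat]
      ring_nf
  have := ENNReal.Tendsto.mul (ENNReal.Tendsto.mul (tendsto_const_nhds (x := progW T T))
    (by simp) h1 (by simp [progW_ne_top])) (by simp) h3 (by simp [progW_ne_top])
  simpa [upProd] using this

lemma one_le_list_prod {ι : Type*} (l : List ι) (f : ι → ENNReal) (h : ∀ x ∈ l, 1 ≤ f x) :
    1 ≤ (l.map f).prod := by
  induction l with
  | nil => simp
  | cons a l ih =>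
    rw [List.map_cons, List.prod_cons]
    exact one_le_mul (h a (by simp)) (ih fun x hx => h x (by simp [hx]))

lemma list_prod_ne_top {ι : Type*} (l : List ι) (f : ι → ENNReal) (h : ∀ x ∈ l, f x ≠ ⊤) :
    (l.map f).prod ≠ ⊤ := by
  induction l with
  | nil => simp
  | cons a l ih =>
    rw [List.map_cons, List.prod_cons]
    exact ENNReal.mul_ne_top (h a (by simp)) (ih fun x hx => h x (by simp [hx]))

lemma pairProd_ne_top {ι : Type*} (g : ι → ι → ENNReal) (h : ∀ a b, g a b ≠ ⊤) (l : List ι) :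
    pairProd g l ≠ ⊤ := by
  induction l with
  | nil => simp [pairProd]
  | cons a l ih => exact ENNReal.mul_ne_top (list_prod_ne_top _ _ fun x _ => h a x) ih

lemma upProd_ne_top (T : ℝ) (l : List ℝ) : upProd T l ≠ ⊤ :=
  ENNReal.mul_ne_top (ENNReal.mul_ne_top (progW_ne_top _ _)
    (list_prod_ne_top _ _ fun _ _ => progW_ne_top _ _))
    (pairProd_ne_top _ (fun _ _ => progW_ne_top _ _) _)

lemma progW_le_upProd {T : ℝ} (hT : 0 < T) (l : List ℝ) (hl : ∀ x ∈ l, 0 < x) :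
    progW T T ≤ upProd T l := by
  rw [upProd, mul_assoc]
  refine le_mul_of_one_le_right zero_le (one_le_mul
    (one_le_list_prod _ _ fun x hx => one_le_progW (hl x hx) hT) ?_)
  induction l with
  | nil => simp [pairProd]
  | cons a l ih =>
    have ha := hl a (by simp)
    refine one_le_mul (one_le_list_prod _ _ fun x hx => ?_) (ih fun x hx => hl x (by simp [hx]))
    have := hl x (by simp [hx])
    exact one_le_progW (by positivity) (by positivity)

/-- The product formula for sequences of partitions increasing from an arbitrary partition. -/
theorem total_applyUp {T : ℝ} (hT : 0 < T) (l : List ℝ) (hl : ∀ x ∈ l, 0 < x) :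
    total T (applyUp l 1) = upProd T l := by
  have hQ1 : progW T T ≠ 0 := (zero_lt_one.trans_le (one_le_progW hT hT)).ne'
  have hP := total_applyUp_ne_top hT l hl
  have hpos : ∀ N : ℕ, ∀ x ∈ l.map (· + N * (2 * T)), 0 < x := fun N => by
    simp only [List.mem_map, forall_exists_index, and_imp]
    rintro _ x hx rfl
    have := hl x hx
    positivity
  refine le_antisymm ?_ ?_
  · have key : ∀ N : ℕ, total T (applyUp l 1) ≤ upProd T l +
        upProd T l * (l.length * expW (N * (2 * T)) * total T (applyUp l 1)) := fun N => by
      obtain ⟨c, hc, hc'⟩ := exists_total_eq_mul_shift hT l hl N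
      have h1 : total T (applyUp (l.map (· + N * (2 * T))) 1) ≤
          progW T T + l.length * expW (N * (2 * T)) * total T (applyUp l 1) := by
        rw [← total_one hT, ← total_smul, ← total_add]
        exact total_mono T (applyUp_add_le l (by positivity))
      have h2 := progW_le_upProd hT _ (hpos N)
      have h3 : c ≤ upProd T l := by
        rw [hc']
        exact le_mul_of_one_le_right zero_le ((one_le_progW hT hT).trans h2)
      calc total T (applyUp l 1)
          ≤ c * (progW T T + l.length * expW (N * (2 * T)) * total T (applyUp l 1)) := by
            conv_lhs => rw [hc]
            gcongr
        _ ≤ _ := by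
            rw [mul_add]
            refine add_le_add ?_ (by gcongr)
            rw [hc']
            gcongr
    have hlim : Tendsto (fun N : ℕ => upProd T l +
        upProd T l * (l.length * expW (N * (2 * T)) * total T (applyUp l 1))) atTop
        (𝓝 (upProd T l + upProd T l * (l.length * 0 * total T (applyUp l 1)))) := by
      refine tendsto_const_nhds.add (ENNReal.Tendsto.const_mul (ENNReal.Tendsto.mul_const
        (ENNReal.Tendsto.const_mul ?_ (Or.inr (ENNReal.natCast_ne_top _))) (Or.inr hP))
        (Or.inr (upProd_ne_top T l)))
      rw [← ENNReal.ofReal_zero]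
      refine ENNReal.tendsto_ofReal (Real.tendsto_exp_neg_atTop_nhds_zero.comp ?_)
      exact tendsto_natCast_atTop_atTop.atTop_mul_const (by positivity)
    simpa using ge_of_tendsto' hlim key
  · have key : ∀ N : ℕ, upProd T l * progW T T ≤
        total T (applyUp l 1) * upProd T (l.map (· + N * (2 * T))) := fun N => by
      obtain ⟨c, hc, hc'⟩ := exists_total_eq_mul_shift hT l hl N
      rw [hc, hc', mul_right_comm]
      gcongr
      rw [← total_one hT]
      exact total_mono T (one_le_applyUp _)
    have := ge_of_tendsto' (ENNReal.Tendsto.const_mul (tendsto_upProd hT l) (Or.inr hP)) key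
    exact (ENNReal.mul_le_mul_iff_left hQ1 (progW_ne_top T T)).1 this

end UpFormula

section Words

/-- The function obtained by composing `up a` for the letters `(true, a)` and `down a` for the
letters `(false, a)` of a word and applying the result to the constant function `1`. -/
noncomputable def applyWord : List (Bool × ℝ) → Ptn → ENNReal
  | [] => 1
  | (true, a) :: r => up a (applyWord r)
  | (false, a) :: r => down a (applyWord r)

/-- The parameter of the single factor attached to a letter. -/
def letterSingle (T : ℝ) (x : Bool × ℝ) : ℝ := if x.1 then x.2 else T - x.2

/-- The contribution of the first letter to the parameter of the factor attached to a pair. -/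
def letterLeft (T : ℝ) (x : Bool × ℝ) : ℝ := if x.1 then x.2 else 2 * T - x.2

/-- The contribution of the second letter to the parameter of the factor attached to a pair. -/
def letterRight (x : Bool × ℝ) : ℝ := if x.1 then x.2 else -x.2

/-- The product formula for `total T (applyUp l (applyWord r))`. -/
noncomputable def wordProd (T : ℝ) (l : List ℝ) (r : List (Bool × ℝ)) : ENNReal :=
  upProd T l * (r.map fun x => progW (letterSingle T x) T).prod *
    (l.map fun a => (r.map fun x => progW (a + letterRight x) (2 * T)).prod).prod *
    pairProd (fun x y => progW (letterLeft T x + letterRight y) (2 * T)) r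

theorem total_applyWord {T : ℝ} (hT : 0 < T) (r : List (Bool × ℝ)) :
    ∀ l : List ℝ, (∀ a ∈ l, 0 < a) → (∀ x ∈ r, 0 < letterSingle T x) →
      (∀ a ∈ l, ∀ x ∈ r, 0 < a + letterRight x) →
      r.Pairwise (fun x y => 0 < letterLeft T x + letterRight y) →
      total T (applyUp l (applyWord r)) = wordProd T l r := by
  induction r with
  | nil =>
    intro l hl _ _ _
    simp [applyWord, wordProd, pairProd, total_applyUp hT l hl]
  | cons x r ih =>
    intro l hl h1 h2 h3
    rw [List.pairwise_cons] at h3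
    have h1' : ∀ x ∈ r, 0 < letterSingle T x := fun y hy => h1 y (by simp [hy])
    have hx := h1 x (by simp)
    obtain ⟨_ | _, S⟩ := x
    · have hx' : 0 < T - S := by simpa [letterSingle] using hx
      have e1 : progW (T - S) T = geomW (T - S) * progW (2 * T - S) T := by
        rw [progW_eq_mul hx' hT]; ring_nf
      have e2 : (l.map fun a => progW (a - S) (2 * T)).prod =
          (l.map fun a => geomW (a - S)).prod *
            (l.map fun a => progW (2 * T - S + a) (2 * T)).prod := by
        rw [← List.prod_map_mul]
        congr 1
        refine List.map_congr_left fun a ha => ?_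
        have : 0 < a - S := by
          simpa [letterRight, sub_eq_add_neg] using h2 a ha (false, S) (by simp)
        rw [progW_eq_mul this (by positivity)]
        ring_nf
      have e3 : (l.map fun a => (((false, S) :: r).map fun x =>
          progW (a + letterRight x) (2 * T)).prod).prod =
          (l.map fun a => progW (a - S) (2 * T)).prod *
          (l.map fun a => (r.map fun x => progW (a + letterRight x) (2 * T)).prod).prod := by
        rw [← List.prod_map_mul]
        simp [letterRight, sub_eq_add_neg]
      rw [applyWord, total_applyUp_down, ih]
      · simp only [wordProd, e3]
        simp only [upProd, pairProd, List.map_cons, List.prod_cons, letterSingle, letterLeft, e1,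
          e2, Bool.false_eq_true, if_false]
        ring
      · intro a ha
        rcases List.mem_cons.1 ha with rfl | ha
        exacts [by linarith, hl a ha]
      · exact h1'
      · intro a ha y hy
        rcases List.mem_cons.1 ha with rfl | ha
        exacts [by simpa [letterLeft] using h3.1 y hy, h2 a ha y (by simp [hy])]
      · exact h3.2
    · have e3 : (l.map fun a => (((true, S) :: r).map fun x =>
          progW (a + letterRight x) (2 * T)).prod).prod =
          (l.map fun a => progW (a + S) (2 * T)).prod *
          (l.map fun a => (r.map fun x => progW (a + letterRight x) (2 * T)).prod).prod := by
        rw [← List.prod_map_mul]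
        simp [letterRight]
      have e4 : applyUp l (applyWord ((true, S) :: r)) = applyUp (l ++ [S]) (applyWord r) := by
        rw [applyUp_append, applyWord, applyUp_cons, applyUp_nil]
      rw [e4, ih]
      · simp only [wordProd, e3]
        simp only [upProd, pairProd_append, pairProd, List.map_append, List.prod_append,
          List.map_cons, List.prod_cons, List.map_nil, List.prod_nil, mul_one, letterSingle,
          letterLeft, if_true]
        ring
      · intro a ha
        rcases List.mem_append.1 ha with ha | ha
        · exact hl a ha
        · rw [List.mem_singleton.1 ha]
          simpa [letterSingle] using hx
      · exact h1'
      · intro a ha y hy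
        rcases List.mem_append.1 ha with ha | ha
        · exact h2 a ha y (by simp [hy])
        · rw [List.mem_singleton.1 ha]
          simpa [letterLeft] using h3.1 y hy
      · exact h3.2

end Words

section Profiles

/-- The word of operators attached to a profile. -/
noncomputable def profileWord (τ : ℝ) : ℕ → (ℕ → ℤ) → List (Bool × ℝ)
  | 0, _ => []
  | n + 1, δ => (decide (δ 1 = 1), 2 * τ * (n + 1)) :: profileWord τ n fun i => δ (i + 1)

lemma isDSPP_cons_cons {n : ℕ} {δ : ℕ → ℤ} {lam nu : Ptn} {L : Fin n → Ptn} :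
    IsDSPP (n + 2) δ (Fin.cons lam (Fin.cons nu L : Fin (n + 1) → Ptn) : Fin (n + 2) → Ptn) ↔
      (if δ 1 = 1 then HStrip lam nu else HStrip nu lam) ∧
        IsDSPP (n + 1) (fun i => δ (i + 1)) (Fin.cons nu L : Fin (n + 1) → Ptn) := by
  constructor
  · intro h
    have h0 := h 0 (by omega)
    exact ⟨h0, fun i hi => h (i + 1) (by omega)⟩
  · rintro ⟨h0, h⟩ i hi
    rcases i with _ | i
    exacts [h0, h i (by omega)]

open Classical in
lemma tsum_isDSPP_cons (τ : ℝ) (n : ℕ) (δ : ℕ → ℤ) (lam : Ptn) :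
    (∑' L : Fin n → Ptn, if IsDSPP (n + 1) δ (Fin.cons lam L : Fin (n + 1) → Ptn) then
      expW (2 * τ * ∑ i, ((L i).size : ℝ)) else 0) =
      expW (2 * τ * n * lam.size) * applyWord (profileWord τ n δ) lam := by
  induction n generalizing δ lam with
  | zero =>
    have : ∀ L : Fin 0 → Ptn, IsDSPP (0 + 1) δ (Fin.cons lam L : Fin (0 + 1) → Ptn) :=
      fun L i hi => by omega
    rw [tsum_fintype, Fintype.sum_unique, if_pos (this _)]
    simp [profileWord, applyWord]
  | succ n ih =>
    rw [← (Fin.consEquiv fun _ : Fin (n + 1) => Ptn).tsum_eq, ENNReal.tsum_prod']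
    have key : ∀ nu : Ptn, (∑' L : Fin n → Ptn,
        if IsDSPP (n + 1 + 1) δ (Fin.cons lam (Fin.consEquiv (fun _ : Fin (n + 1) => Ptn) (nu, L)) :
          Fin (n + 1 + 1) → Ptn) then
        expW (2 * τ * ∑ i, ((Fin.consEquiv (fun _ : Fin (n + 1) => Ptn) (nu, L) i).size : ℝ))
        else 0)
        = (if δ 1 = 1 then strip lam nu else strip nu lam) * (expW (2 * τ * (n + 1) * nu.size) *
          applyWord (profileWord τ n fun i => δ (i + 1)) nu) := fun nu => by
      have e : 2 * τ * (n + 1) * nu.size = 2 * τ * nu.size + 2 * τ * n * nu.size := by ring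
      rw [e, expW_add, mul_assoc (expW _), ← ih, ← ENNReal.tsum_mul_left, ← ENNReal.tsum_mul_left]
      refine tsum_congr fun L => ?_
      change (if IsDSPP (n + 2) δ (Fin.cons lam (Fin.cons nu L : Fin (n + 1) → Ptn) :
        Fin (n + 2) → Ptn) then
        expW (2 * τ * ∑ i, (((Fin.cons nu L : Fin (n + 1) → Ptn) i).size : ℝ))
        else 0) = _
      rw [Fin.sum_univ_succ, mul_add, expW_add]
      simp only [isDSPP_cons_cons, Fin.cons_zero, Fin.cons_succ]
      by_cases h1 : δ 1 = 1 <;>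
        by_cases h2 : IsDSPP (n + 1) (fun i => δ (i + 1)) (Fin.cons nu L : Fin (n + 1) → Ptn) <;>
        simp [h1, h2, strip]
    simp_rw [key]
    have hw : ∀ nu : Ptn, expW (2 * τ * (n + 1) * nu.size) = expW (2 * τ * (n + 1) * lam.size) *
        expW (2 * τ * (n + 1) * (nu.size - lam.size)) := fun nu => by
      rw [← expW_add]; congr 1; ring
    by_cases h : δ 1 = 1
    · simp only [profileWord, h, decide_true, applyWord, up, if_true, ← ENNReal.tsum_mul_left]
      refine tsum_congr fun nu => ?_
      rw [hw]; push_cast; ring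
    · simp only [profileWord, h, decide_false, applyWord, down, if_false, ← ENNReal.tsum_mul_left]
      refine tsum_congr fun nu => ?_
      rw [hw]; push_cast; ring

open Classical in
lemma tsum_isDSPP (τ : ℝ) (h : ℕ) (δ : ℕ → ℤ) :
    (∑' L : Fin (h + 1) → Ptn, if IsDSPP (h + 1) δ L then
      expW (τ * ((L 0).size + 2 * ∑ i : Fin h, ((L i.succ).size : ℝ))) else 0) =
      total (τ * (2 * h + 1)) (applyWord (profileWord τ h δ)) := by
  rw [← (Fin.consEquiv fun _ : Fin (h + 1) => Ptn).tsum_eq, ENNReal.tsum_prod', total]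
  refine tsum_congr fun lam => ?_
  have e : τ * (2 * h + 1) * lam.size = τ * lam.size + 2 * τ * h * lam.size := by ring
  rw [e, expW_add, mul_assoc, ← tsum_isDSPP_cons, ← ENNReal.tsum_mul_left]
  refine tsum_congr fun L => ?_
  change (if IsDSPP (h + 1) δ (Fin.cons lam L : Fin (h + 1) → Ptn) then
    expW (τ * (lam.size + 2 * ∑ i : Fin h, ((L i).size : ℝ))) else 0) = _
  rw [mul_ite, mul_zero, ← expW_add]
  congr 2
  ring

/-- The second half of a symmetric cylindric partition. -/
def upperHalf (h : ℕ) (M : Fin (2 * h + 1) → Ptn) (i : Fin (h + 1)) : Ptn :=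
  M ⟨h + i, by omega⟩

/-- The palindromic sequence with a given second half. -/
def unfoldHalf (h : ℕ) (L : Fin (h + 1) → Ptn) (k : Fin (2 * h + 1)) : Ptn :=
  L ⟨(k - h) + (h - k), by omega⟩

lemma isDSPP_upperHalf {h : ℕ} {δ : ℕ → ℤ} {M : Fin (2 * h + 1) → Ptn} (hM : IsSCP h δ M) :
    IsDSPP (h + 1) δ (upperHalf h M) := by
  intro i hi
  have := hM.1 (h + i) (by omega)
  have e : dblProfile h δ (h + i + 1) = δ (i + 1) := by
    rw [dblProfile, if_neg (by omega), add_assoc, Nat.add_sub_cancel_left]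
  rw [e] at this
  exact this

lemma isSCP_unfoldHalf {h : ℕ} {δ : ℕ → ℤ} (hδ : IsProfile h δ) {L : Fin (h + 1) → Ptn}
    (hL : IsDSPP (h + 1) δ L) : IsSCP h δ (unfoldHalf h L) := by
  refine ⟨fun i hi => ?_, fun k => congrArg L (Fin.ext ?_)⟩
  · by_cases hih : i + 1 ≤ h
    · have h1 := hL (h - i - 1) (by omega)
      have ed : δ (h - i - 1 + 1) = δ (h - i) := congrArg δ (by omega)
      have e1 : unfoldHalf h L ⟨i, Nat.lt_of_succ_lt hi⟩ = L ⟨h - i, by omega⟩ :=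
        congrArg L (Fin.ext (show (i - h) + (h - i) = h - i by omega))
      have e2 : unfoldHalf h L ⟨i + 1, hi⟩ = L ⟨h - i - 1, by omega⟩ :=
        congrArg L (Fin.ext (show (i + 1 - h) + (h - (i + 1)) = h - i - 1 by omega))
      have e3 : L ⟨h - i - 1 + 1, by omega⟩ = L ⟨h - i, by omega⟩ :=
        congrArg L (Fin.ext (show h - i - 1 + 1 = h - i by omega))
      rw [dblProfile, if_pos hih, show h + 1 - (i + 1) = h - i by omega, e1, e2]
      rw [ed, e3] at h1
      rcases hδ (h - i) (by omega) (by omega) with hd | hd <;> rw [hd] at h1 ⊢ <;> simpa using h1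
    · have h1 := hL (i - h) (by omega)
      have e1 : unfoldHalf h L ⟨i, Nat.lt_of_succ_lt hi⟩ = L ⟨i - h, by omega⟩ :=
        congrArg L (Fin.ext (show (i - h) + (h - i) = i - h by omega))
      have e2 : unfoldHalf h L ⟨i + 1, hi⟩ = L ⟨i - h + 1, by omega⟩ :=
        congrArg L (Fin.ext (show (i + 1 - h) + (h - (i + 1)) = i - h + 1 by omega))
      rw [dblProfile, if_neg hih, show i + 1 - h = i - h + 1 by omega, e1, e2]
      exact h1
  · have := k.isLt
    change (k : ℕ) - h + (h - k) = 2 * h - k - h + (h - (2 * h - k))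
    omega

/-- Symmetric cylindric partitions are determined by their second halves. -/
def scpEquiv (h : ℕ) (δ : ℕ → ℤ) (hδ : IsProfile h δ) :
    {M : Fin (2 * h + 1) → Ptn // IsSCP h δ M} ≃ {L : Fin (h + 1) → Ptn // IsDSPP (h + 1) δ L} where
  toFun M := ⟨upperHalf h M.1, isDSPP_upperHalf M.2⟩
  invFun L := ⟨unfoldHalf h L.1, isSCP_unfoldHalf hδ L.2⟩
  left_inv M := by
    refine Subtype.ext (funext fun k => ?_)
    have hk := k.isLt
    change M.1 ⟨h + ((k - h) + (h - k)), _⟩ = M.1 k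
    by_cases hkh : (k : ℕ) ≤ h
    · rw [M.2.2 k]
      exact congrArg M.1 (Fin.ext (show h + ((k - h) + (h - k)) = 2 * h - k by omega))
    · exact congrArg M.1 (Fin.ext (show h + ((k - h) + (h - k)) = k by omega))
  right_inv L := by
    refine Subtype.ext (funext fun i => congrArg L.1 (Fin.ext ?_))
    change h + i - h + (h - (h + i)) = (i : ℕ)
    omega

lemma scpSize_eq_upperHalf (h : ℕ) (M : Fin (2 * h + 1) → Ptn) :
    scpSize h M = (upperHalf h M 0).size + 2 * ∑ i : Fin h, (upperHalf h M i.succ).size := rfl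

lemma tsum_scpSize (τ : ℝ) {h : ℕ} {δ : ℕ → ℤ} (hδ : IsProfile h δ) :
    ∑' M : {M : Fin (2 * h + 1) → Ptn // IsSCP h δ M}, expW (τ * scpSize h M.1) =
      total (τ * (2 * h + 1)) (applyWord (profileWord τ h δ)) := by
  classical
  rw [← tsum_isDSPP, ← (scpEquiv h δ hδ).symm.tsum_eq]
  have := tsum_subtype {L : Fin (h + 1) → Ptn | IsDSPP (h + 1) δ L} fun L =>
    expW (τ * ((L 0).size + 2 * ∑ i : Fin h, ((L i.succ).size : ℝ)))
  simp only [Set.indicator, Set.mem_ofPred_eq] at this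
  rw [← this]
  refine tsum_congr fun L => ?_
  have e : upperHalf h ((scpEquiv h δ hδ).symm L).1 = L.1 :=
    congrArg Subtype.val ((scpEquiv h δ hδ).apply_symm_apply L)
  rw [scpSize_eq_upperHalf, e]
  push_cast
  rfl

lemma tsum_SCPcount {τ : ℝ} (m : ℕ) {δ : ℕ → ℤ} (hδ : IsProfile (m - 1) δ)
    (hfin : total (τ * (2 * (m - 1 : ℕ) + 1)) (applyWord (profileWord τ (m - 1) δ)) ≠ ⊤) :
    ∑' n : ℕ, (SCPcount m δ n : ENNReal) * expW (τ * n) =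
      total (τ * (2 * (m - 1 : ℕ) + 1)) (applyWord (profileWord τ (m - 1) δ)) := by
  rw [← tsum_scpSize τ hδ] at hfin ⊢
  rw [← (Equiv.sigmaFiberEquiv fun M : {M : Fin (2 * (m - 1) + 1) → Ptn // IsSCP (m - 1) δ M} =>
    scpSize (m - 1) M.1).tsum_eq, ENNReal.tsum_sigma'] at hfin ⊢
  refine tsum_congr fun n => ?_
  have hn : ∀ M : {M : {M : Fin (2 * (m - 1) + 1) → Ptn // IsSCP (m - 1) δ M} //
      scpSize (m - 1) M.1 = n}, expW (τ * scpSize (m - 1) ((Equiv.sigmaFiberEquiv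
        fun M : {M : Fin (2 * (m - 1) + 1) → Ptn // IsSCP (m - 1) δ M} =>
          scpSize (m - 1) M.1) ⟨n, M⟩).1) = expW (τ * n) := fun M => by
    change expW (τ * scpSize (m - 1) M.1.1) = _
    rw [M.2]
  have hlt := ne_top_of_le_ne_top hfin (ENNReal.le_tsum n)
  simp_rw [hn] at hlt ⊢
  rw [ENNReal.tsum_const] at hlt ⊢
  congr 1
  have e := Nat.card_congr (Equiv.subtypeSubtypeEquivSubtypeInter
    (fun M : Fin (2 * (m - 1) + 1) → Ptn => IsSCP (m - 1) δ M) fun M => scpSize (m - 1) M = n)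
  rw [SCPcount, ← e]
  have : ENat.card {M : {M : Fin (2 * (m - 1) + 1) → Ptn // IsSCP (m - 1) δ M} //
      scpSize (m - 1) M.1 = n} ≠ ⊤ := fun h => by
    rw [h] at hlt
    exact hlt (by simp [expW_ne_zero])
  rw [Ne, ENat.card_eq_top, not_infinite_iff_finite] at this
  rw [ENat.card_eq_coe_natCard]
  rfl

end Profiles

section ProfileProduct

lemma pairProd_map {ι κ M : Type*} [CommMonoid M] (g : κ → κ → M) (f : ι → κ) (l : List ι) :
    pairProd g (l.map f) = pairProd (fun a b => g (f a) (f b)) l := by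
  induction l with
  | nil => rfl
  | cons a l ih => simp [pairProd, ih, Function.comp_def]

lemma pairProd_eq_prod_filter {M : Type*} [CommMonoid M] (g : ℕ → ℕ → M) (n : ℕ) :
    pairProd g (List.range' 1 n) =
      ∏ q ∈ (Finset.Icc 1 n ×ˢ Finset.Icc 1 n).filter (fun q => q.1 < q.2), g q.1 q.2 := by
  have key : ∀ l : List ℕ, l.Pairwise (· < ·) → pairProd g l =
      (l.map fun i => (l.map fun j => if i < j then g i j else 1).prod).prod := fun l hl => by
    induction l with
    | nil => rfl
    | cons a l ih =>
      rw [List.pairwise_cons] at hl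
      rw [pairProd, ih hl.2, List.map_cons, List.prod_cons, List.map_cons, List.prod_cons,
        if_neg (lt_irrefl a), one_mul]
      congr 1
      · exact congrArg _ (List.map_congr_left fun j hj => (if_pos (hl.1 j hj)).symm)
      · refine congrArg _ (List.map_congr_left fun i hi => ?_)
        rw [List.map_cons, List.prod_cons, if_neg (hl.1 i hi).not_gt, one_mul]
  rw [Finset.prod_filter, Finset.prod_product, key _ List.pairwise_lt_range']
  rfl

lemma profileWord_eq_map (τ : ℝ) (n : ℕ) (δ : ℕ → ℤ) : profileWord τ n δ =
    (List.range' 1 n).map fun i => (decide (δ i = 1), 2 * τ * ((n : ℝ) + 1 - i)) := by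
  induction n generalizing δ with
  | zero => rfl
  | succ n ih =>
    rw [profileWord, ih, List.range'_succ, List.map_cons, ← List.map_add_range', List.map_map]
    congr 1
    · simp
    · refine List.map_congr_left fun i _ => ?_
      simp only [Function.comp, add_comm 1 i]
      push_cast
      congr 2
      ring

/-- The element of `W4` contributed by an index. -/
def singleElt (m : ℕ) (δ : ℕ → ℤ) (i : ℕ) : ℕ := if δ i = -1 then 2 * i - 1 else 2 * m - 2 * i

/-- The element of `W5` contributed by a pair of indices. -/
def pairElt (m : ℕ) (δ : ℕ → ℤ) (q : ℕ × ℕ) : ℕ :=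
  if δ q.1 = -1 ∧ δ q.2 = -1 then 2 * q.1 + 2 * q.2 - 2
  else if δ q.1 = 1 ∧ δ q.2 = 1 then 4 * m - 2 * q.1 - 2 * q.2
  else if δ q.1 < δ q.2 then 2 * (2 * m - 1) + 2 * q.1 - 2 * q.2
  else 2 * q.2 - 2 * q.1

lemma W4_eq (m : ℕ) (δ : ℕ → ℤ) :
    W4 m δ = (2 * m - 1) ::ₘ (Finset.Icc 1 (m - 1)).val.map (singleElt m δ) := rfl

lemma W5_eq (m : ℕ) (δ : ℕ → ℤ) : W5 m δ = (((Finset.Icc 1 (m - 1)) ×ˢ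
    (Finset.Icc 1 (m - 1))).filter (fun q => q.1 < q.2)).val.map (pairElt m δ) := rfl

/-- The pairs consisting of a period and a residue for the product formula. -/
def scpParam (m : ℕ) (δ : ℕ → ℤ) : Multiset (ℕ × ℕ) :=
  (W4 m δ).map (fun t => (2 * m - 1, t)) + (W5 m δ).map (fun t => (2 * (2 * m - 1), t))

section Elements
variable {m : ℕ} {δ : ℕ → ℤ}

lemma singleElt_pos {i : ℕ} (hi : 1 ≤ i) (him : i ≤ m - 1) : 0 < singleElt m δ i := by
  unfold singleElt; split_ifs <;> omega

lemma pairElt_pos {i j : ℕ} (hi : 1 ≤ i) (hij : i < j) (hjm : j ≤ m - 1) :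
    0 < pairElt m δ (i, j) := by
  unfold pairElt; dsimp only; split_ifs <;> omega

lemma pos_of_mem_W4 (hm : 2 ≤ m) {t : ℕ} (ht : t ∈ W4 m δ) : 0 < t := by
  rw [W4_eq, Multiset.mem_cons, Multiset.mem_map] at ht
  obtain rfl | ⟨i, hi, rfl⟩ := ht
  · omega
  · rw [Finset.mem_val, Finset.mem_Icc] at hi
    exact singleElt_pos hi.1 hi.2

lemma pos_of_mem_W5 {t : ℕ} (ht : t ∈ W5 m δ) : 0 < t := by
  rw [W5_eq, Multiset.mem_map] at ht
  obtain ⟨⟨i, j⟩, hq, rfl⟩ := ht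
  simp only [Finset.mem_val, Finset.mem_filter, Finset.mem_product, Finset.mem_Icc] at hq
  exact pairElt_pos hq.1.1.1 hq.2 hq.1.2.2

lemma pos_of_mem_scpParam (hm : 2 ≤ m) {x : ℕ × ℕ} (hx : x ∈ scpParam m δ) :
    0 < x.1 ∧ 0 < x.2 := by
  rw [scpParam, Multiset.mem_add, Multiset.mem_map, Multiset.mem_map] at hx
  obtain ⟨t, ht, rfl⟩ | ⟨t, ht, rfl⟩ := hx
  · exact ⟨show 0 < 2 * m - 1 by omega, pos_of_mem_W4 hm ht⟩
  · exact ⟨show 0 < 2 * (2 * m - 1) by omega, pos_of_mem_W5 ht⟩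

lemma letterSingle_eq (τ : ℝ) (hδ : IsProfile (m - 1) δ) {i : ℕ} (hi : 1 ≤ i) (him : i ≤ m - 1) :
    letterSingle (τ * (2 * (m - 1 : ℕ) + 1))
      (decide (δ i = 1), 2 * τ * (((m - 1 : ℕ) : ℝ) + 1 - i)) = τ * singleElt m δ i := by
  have h1 : ((m - 1 : ℕ) : ℝ) = m - 1 := by rw [Nat.cast_sub (by omega), Nat.cast_one]
  rcases hδ i hi him with h | h
  · rw [letterSingle, singleElt, if_pos (by simp [h]), if_neg (by simp [h]), h1,
      Nat.cast_sub (by omega)]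
    push_cast; ring
  · rw [letterSingle, singleElt, if_neg (by simp [h]), if_pos h, h1, Nat.cast_sub (by omega)]
    push_cast; ring

lemma letterLeft_add_letterRight_eq (τ : ℝ) (hδ : IsProfile (m - 1) δ) {i j : ℕ} (hi : 1 ≤ i)
    (hij : i < j) (hjm : j ≤ m - 1) :
    letterLeft (τ * (2 * (m - 1 : ℕ) + 1))
        (decide (δ i = 1), 2 * τ * (((m - 1 : ℕ) : ℝ) + 1 - i)) +
      letterRight (decide (δ j = 1), 2 * τ * (((m - 1 : ℕ) : ℝ) + 1 - j)) =
        τ * pairElt m δ (i, j) := by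
  have h1 : ((m - 1 : ℕ) : ℝ) = m - 1 := by rw [Nat.cast_sub (by omega), Nat.cast_one]
  rw [h1]
  rcases hδ i hi (by omega) with h | h <;> rcases hδ j (by omega) hjm with h' | h' <;>
    simp only [letterLeft, letterRight, pairElt, h, h']
  · norm_num
    rw [Nat.sub_sub, Nat.cast_sub (by omega)]
    push_cast; ring
  · norm_num
    rw [Nat.cast_sub (by omega)]
    push_cast; ring
  · norm_num
    rw [Nat.cast_sub (by omega)]
    push_cast
    rw [Nat.cast_sub (by omega)]
    push_cast; ring
  · norm_num
    rw [Nat.cast_sub (by omega)]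
    push_cast; ring

end Elements

lemma progW_mul_mul (τ : ℝ) (hτ : 0 < τ) (s t : ℕ) :
    progW (τ * t) (τ * s) = ENNReal.ofReal (Real.exp (progLog (s * τ) (t / s))) := by
  rw [progW, mul_div_mul_left _ _ hτ.ne', mul_comm τ]

lemma multiset_prod_ofReal_exp {ι : Type*} (s : Multiset ι) (f : ι → ℝ) :
    (s.map fun i => ENNReal.ofReal (Real.exp (f i))).prod =
      ENNReal.ofReal (Real.exp (s.map f).sum) := by
  induction s using Multiset.induction_on with
  | empty => simp
  | cons a s ih =>
    rw [Multiset.map_cons, Multiset.prod_cons, ih, Multiset.map_cons, Multiset.sum_cons,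
      Real.exp_add, ENNReal.ofReal_mul (Real.exp_pos _).le]

lemma total_profileWord {τ : ℝ} (hτ : 0 < τ) {m : ℕ} (hm : 2 ≤ m) {δ : ℕ → ℤ}
    (hδ : IsProfile (m - 1) δ) :
    total (τ * (2 * (m - 1 : ℕ) + 1)) (applyWord (profileWord τ (m - 1) δ)) =
      ENNReal.ofReal (Real.exp ((scpParam m δ).map fun x : ℕ × ℕ =>
        progLog (x.1 * τ) (x.2 / x.1)).sum) := by
  have hT : (2 * (m - 1 : ℕ) + 1 : ℝ) = (2 * m - 1 : ℕ) := by
    rw [show 2 * m - 1 = 2 * (m - 1) + 1 by omega]; push_cast; ring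
  have hT2 : 2 * (τ * (2 * (m - 1 : ℕ) + 1)) = τ * (2 * (2 * m - 1) : ℕ) := by
    rw [hT]; push_cast; ring
  have hT0 : (0 : ℝ) < 2 * (m - 1 : ℕ) + 1 := by positivity
  have hr : profileWord τ (m - 1) δ = _ := profileWord_eq_map τ (m - 1) δ
  have hmem : ∀ {i}, i ∈ List.range' 1 (m - 1) → 1 ≤ i ∧ i ≤ m - 1 := fun {i} hi => by
    rw [List.mem_range'_1] at hi
    omega
  have h := total_applyWord (mul_pos hτ hT0) (profileWord τ (m - 1) δ) [] (by simp) (by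
      rw [hr]
      simp only [List.mem_map, forall_exists_index, and_imp]
      rintro _ i hi rfl
      obtain ⟨h1, h2⟩ := hmem hi
      rw [letterSingle_eq τ hδ h1 h2]
      have := singleElt_pos (δ := δ) h1 h2
      positivity) (by simp) (by
      rw [hr, List.pairwise_map]
      refine List.Pairwise.imp_of_mem ?_ List.pairwise_lt_range'
      intro i j hi hj hij
      rw [letterLeft_add_letterRight_eq τ hδ (hmem hi).1 hij (hmem hj).2]
      have := pairElt_pos (δ := δ) (hmem hi).1 hij (hmem hj).2
      positivity)
  rw [applyUp_nil] at h
  rw [h, wordProd, hr, pairProd_map, pairProd_eq_prod_filter, List.map_map,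
    ← multiset_prod_ofReal_exp,
    scpParam, Multiset.map_add, Multiset.prod_add, Multiset.map_map, Multiset.map_map, W4_eq,
    Multiset.map_cons, Multiset.prod_cons, W5_eq, Multiset.map_map, Multiset.map_map, List.map_nil,
    List.prod_nil, mul_one]
  congr 1
  · congr 1
    · simp only [upProd, pairProd, List.map_nil, List.prod_nil, mul_one, Function.comp]
      rw [hT, progW_mul_mul τ hτ]
    · change _ = ((List.range' 1 (m - 1)).map _).prod
      refine congrArg _ (List.map_congr_left fun i hi => ?_)
      simp only [Function.comp]
      rw [letterSingle_eq τ hδ (hmem hi).1 (hmem hi).2, hT, progW_mul_mul τ hτ]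
  · refine Finset.prod_congr rfl fun q hq => ?_
    simp only [Finset.mem_filter, Finset.mem_product, Finset.mem_Icc] at hq
    simp only [Function.comp]
    rw [letterLeft_add_letterRight_eq τ hδ hq.1.1.1 hq.2 hq.1.2.2, hT2, progW_mul_mul τ hτ]

/-- The product formula for the generating function of symmetric cylindric partitions. -/
theorem hasSum_SCPcount {τ : ℝ} (hτ : 0 < τ) {m : ℕ} (hm : 2 ≤ m) {δ : ℕ → ℤ}
    (hδ : IsProfile (m - 1) δ) :
    HasSum (fun n : ℕ => (SCPcount m δ n : ℝ) * Real.exp (-(n * τ)))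
      (Real.exp ((scpParam m δ).map fun x : ℕ × ℕ => progLog (x.1 * τ) (x.2 / x.1)).sum) := by
  have h1 := total_profileWord hτ hm hδ
  have h2 := tsum_SCPcount (τ := τ) m hδ (by rw [h1]; exact ENNReal.ofReal_ne_top)
  rw [h1] at h2
  have h3 : ∀ n : ℕ, (SCPcount m δ n : ENNReal) * expW (τ * n) =
      ENNReal.ofReal ((SCPcount m δ n : ℝ) * Real.exp (-(n * τ))) := fun n => by
    rw [ENNReal.ofReal_mul (Nat.cast_nonneg _), ENNReal.ofReal_natCast, expW, mul_comm τ]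
  simp_rw [h3] at h2
  have h4 : Summable fun n : ℕ => (SCPcount m δ n : ℝ) * Real.exp (-(n * τ)) := by
    have := ENNReal.summable_toReal (h2 ▸ ENNReal.ofReal_ne_top)
    refine this.congr fun n => ENNReal.toReal_ofReal (by positivity)
  rw [← ENNReal.ofReal_tsum_of_nonneg (fun n => by positivity) h4,
    ENNReal.ofReal_eq_ofReal_iff (tsum_nonneg fun n => by positivity) (Real.exp_pos _).le] at h2
  exact h2 ▸ h4.hasSum

end ProfileProduct

section Assembly
open Filter Topology

lemma card_filter_lt (n : ℕ) :
    2 * (((Finset.Icc 1 n ×ˢ Finset.Icc 1 n).filter fun q => q.1 < q.2).card : ℝ) =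
      n * (n - 1) := by
  have h : ∀ n : ℕ, ((Finset.Icc 1 n ×ˢ Finset.Icc 1 n).filter fun q => q.1 < q.2).card =
      ∑ j ∈ Finset.Icc 1 n, (j - 1) := fun n => by
    rw [Finset.card_filter, Finset.sum_product_right]
    refine Finset.sum_congr rfl fun j hj => ?_
    rw [← Finset.card_filter, show (Finset.Icc 1 n).filter (fun i => i < j) = Finset.Ico 1 j by
      ext i
      simp only [Finset.mem_filter, Finset.mem_Icc, Finset.mem_Ico] at hj ⊢
      omega, Nat.card_Ico]
  induction n with
  | zero => simp
  | succ n ih =>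
    rw [h n] at ih
    rw [h, Finset.sum_Icc_succ_top (by omega), Nat.cast_add, mul_add, ih]
    push_cast
    ring

lemma card_W4 {m : ℕ} (hm : 2 ≤ m) (δ : ℕ → ℤ) : ((W4 m δ).card : ℝ) = m := by
  rw [W4_eq, Multiset.card_cons, Multiset.card_map, Finset.card_val, Nat.card_Icc]
  norm_cast
  omega

lemma card_W5 {m : ℕ} (hm : 2 ≤ m) (δ : ℕ → ℤ) :
    ((W5 m δ).card : ℝ) = ((m : ℝ) - 1) * (m - 2) / 2 := by
  have h := card_filter_lt (m - 1)
  rw [Nat.cast_sub (by omega), Nat.cast_one] at h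
  rw [W5_eq, Multiset.card_map, Finset.card_val]
  linarith

lemma multiset_sum_map_affine (s : Multiset ℕ) (p q : ℝ) :
    (s.map fun t : ℕ => p * t + q).sum = p * (s.map fun t : ℕ => (t : ℝ)).sum + q * s.card := by
  induction s using Multiset.induction_on with
  | empty => simp
  | cons a s ih =>
    simp only [Multiset.map_cons, Multiset.sum_cons, Multiset.card_cons, ih]
    push_cast
    ring

lemma multiset_prod_eq_exp_sum_log {ι : Type*} (s : Multiset ι) (f : ι → ℝ)
    (h : ∀ x ∈ s, 0 < f x) :
    (s.map f).prod = Real.exp (s.map fun x => Real.log (f x)).sum := by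
  induction s using Multiset.induction_on with
  | empty => simp
  | cons a s ih =>
    rw [Multiset.map_cons, Multiset.prod_cons, ih fun x hx => h x (Multiset.mem_cons_of_mem hx),
      Multiset.map_cons, Multiset.sum_cons, Real.exp_add,
      Real.exp_log (h a (Multiset.mem_cons_self a s))]

lemma multiset_map_bind_pure_cast (s : Multiset ℕ) (f : ℝ → ℝ) :
    Multiset.map f (s >>= fun a : ℕ => pure (a : ℝ)) = s.map fun t : ℕ => f t := by
  change Multiset.map f (s.bind fun a : ℕ => {(a : ℝ)}) = _
  rw [Multiset.bind_singleton, Multiset.map_map]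
  rfl

section Constants
variable {m : ℕ} (δ : ℕ → ℤ)

lemma cast_two_mul_sub_one {m : ℕ} (hm : 2 ≤ m) : ((2 * m - 1 : ℕ) : ℝ) = 2 * m - 1 := by
  rw [Nat.cast_sub (by omega)]; push_cast; ring

lemma bSCP_eq (hm : 2 ≤ m) : bSCP m δ =
    ((W4 m δ).map fun t : ℕ => (t : ℝ)).sum / (2 * (2 * m - 1)) +
      ((W5 m δ).map fun t : ℕ => (t : ℝ)).sum / (4 * (2 * m - 1)) -
      ((m : ℝ) ^ 2 - m + 2) / 8 := by
  have h4 := multiset_sum_map_affine (W4 m δ) (1 / (2 * (2 * m - 1))) (-1 / 4)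
  have h5 := multiset_sum_map_affine (W5 m δ) (1 / (4 * (2 * m - 1))) (-1 / 4)
  have e4 : ∀ t : ℕ, (t : ℝ) / (2 * (2 * m - 1)) - 1 / 4 =
      1 / (2 * (2 * m - 1)) * t + -1 / 4 := fun t => by ring
  have e5 : ∀ t : ℕ, (t : ℝ) / (4 * (2 * m - 1)) - 1 / 4 =
      1 / (4 * (2 * m - 1)) * t + -1 / 4 := fun t => by ring
  simp only [bSCP, multiset_map_bind_pure_cast, e4, e5, h4, h5, card_W4 hm, card_W5 hm]
  ring

lemma sum_scpParam (f : ℕ × ℕ → ℝ) : ((scpParam m δ).map f).sum =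
    ((W4 m δ).map fun t => f (2 * m - 1, t)).sum +
      ((W5 m δ).map fun t => f (2 * (2 * m - 1), t)).sum := by
  rw [scpParam, Multiset.map_add, Multiset.sum_add, Multiset.map_map, Multiset.map_map]
  rfl

lemma sum_scpParam_leading (hm : 2 ≤ m) :
    ((scpParam m δ).map fun x : ℕ × ℕ => Real.pi ^ 2 / (6 * x.1)).sum = rSCP m / 4 := by
  have hT := cast_two_mul_sub_one hm
  have h0 : (2 * (m : ℝ) - 1) ≠ 0 := by
    have : (2 : ℝ) ≤ m := by exact_mod_cast hm
    linarith
  rw [sum_scpParam]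
  simp only [Multiset.map_const', Multiset.sum_replicate, nsmul_eq_mul, card_W4 hm, card_W5 hm,
    Nat.cast_mul, hT, rSCP]
  field_simp
  push_cast
  ring

lemma sum_scpParam_log_coeff (hm : 2 ≤ m) :
    ((scpParam m δ).map fun x : ℕ × ℕ => (x.2 : ℝ) / x.1 - 1 / 2).sum = 2 * bSCP m δ := by
  have h4 := multiset_sum_map_affine (W4 m δ) (1 / (2 * m - 1)) (-1 / 2)
  have h5 := multiset_sum_map_affine (W5 m δ) (1 / (2 * (2 * m - 1))) (-1 / 2)
  have e4 : ∀ t : ℕ, (t : ℝ) / (2 * m - 1) - 1 / 2 = 1 / (2 * m - 1) * t + -1 / 2 :=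
    fun t => by ring
  have e5 : ∀ t : ℕ, (t : ℝ) / (2 * (2 * m - 1)) - 1 / 2 =
      1 / (2 * (2 * m - 1)) * t + -1 / 2 := fun t => by ring
  rw [sum_scpParam]
  simp only [Nat.cast_mul, Nat.cast_ofNat, cast_two_mul_sub_one hm, e4, e5, h4, h5, card_W4 hm,
    card_W5 hm, bSCP_eq δ hm]
  have h0 : 2 * (m : ℝ) - 1 ≠ 0 := by
    have : (2 : ℝ) ≤ m := by exact_mod_cast hm
    linarith
  field_simp
  ring

lemma exp_sum_scpParam_const (hm : 2 ≤ m) :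
    Real.exp ((scpParam m δ).map fun x : ℕ × ℕ => Real.log (Real.Gamma (x.2 / x.1)) -
      1 / 2 * Real.log (2 * Real.pi) + ((x.2 : ℝ) / x.1 - 1 / 2) * Real.log x.1).sum =
      vSCP m δ * 2 ^ (2 * bSCP m δ) := by
  have hT0 : (0 : ℝ) < 2 * m - 1 := by
    have : (2 : ℝ) ≤ m := by exact_mod_cast hm
    linarith
  have hg4 := multiset_prod_eq_exp_sum_log (W4 m δ)
    (fun t : ℕ => Real.Gamma ((t : ℝ) / (2 * m - 1))) fun t ht => by
      have := pos_of_mem_W4 hm ht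
      exact Real.Gamma_pos_of_pos (by positivity)
  have hg5 := multiset_prod_eq_exp_sum_log (W5 m δ)
    (fun t : ℕ => Real.Gamma ((t : ℝ) / (2 * (2 * m - 1)))) fun t ht => by
      have := pos_of_mem_W5 ht
      exact Real.Gamma_pos_of_pos (by positivity)
  have h4 := multiset_sum_map_affine (W4 m δ) (Real.log (2 * m - 1) / (2 * m - 1))
    (-1 / 2 * Real.log (2 * Real.pi) - 1 / 2 * Real.log (2 * m - 1))
  have h5 := multiset_sum_map_affine (W5 m δ) (Real.log (2 * (2 * m - 1)) / (2 * (2 * m - 1)))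
    (-1 / 2 * Real.log (2 * Real.pi) - 1 / 2 * Real.log (2 * (2 * m - 1)))
  have e4 : ∀ t : ℕ, Real.log (Real.Gamma ((t : ℝ) / (2 * m - 1))) -
      1 / 2 * Real.log (2 * Real.pi) + ((t : ℝ) / (2 * m - 1) - 1 / 2) * Real.log (2 * m - 1) =
      Real.log (Real.Gamma ((t : ℝ) / (2 * m - 1))) +
        (Real.log (2 * m - 1) / (2 * m - 1) * t +
        (-1 / 2 * Real.log (2 * Real.pi) - 1 / 2 * Real.log (2 * m - 1))) := fun t => by ring
  have e5 : ∀ t : ℕ, Real.log (Real.Gamma ((t : ℝ) / (2 * (2 * m - 1)))) -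
      1 / 2 * Real.log (2 * Real.pi) +
        ((t : ℝ) / (2 * (2 * m - 1)) - 1 / 2) * Real.log (2 * (2 * m - 1)) =
      Real.log (Real.Gamma ((t : ℝ) / (2 * (2 * m - 1)))) +
        (Real.log (2 * (2 * m - 1)) / (2 * (2 * m - 1)) * t +
        (-1 / 2 * Real.log (2 * Real.pi) - 1 / 2 * Real.log (2 * (2 * m - 1)))) :=
    fun t => by ring
  rw [sum_scpParam, vSCP]
  simp only [multiset_map_bind_pure_cast]
  rw [hg4, hg5, Real.rpow_def_of_pos two_pos, Real.rpow_def_of_pos Real.pi_pos,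
    Real.rpow_def_of_pos hT0, Real.rpow_def_of_pos two_pos]
  simp only [← Real.exp_add, Nat.cast_mul, Nat.cast_ofNat, cast_two_mul_sub_one hm, e4, e5,
    Multiset.sum_map_add, h4, h5, card_W4 hm, card_W5 hm, bSCP_eq δ hm]
  simp only [Real.log_mul two_ne_zero Real.pi_ne_zero, Real.log_mul two_ne_zero hT0.ne']
  congr 1
  generalize (Multiset.map (fun t : ℕ => Real.log (Real.Gamma ((t : ℝ) / (2 * m - 1))))
    (W4 m δ)).sum = x
  generalize (Multiset.map (fun t : ℕ => Real.log (Real.Gamma ((t : ℝ) / (2 * (2 * m - 1)))))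
    (W5 m δ)).sum = y
  field_simp
  ring

end Constants

lemma exists_dom_scpParam {m : ℕ} (hm : 2 ≤ m) {δ : ℕ → ℤ} {A : ℕ → ℝ}
    (hA : ∀ N, 0 ≤ A N) (hs : ∀ τ : ℝ, 0 < τ → Summable fun N : ℕ => A N * Real.exp (-(N * τ)))
    (h1 : ∀ x ∈ scpParam m δ, ∀ k, 1 ≤ A (x.2 + x.1 * k)) :
    ∃ κ > 0, ∃ τ₀ > 0, ∀ τ, 0 < τ → τ < τ₀ → ∀ θ, |θ| ≤ Real.pi →
      κ * (θ ^ 2 / (τ * (τ ^ 2 + θ ^ 2))) ≤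
        ∑' N : ℕ, A N * Real.exp (-(N * τ)) * (1 - Real.cos (N * θ)) := by
  have hT : 0 < 2 * m - 1 := by omega
  have mem : ∀ t ∈ W4 m δ, (2 * m - 1, t) ∈ scpParam m δ := fun t ht =>
    Multiset.mem_add.2 (Or.inl (Multiset.mem_map_of_mem _ ht))
  have hTT : ∀ k, 1 ≤ A ((2 * m - 1) * (k + 1)) := fun k => by
    have := h1 _ (mem (2 * m - 1) (Multiset.mem_cons_self _ _)) k
    rwa [show 2 * m - 1 + (2 * m - 1) * k = (2 * m - 1) * (k + 1) by ring] at this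
  have ht : singleElt m δ 1 ∈ W4 m δ := by
    rw [W4_eq]
    exact Multiset.mem_cons_of_mem (Multiset.mem_map_of_mem _
      (Finset.mem_Icc (a := 1) (b := m - 1).2 ⟨le_rfl, by omega⟩))
  by_cases h : δ 1 = -1
  · have e : singleElt m δ 1 = 1 := by rw [singleElt, if_pos h]
    rw [e] at ht
    refine exists_dom hA hs hT (φ := fun k => 1 + (2 * m - 1) * (k + 1)) (fun a b hab => ?_)
      (fun k => Or.inl (add_comm _ _)) hTT fun k => h1 _ (mem 1 ht) (k + 1)
    have := Nat.eq_of_mul_eq_mul_left hT (Nat.add_left_cancel hab)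
    omega
  · have e : singleElt m δ 1 = 2 * m - 2 := by rw [singleElt, if_neg h]
    rw [e] at ht
    refine exists_dom hA hs hT (φ := fun k => (2 * m - 2) + (2 * m - 1) * k) (fun a b hab => ?_)
      (fun k => Or.inr ?_) hTT fun k => h1 _ (mem _ ht) k
    · exact Nat.eq_of_mul_eq_mul_left hT (Nat.add_left_cancel hab)
    · have : 2 * m - 2 + 1 = 2 * m - 1 := by omega
      rw [add_right_comm, this]
      ring

end Assembly

/-- **Theorem 6.4**: for `m ≥ 2` and a profile `δ = (δ_1, …, δ_{m-1})`,
as `n → ∞`,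
`SCP_δ(n) ~ v √(1/(8π)) · r^{b+1/4}/n^{b+3/4} · exp(√(nr))`. -/
theorem asymptotic_symmetric_cylindric_partitions (m : ℕ) (hm : 2 ≤ m)
    (δ : ℕ → ℤ) (hδ : IsProfile (m - 1) δ) :
    Filter.Tendsto
      (fun n : ℕ => (SCPcount m δ n : ℝ) /
        (vSCP m δ * Real.sqrt (1 / (8 * Real.pi)) *
          (rSCP m ^ (bSCP m δ + 1 / 4) / (n : ℝ) ^ (bSCP m δ + 3 / 4)) *
          Real.exp (Real.sqrt ((n : ℝ) * rSCP m))))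
      Filter.atTop (nhds 1) := by
  have hP : ∀ x ∈ scpParam m δ, 0 < x.1 ∧ 0 < x.2 := fun x hx => pos_of_mem_scpParam hm hx
  obtain ⟨A, hA, hA1, hAs⟩ := exists_coeff_multiset_progLog (scpParam m δ) hP
  obtain ⟨κ, hκ, τ₀, hτ₀, hdom⟩ := exists_dom_scpParam hm hA (fun τ hτ => (hAs τ hτ).summable) hA1
  have hlim := tendsto_multiset_progLog (scpParam m δ) hP
  have hr : 0 < rSCP m := by
    have : (2 : ℝ) ≤ m := by exact_mod_cast hm
    have h1 : (0 : ℝ) < 2 * m - 1 := by linarith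
    rw [rSCP]
    positivity
  rw [sum_scpParam_leading δ hm, sum_scpParam_log_coeff δ hm] at hlim
  have main := tendsto_coeff_div hA hAs (fun τ hτ => hasSum_SCPcount hτ hm hδ) hlim
    (by positivity) hκ hτ₀ hdom
  refine main.congr' ?_
  filter_upwards [Filter.eventually_gt_atTop 0] with n hn
  have hn' : (0 : ℝ) < n := by exact_mod_cast hn
  have e1 : 2 * √(rSCP m / 4 * n) = √(n * rSCP m) := by
    rw [show (n : ℝ) * rSCP m = 2 ^ 2 * (rSCP m / 4 * n) by ring,
      Real.sqrt_mul (show (0 : ℝ) ≤ 2 ^ 2 by norm_num), Real.sqrt_sq zero_le_two]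
  have e2 : (rSCP m / 4 / n) ^ (2 * bSCP m δ / 2 + 3 / 4) =
      (rSCP m / 4) ^ (bSCP m δ + 1 / 4) * √(rSCP m / 4) / (n : ℝ) ^ (bSCP m δ + 3 / 4) := by
    rw [mul_div_cancel_left₀ _ two_ne_zero, Real.div_rpow (by positivity) hn'.le,
      Real.sqrt_eq_rpow, ← Real.rpow_add (by positivity)]
    norm_num [add_assoc]
  have e3 : (rSCP m / 4) ^ (bSCP m δ + 1 / 4) * (2 ^ (2 * bSCP m δ) * √2) =
      rSCP m ^ (bSCP m δ + 1 / 4) := by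
    rw [Real.sqrt_eq_rpow, ← Real.rpow_add two_pos, show 2 * bSCP m δ + 1 / 2 =
      2 * (bSCP m δ + 1 / 4) by ring, Real.rpow_mul (by norm_num), ← Real.mul_rpow (by positivity)
      (by positivity)]
    norm_num
  have e4 : √(Real.pi / (rSCP m / 4)) * √(rSCP m / 4) = √Real.pi := by
    rw [← Real.sqrt_mul (by positivity), div_mul_cancel₀ _ (by positivity)]
  have e5 : √(1 / (8 * Real.pi)) * √2 = √Real.pi / (2 * Real.pi) := by
    rw [← Real.sqrt_mul (by positivity), eq_div_iff (by positivity),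
      ← Real.sqrt_sq (show 0 ≤ 2 * Real.pi by positivity), ← Real.sqrt_mul (by positivity)]
    congr 1
    have := Real.pi_pos.ne'
    field_simp
    norm_num
  rw [exp_sum_scpParam_const δ hm, e1, e2, ← e3]
  congr 1
  rw [show vSCP m δ * 2 ^ (2 * bSCP m δ) * √(Real.pi / (rSCP m / 4)) / (2 * Real.pi) *
      ((rSCP m / 4) ^ (bSCP m δ + 1 / 4) * √(rSCP m / 4) / (n : ℝ) ^ (bSCP m δ + 3 / 4)) =
      vSCP m δ * 2 ^ (2 * bSCP m δ) * (√(Real.pi / (rSCP m / 4)) * √(rSCP m / 4)) / (2 * Real.pi) *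
      ((rSCP m / 4) ^ (bSCP m δ + 1 / 4) / (n : ℝ) ^ (bSCP m δ + 3 / 4)) by ring, e4,
    mul_div_assoc _ (√Real.pi), ← e5]
  ring
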